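/- arXiv:math/0209251 — 2 statements merged into one kernel-verified Lean document; each statement's English description precedes it below -/
import Mathlib

section
/- Let (R,m,K)→(S,n,L) be a flat local homomorphism of F-finite reduced Noetherian local rings of prime characteristic p whose closed fiber S/mS is Gorenstein. Assume that R is strongly F-regular and that S/mS is F-rational. Then S is strongly F-regular. -/
open IsLocalRing

/-- The Frobenius power `I^[q]` of an ideal: the ideal generated by the `q`-th powers
of the elements of `I`. -/
def Ideal.frobPow {R : Type*} [CommRing R] (I : Ideal R) (q : ℕ) : Ideal R :=
  Ideal.span ((fun x : R => x ^ q) '' (I : Set R))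

/-- `R°`: the complement in `R` of the union of the minimal primes of `R`. -/
def circComplement (R : Type*) [CommRing R] : Set R :=
  {c : R | ∀ P ∈ minimalPrimes R, c ∉ P}

/-- `x ∈ I*`: tight closure membership (`p` is the characteristic). -/
def MemTightClosure {R : Type*} [CommRing R] (p : ℕ) (I : Ideal R) (x : R) : Prop :=
  ∃ c ∈ circComplement R, ∃ N : ℕ, ∀ e : ℕ, N ≤ e → c * x ^ p ^ e ∈ I.frobPow (p ^ e)

/-- An ideal is tightly closed if `I* = I`. -/
def Ideal.IsTightlyClosed {R : Type*} [CommRing R] (p : ℕ) (I : Ideal R) : Prop :=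
  ∀ x : R, MemTightClosure p I x → x ∈ I

/-- An ideal is Frobenius closed if `x^q ∈ I^[q]` for some `q` implies `x ∈ I`. -/
def Ideal.IsFrobeniusClosed {R : Type*} [CommRing R] (p : ℕ) (I : Ideal R) : Prop :=
  ∀ x : R, (∃ e : ℕ, x ^ p ^ e ∈ I.frobPow (p ^ e)) → x ∈ I

/-- A ring is weakly F-regular if every ideal is tightly closed. -/
def IsWeaklyFRegular (R : Type*) [CommRing R] (p : ℕ) : Prop :=
  ∀ I : Ideal R, I.IsTightlyClosed p

/-- A test element: an element of `R°` that works in every tight closure test. -/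
def IsTestElement {R : Type*} [CommRing R] (p : ℕ) (c : R) : Prop :=
  c ∈ circComplement R ∧
    ∀ (I : Ideal R) (x : R), MemTightClosure p I x → ∀ e : ℕ, c * x ^ p ^ e ∈ I.frobPow (p ^ e)

/-- A (full) system of parameters of a local ring: `dim R` elements of the maximal
ideal generating an ideal whose radical is the maximal ideal. -/
def IsSystemOfParameters (R : Type*) [CommRing R] [IsLocalRing R] {n : ℕ} (x : Fin n → R) : Prop :=
  ringKrullDim R = n ∧ (∀ i, x i ∈ maximalIdeal R) ∧
    maximalIdeal R ≤ (Ideal.span (Set.range x)).radical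

/-- A parameter ideal: an ideal generated by part of a system of parameters. -/
def Ideal.IsParameterIdeal {R : Type*} [CommRing R] [IsLocalRing R] (I : Ideal R) : Prop :=
  ∃ (n k : ℕ) (h : k ≤ n) (x : Fin n → R), IsSystemOfParameters R x ∧
    I = Ideal.span (Set.range fun i : Fin k => x (Fin.castLE h i))

/-- A local ring is F-rational if every parameter ideal is tightly closed. -/
def IsFRational (R : Type*) [CommRing R] [IsLocalRing R] (p : ℕ) : Prop :=
  ∀ I : Ideal R, I.IsParameterIdeal → I.IsTightlyClosed p

/-- A local ring is F-injective if every parameter ideal is Frobenius closed. -/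
def IsFInjective (R : Type*) [CommRing R] [IsLocalRing R] (p : ℕ) : Prop :=
  ∀ I : Ideal R, I.IsParameterIdeal → I.IsFrobeniusClosed p

/-- A local ring is Cohen-Macaulay if some system of parameters is a regular sequence. -/
def IsCohenMacaulayLocalRing (R : Type*) [CommRing R] [IsLocalRing R] : Prop :=
  ∃ (n : ℕ) (x : Fin n → R), IsSystemOfParameters R x ∧
    RingTheory.Sequence.IsRegular R (List.ofFn x)

/-- An irreducible ideal: a proper ideal that is not the intersection of two
strictly larger ideals. -/
def Ideal.IsIrreducible {R : Type*} [CommRing R] (I : Ideal R) : Prop :=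
  I ≠ ⊤ ∧ ∀ A B : Ideal R, I = A ⊓ B → I = A ∨ I = B

/-- A local ring is Gorenstein if it is Cohen-Macaulay and some system of parameters
generates an irreducible ideal. -/
def IsGorensteinLocalRing (R : Type*) [CommRing R] [IsLocalRing R] : Prop :=
  ∃ (n : ℕ) (x : Fin n → R), IsSystemOfParameters R x ∧
    RingTheory.Sequence.IsRegular R (List.ofFn x) ∧
    (Ideal.span (Set.range x)).IsIrreducible

/-- The inclusion `R·c^{1/q} ⊆ R^{1/q}` (with `q = p^e`) splits over `R`: identifying
`R^{1/q}` with `R` via `x^{1/q} ↦ x`, this says there is an additive map `θ : R → R`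
which is `R`-linear for the `q`-th power action and sends `c` to `1`. -/
def FrobSplits {R : Type*} [CommRing R] (p : ℕ) (c : R) (e : ℕ) : Prop :=
  ∃ θ : R →+ R, (∀ a x : R, θ (a ^ p ^ e * x) = a * θ x) ∧ θ c = 1

/-- A reduced ring of characteristic `p` is F-finite if `R^{1/p}` is a finitely
generated `R`-module, i.e. `R` is finitely generated over its subring of `p`-th powers. -/
def IsFFinite (R : Type*) [CommRing R] (p : ℕ) : Prop :=
  ∃ s : Finset R, ∀ x : R, ∃ a : R → R, x = ∑ i ∈ s, a i ^ p * i

/-- An F-finite reduced ring is strongly F-regular if for every `c ∈ R°` there is a `q`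
such that `R·c^{1/q} ⊆ R^{1/q}` splits over `R`. -/
def IsStronglyFRegular (R : Type*) [CommRing R] (p : ℕ) : Prop :=
  ∀ c ∈ circComplement R, ∃ e : ℕ, FrobSplits p c e

theorem mul_eq_zero_of_mem_circComplement {R : Type*} [CommRing R] [IsReduced R] {y x : R}
    (hy : y ∈ circComplement R) (h : y * x = 0) : x = 0 := by
  have : x ∈ nilradical R := by
    rw [nilradical, ← Ideal.sInf_minimalPrimes, Ideal.mem_sInf]
    intro P hP
    have := hP.1.1
    have h0 : y * x ∈ P := by rw [h]; exact P.zero_mem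
    exact (this.mem_or_mem h0).resolve_left (hy P hP)
  simpa [nilradical_eq_zero] using this

theorem exists_mul_eq_zero_of_not_isDomain {R : Type*} [CommRing R] [IsNoetherianRing R]
    [IsReduced R] [Nontrivial R] (h : ¬ IsDomain R) :
    ∃ b b' : R, b ≠ 0 ∧ b' ≠ 0 ∧ b * b' = 0 ∧ b + b' ∈ circComplement R := by
  have hfin : (minimalPrimes R).Finite := minimalPrimes.finite_of_isNoetherianRing R
  obtain ⟨P, hP⟩ : (minimalPrimes R).Nonempty :=
    Set.nonempty_coe_sort.mp (Ideal.nonempty_minimalPrimes bot_ne_top)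
  have hPp : P.IsPrime := hP.1.1
  have key : ∀ Q ∈ minimalPrimes R, Q ≤ P → Q = P := fun Q hQ hle =>
    le_antisymm hle (hP.2 hQ.1 hle)
  have hfin' : (minimalPrimes R \ {P}).Finite := hfin.subset Set.sdiff_subset
  obtain ⟨b', hb', hb'P⟩ : ∃ b' ∈ hfin'.toFinset.inf id, b' ∉ P := by
    by_contra! hle
    obtain ⟨Q, hQ, hQP⟩ := (hPp.inf_le' (s := hfin'.toFinset) (f := id)).1 hle
    simp only [Set.Finite.mem_toFinset, Set.mem_sdiff, Set.mem_singleton_iff] at hQ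
    exact hQ.2 (key Q hQ.1 hQP)
  obtain ⟨b, hb, hbQ⟩ : ∃ b ∈ P, ∀ Q ∈ minimalPrimes R, Q ≠ P → b ∉ Q := by
    by_contra! hle
    have hsub : (P : Set R) ⊆ ⋃ Q ∈ (hfin'.toFinset : Set (Ideal R)), (Q : Set R) := by
      intro x hx
      obtain ⟨Q, hQ, hne, hxQ⟩ := hle x hx
      simp only [Set.mem_iUnion]
      exact ⟨Q, by simpa using ⟨hQ, hne⟩, hxQ⟩
    obtain ⟨Q, hQ, hPQ⟩ := (Ideal.subset_union_prime (f := id) ⊥ ⊥ (by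
      intro Q hQ _ _
      simp only [Set.Finite.mem_toFinset, Set.mem_sdiff, Set.mem_singleton_iff] at hQ
      exact hQ.1.1.1)).1 hsub
    simp only [Set.Finite.mem_toFinset, Set.mem_sdiff, Set.mem_singleton_iff] at hQ
    exact hQ.2 (le_antisymm (hQ.1.2 hP.1 hPQ) hPQ)
  have hb'Q : ∀ Q ∈ minimalPrimes R, Q ≠ P → b' ∈ Q := by
    intro Q hQ hne
    have : hfin'.toFinset.inf id ≤ Q := Finset.inf_le (f := id) (by simpa using ⟨hQ, hne⟩)
    exact this hb'
  have hnil : ∀ x : R, (∀ Q ∈ minimalPrimes R, x ∈ Q) → x = 0 := by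
    intro x hx
    have : x ∈ nilradical R := by
      rw [nilradical, ← Ideal.sInf_minimalPrimes, Ideal.mem_sInf]
      intro Q hQ
      exact hx Q hQ
    simpa [nilradical_eq_zero] using this
  refine ⟨b, b', ?_, ?_, hnil _ ?_, ?_⟩
  · rintro rfl
    have hall : ∀ Q ∈ minimalPrimes R, Q = P := by
      intro Q hQ
      by_contra hne
      exact hbQ Q hQ hne Q.zero_mem
    apply h
    have : P = ⊥ := by
      rw [eq_bot_iff]
      intro x hx
      exact hnil x fun Q hQ => by rwa [hall Q hQ]
    rw [this] at hPp
    have := IsDomain.of_bot_isPrime (A := R)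
    exact this
  · rintro rfl
    exact hb'P P.zero_mem
  · intro Q hQ
    by_cases hne : Q = P
    · subst hne; exact Q.mul_mem_right _ hb
    · exact Q.mul_mem_left _ (hb'Q Q hQ hne)
  · intro Q hQ hmem
    by_cases hne : Q = P
    · subst hne
      exact hb'P ((Ideal.add_mem_iff_right Q hb).1 hmem)
    · exact hbQ Q hQ hne ((Ideal.add_mem_iff_left Q (hb'Q Q hQ hne)).1 hmem)

section FrobeniusInverseLinear

variable {R : Type*} [CommRing R]

/-- The additive endomorphism `θ` is `p⁻ᵉ`-linear. -/
def IsCartierMap (p e : ℕ) (θ : R →+ R) : Prop :=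
  ∀ a x : R, θ (a ^ p ^ e * x) = a * θ x

theorem IsCartierMap.comp_mulLeft {p e : ℕ} {θ : R →+ R} (h : IsCartierMap p e θ) (b : R) :
    IsCartierMap p e (θ.comp (AddMonoidHom.mulLeft b)) := by
  intro a x
  simp only [AddMonoidHom.comp_apply, AddMonoidHom.coe_mulLeft]
  rw [← h, mul_left_comm]

theorem IsCartierMap.comp {p d e : ℕ} {θ ψ : R →+ R} (h : IsCartierMap p d θ)
    (h' : IsCartierMap p e ψ) : IsCartierMap p (d + e) (θ.comp ψ) := by
  intro a x
  simp only [AddMonoidHom.comp_apply]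
  rw [← h, ← h', ← pow_mul, pow_add]

theorem IsCartierMap.mulLeft_comp {p e : ℕ} {θ : R →+ R} (h : IsCartierMap p e θ) (b : R) :
    IsCartierMap p e ((AddMonoidHom.mulLeft b).comp θ) := by
  intro a x
  simp only [AddMonoidHom.comp_apply, AddMonoidHom.coe_mulLeft]
  rw [h, mul_left_comm]

/-- Restriction of a `p⁻ᵉ⁻ᵈ`-linear map along the `d`-th Frobenius. -/
theorem IsCartierMap.exists_restrict {p : ℕ} [Fact p.Prime] [CharP R p] {d e : ℕ} {θ : R →+ R}
    (h : IsCartierMap p (e + d) θ) :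
    ∃ ψ : R →+ R, IsCartierMap p e ψ ∧ ∀ x, ψ x = θ (x ^ p ^ d) := by
  refine ⟨θ.comp (iterateFrobenius R p d : R →+ R), ?_, ?_⟩
  · intro a x
    simp only [AddMonoidHom.comp_apply, AddMonoidHom.coe_coe, iterateFrobenius_def]
    rw [mul_pow, ← pow_mul, ← pow_add, h]
  · intro x
    simp [iterateFrobenius_def]

variable [IsLocalRing R]

variable (R) in
/-- The elements of `R` whose `pᵉ`-th roots do not split off from `R^{1/pᵉ}`. -/
def nonSplitIdeal (p e : ℕ) : Ideal R where
  carrier := {r | ∀ θ : R →+ R, IsCartierMap p e θ → θ r ∈ maximalIdeal R}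
  add_mem' := fun ha hb θ h => by
    rw [map_add]
    exact add_mem (ha θ h) (hb θ h)
  zero_mem' := fun θ _ => by simp
  smul_mem' := fun c x hx θ h => hx _ (h.comp_mulLeft c)

theorem mem_nonSplitIdeal {p e : ℕ} {r : R} :
    r ∈ nonSplitIdeal R p e ↔ ∀ θ : R →+ R, IsCartierMap p e θ → θ r ∈ maximalIdeal R :=
  Iff.rfl

theorem notMem_nonSplitIdeal_iff {p e : ℕ} {r : R} :
    r ∉ nonSplitIdeal R p e ↔ FrobSplits p r e := by
  constructor
  · intro h
    rw [mem_nonSplitIdeal] at h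
    push Not at h
    obtain ⟨θ, hθ, hr⟩ := h
    obtain ⟨u, hu⟩ : IsUnit (θ r) := by simpa using hr
    refine ⟨_, hθ.mulLeft_comp (↑u⁻¹), ?_⟩
    simp [← hu]
  · rintro ⟨θ, hθ, h1⟩ h
    have := h θ hθ
    rw [h1] at this
    exact (Ideal.ne_top_iff_one _).1 (maximalIdeal.isMaximal R).ne_top this

theorem IsCartierMap.map_mem_nonSplitIdeal {p d e : ℕ} {θ : R →+ R} (h : IsCartierMap p d θ)
    {r : R} (hr : r ∈ nonSplitIdeal R p (e + d)) : θ r ∈ nonSplitIdeal R p e :=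
  fun _ hψ => hr _ (hψ.comp h)

omit [IsLocalRing R] in
theorem IsCartierMap.map_mem_of_mem_frobPow {p e : ℕ} {θ : R →+ R} (h : IsCartierMap p e θ)
    {I : Ideal R} {r : R} (hr : r ∈ I.frobPow (p ^ e)) : θ r ∈ I := by
  unfold Ideal.frobPow at hr
  induction hr using Submodule.span_induction generalizing θ with
  | mem x hx =>
    obtain ⟨y, hy, rfl⟩ := hx
    have := h y 1
    simp only [mul_one] at this
    simp only [this]
    exact I.mul_mem_right _ hy
  | zero => simp
  | add x y _ _ hx hy => rw [map_add]; exact add_mem (hx h) (hy h)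
  | smul a x _ hx => exact hx (h.comp_mulLeft a)

theorem frobPow_maximalIdeal_le_nonSplitIdeal (p e : ℕ) :
    (maximalIdeal R).frobPow (p ^ e) ≤ nonSplitIdeal R p e :=
  fun _ hr _ hθ => hθ.map_mem_of_mem_frobPow hr

theorem IsStronglyFRegular.isDomain [IsNoetherianRing R] {p : ℕ} [Fact p.Prime] [IsReduced R]
    (h : IsStronglyFRegular R p) : IsDomain R := by
  by_contra hdom
  obtain ⟨b, b', hb, hb', hbb, hc⟩ := exists_mul_eq_zero_of_not_isDomain hdom
  obtain ⟨e, θ, hθ, h1⟩ := h _ hc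
  have hq : p ^ e ≠ 0 := pow_ne_zero _ (Fact.out : p.Prime).ne_zero
  have key : ∀ x y : R, x * y = 0 → y ≠ 0 → ¬ IsUnit (θ x) := by
    intro x y hxy hy hu
    have := hθ y x
    rw [show y ^ p ^ e * x = 0 by
      rw [← Nat.succ_pred_eq_of_ne_zero hq, pow_succ, mul_assoc, mul_comm y, hxy, mul_zero],
      map_zero] at this
    exact hy ((hu.mul_left_eq_zero).1 this.symm)
  rw [map_add] at h1
  rcases isUnit_or_isUnit_of_add_one h1 with hu | hu
  · exact key _ _ hbb hb' hu
  · exact key _ _ (by rwa [mul_comm]) hb hu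

omit [IsLocalRing R] in
/-- Over an F-finite domain `R^{1/p}` is generically free with dual basis consisting of
`p⁻¹`-linear maps. -/
theorem IsFFinite.exists_isCartierMap [IsDomain R] {p : ℕ} [Fact p.Prime] [CharP R p]
    (h : IsFFinite R p) :
    ∃ c : R, c ≠ 0 ∧ ∃ (t : Finset R) (φ : R → R →+ R), (∀ i, IsCartierMap p 1 (φ i)) ∧
      ∀ x, c ^ p * x = ∑ i ∈ t, φ i x ^ p * i := by
  classical
  obtain ⟨s, hs⟩ := h
  let ind : Finset R → Prop := fun t => ∀ a : R → R, ∑ i ∈ t, a i ^ p * i = 0 → ∀ i ∈ t, a i = 0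
  have hne : ((s.powerset).filter ind).Nonempty :=
    ⟨∅, by simp [ind]⟩
  obtain ⟨t, ht, hmax⟩ := Finset.exists_max_image _ Finset.card hne
  simp only [Finset.mem_filter, Finset.mem_powerset] at ht hmax
  obtain ⟨hts, hti⟩ := ht
  have hp0 : p ≠ 0 := (Fact.out : p.Prime).ne_zero
  have h1 : ∀ j ∈ s, ∃ c : R, c ≠ 0 ∧ ∃ b : R → R, c ^ p * j = ∑ i ∈ t, b i ^ p * i := by
    intro j hj
    by_cases hjt : j ∈ t
    · refine ⟨1, one_ne_zero, fun i => if i = j then 1 else 0, ?_⟩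
      simp [ite_pow, hp0, hjt]
    · have hnot : ¬ ind (insert j t) := by
        intro hind
        have := hmax (insert j t) ⟨Finset.insert_subset hj hts, hind⟩
        rw [Finset.card_insert_of_notMem hjt] at this
        omega
      simp only [ind] at hnot
      push Not at hnot
      obtain ⟨a, ha0, k, hk, hak⟩ := hnot
      rw [Finset.sum_insert hjt] at ha0
      have haj : a j ≠ 0 := by
        intro haj
        rw [haj, zero_pow hp0, zero_mul, zero_add] at ha0
        rcases Finset.mem_insert.1 hk with rfl | hk
        · exact hak haj
        · exact hak (hti a ha0 k hk)
      refine ⟨a j, haj, fun i => - a i, ?_⟩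
      have hneg : ∀ x : R, (-x) ^ p = - x ^ p := fun x => by
        have := map_neg (frobenius R p) x
        simpa [frobenius_def] using this
      simp only [hneg, neg_mul, Finset.sum_neg_distrib]
      exact eq_neg_of_add_eq_zero_left ha0
  choose! d hd0 b hb using h1
  have hc0 : ∏ j ∈ s, d j ≠ 0 := Finset.prod_ne_zero_iff.2 hd0
  set c := ∏ j ∈ s, d j with hc
  have hspan : ∀ x, ∃ a : R → R, c ^ p * x = ∑ i ∈ t, a i ^ p * i := by
    intro x
    obtain ⟨a, rfl⟩ := hs x
    refine ⟨fun i => ∑ j ∈ s, (∏ k ∈ s.erase j, d k) * a j * b j i, ?_⟩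
    have hsum : ∀ i, (∑ j ∈ s, (∏ k ∈ s.erase j, d k) * a j * b j i) ^ p =
        ∑ j ∈ s, ((∏ k ∈ s.erase j, d k) * a j * b j i) ^ p := fun i => by
      have := map_sum (frobenius R p) (fun j => (∏ k ∈ s.erase j, d k) * a j * b j i) s
      simpa only [frobenius_def] using this
    simp only [hsum, Finset.sum_mul]
    rw [Finset.sum_comm, Finset.mul_sum]
    refine Finset.sum_congr rfl fun j hj => ?_
    rw [hc, ← Finset.mul_prod_erase s d hj]
    calc _ = (∏ k ∈ s.erase j, d k) ^ p * a j ^ p * (d j ^ p * j) := by ring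
      _ = _ := by
        rw [hb j hj, Finset.mul_sum]
        refine Finset.sum_congr rfl fun i _ => by ring
  have huniq : ∀ a a' : R → R, ∑ i ∈ t, a i ^ p * i = ∑ i ∈ t, a' i ^ p * i →
      ∀ i ∈ t, a i = a' i := by
    intro a a' haa i hi
    have := hti (fun i => a i - a' i) (by
      simp only [sub_pow_char, sub_mul, Finset.sum_sub_distrib, haa, sub_self]) i hi
    exact sub_eq_zero.1 this
  choose f hf using hspan
  have hadd : ∀ x y, ∀ i ∈ t, f (x + y) i = f x i + f y i := fun x y =>
    huniq (f (x + y)) (fun i => f x i + f y i) (by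
      simp only [add_pow_char, add_mul, Finset.sum_add_distrib, ← hf, mul_add])
  have hmul : ∀ a x, ∀ i ∈ t, f (a ^ p * x) i = a * f x i := fun a x =>
    huniq (f (a ^ p * x)) (fun i => a * f x i) (by
      simp only [mul_pow, mul_assoc, ← Finset.mul_sum, ← hf]
      ring)
  refine ⟨c, hc0, t, fun i => if hi : i ∈ t then
    AddMonoidHom.mk' (fun x => f x i) (fun x y => hadd x y i hi) else 0, ?_, ?_⟩
  · intro i a x
    by_cases hi : i ∈ t
    · simp only [hi, dif_pos, AddMonoidHom.mk'_apply, pow_one]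
      exact hmul a x i hi
    · simp [hi]
  · intro x
    rw [hf x]
    refine Finset.sum_congr rfl fun i hi => ?_
    simp [hi]

end FrobeniusInverseLinear

section FrobeniusInverseLinear

variable {R : Type*} [CommRing R] [IsLocalRing R]

theorem one_notMem_nonSplitIdeal_one [IsNoetherianRing R] [IsReduced R] {p : ℕ} [Fact p.Prime]
    [CharP R p] (hR : IsStronglyFRegular R p) (hf : IsFFinite R p) :
    (1 : R) ∉ nonSplitIdeal R p 1 := by
  have hdom := hR.isDomain
  obtain ⟨c, hc0, t, φ, hφ, hc⟩ := hf.exists_isCartierMap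
  have hp0 : p ≠ 0 := (Fact.out : p.Prime).ne_zero
  by_cases hu : IsUnit c
  · intro h1
    have : c ^ p * 1 ∈ maximalIdeal R := by
      rw [hc]
      refine Ideal.sum_mem _ fun i _ => Ideal.mul_mem_right _ _ ?_
      exact Ideal.pow_mem_of_mem _ (h1 _ (hφ i)) _ (Nat.pos_of_ne_zero hp0)
    rw [mul_one] at this
    exact this (hu.pow p)
  · have hcc : c ∈ circComplement R := by
      intro P hP hcP
      rw [IsDomain.minimalPrimes_eq_singleton_bot, Set.mem_singleton_iff] at hP
      subst hP
      exact hc0 hcP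
    obtain ⟨e, θ, hθ, h1⟩ := hR c hcc
    rcases e with _ | e
    · exfalso
      have := hθ c 1
      simp only [pow_zero, pow_one, mul_one, h1] at this
      exact hu (IsUnit.of_mul_eq_one _ this.symm)
    · have h2 : IsCartierMap p (1 + e) (θ.comp (AddMonoidHom.mulLeft c)) := by
        rw [add_comm]
        exact IsCartierMap.comp_mulLeft hθ c
      obtain ⟨ψ, hψ, hψ1⟩ := h2.exists_restrict
      intro hm
      have := hm ψ hψ
      rw [hψ1] at this
      simp only [one_pow, AddMonoidHom.comp_apply, AddMonoidHom.coe_mulLeft, mul_one, h1] at this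
      exact this isUnit_one

theorem nonSplitIdeal_antitone [IsNoetherianRing R] [IsReduced R] {p : ℕ} [Fact p.Prime]
    [CharP R p] (hR : IsStronglyFRegular R p) (hf : IsFFinite R p) :
    Antitone (nonSplitIdeal R p) := by
  refine antitone_nat_of_succ_le fun e r hr => ?_
  by_contra hn
  rw [notMem_nonSplitIdeal_iff] at hn
  obtain ⟨φ, hφ, h1⟩ := hn
  refine one_notMem_nonSplitIdeal_one hR hf fun θ hθ => ?_
  rw [← h1]
  exact hr _ (by rw [add_comm]; exact hθ.comp hφ)

omit [IsLocalRing R] in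
theorem Ideal.exists_lift_generators {ι : Type*} {c : ι → R} {I K : Ideal R}
    (h : Ideal.span (Set.range c) ≤ I ⊔ K) :
    ∃ c' : ι → R, (∀ i, c' i ∈ I) ∧
      Ideal.span (Set.range c) ≤ Ideal.span (Set.range c') ⊔ K := by
  have : ∀ i, ∃ y ∈ I, ∃ z ∈ K, y + z = c i := fun i =>
    Submodule.mem_sup.1 (h (Ideal.subset_span ⟨i, rfl⟩))
  choose y hy z hz hyz using this
  refine ⟨y, hy, Ideal.span_le.2 ?_⟩
  rintro _ ⟨i, rfl⟩
  exact Submodule.mem_sup.2 ⟨y i, Ideal.subset_span ⟨i, rfl⟩, z i, hz i, hyz i⟩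

omit [IsLocalRing R] in
/-- A decreasing chain of ideals which is eventually constant modulo each power of `m` has, modulo
each power of `m`, a number of generators bounded independently of the power. -/
theorem exists_generators_mod_pow [IsNoetherianRing R] {m : Ideal R} {I : ℕ → Ideal R}
    (hI : Antitone I) (hst : ∀ N, ∃ e₀, ∀ e ≥ e₀, I e₀ ≤ I e ⊔ m ^ N) :
    ∃ (ι : Type) (_ : Fintype ι), ∀ N e₁ : ℕ, ∃ e₀ ≥ e₁, (∀ e, I e₀ ≤ I e ⊔ m ^ N) ∧
      ∃ g : ι → R, (∀ i, g i ∈ I e₀) ∧ I e₀ ≤ Ideal.span (Set.range g) ⊔ m ^ N := by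
  have hst' : ∀ N e₁, ∃ e₀ ≥ e₁, ∀ e, I e₀ ≤ I e ⊔ m ^ N := by
    intro N e₁
    obtain ⟨e₀, he⟩ := hst N
    refine ⟨max e₀ e₁, le_max_right _ _, fun e => ?_⟩
    calc _ ≤ I e₀ := hI (le_max_left _ _)
      _ ≤ I (max e₀ e) ⊔ m ^ N := he _ (le_max_left _ _)
      _ ≤ _ := sup_le_sup_right (hI (le_max_right _ _)) _
  let L : m.Filtration R :=
    { N := fun r => ⨅ e, (I e ⊓ m ^ r ⊔ m ^ (r + 1))
      mono := fun r => by
        refine le_iInf fun e => (iInf_le _ 0).trans (le_sup_of_le_right ?_)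
        exact sup_le inf_le_right (Ideal.pow_le_pow_right (Nat.le_succ _))
      smul_le := fun r => by
        refine le_iInf fun e => (smul_mono_right _ (iInf_le _ e)).trans ?_
        rw [Submodule.smul_sup]
        refine sup_le_sup ?_ ?_
        · refine le_inf ((smul_mono_right _ inf_le_left).trans Submodule.smul_le_right) ?_
          refine (smul_mono_right _ inf_le_right).trans ?_
          rw [smul_eq_mul, pow_succ']
        · rw [smul_eq_mul, pow_succ' m (r + 1)] }
  have hL : ∀ r, L.N r = ⨅ e, (I e ⊓ m ^ r ⊔ m ^ (r + 1)) := fun r => rfl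
  have hstable : L.Stable := by
    refine (m.stableFiltration_stable (⊤ : Submodule R R)).of_le fun r => ?_
    refine (iInf_le _ 0).trans ?_
    have : ((m.stableFiltration (⊤ : Submodule R R)).N r) = m ^ r := by simp
    refine le_of_le_of_eq ?_ this.symm
    exact sup_le inf_le_right (Ideal.pow_le_pow_right (Nat.le_succ _))
  obtain ⟨d, hd⟩ := hstable.exists_pow_smul_eq
  set C : Ideal R := ⨅ e, (I e ⊔ m ^ d) with hC
  obtain ⟨a, c, hc⟩ := Submodule.fg_iff_exists_fin_generating_family.1 (IsNoetherian.noetherian C)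
  obtain ⟨b, f, hf⟩ := Submodule.fg_iff_exists_fin_generating_family.1
    (IsNoetherian.noetherian (L.N d))
  refine ⟨Fin a ⊕ Fin b, inferInstance, fun N e₁ => ?_⟩
  obtain ⟨e₀, he₁, he⟩ := hst' (d + N + 1) e₁
  have hle : ∀ r ≤ d + N, I e₀ ⊓ m ^ r ≤ L.N r := by
    intro r hr
    rw [hL]
    refine le_iInf fun e x hx => ?_
    obtain ⟨y, hy, z, hz, rfl⟩ := Submodule.mem_sup.1 (he e hx.1)
    have hz' : z ∈ m ^ (r + 1) := Ideal.pow_le_pow_right (by omega) hz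
    refine Submodule.mem_sup.2 ⟨y, ⟨hy, ?_⟩, z, hz', rfl⟩
    exact (Ideal.add_mem_iff_left _ (Ideal.pow_le_pow_right (Nat.le_succ _) hz')).1 hx.2
  have hC1 : Ideal.span (Set.range c) ≤ I e₀ ⊔ m ^ d := by
    change Submodule.span R (Set.range c) ≤ _
    rw [hc]; exact iInf_le _ e₀
  have hf1 : Ideal.span (Set.range f) ≤ I e₀ ⊔ m ^ (d + 1) := by
    change Submodule.span R (Set.range f) ≤ _
    rw [hf]; exact (iInf_le _ e₀).trans (sup_le_sup_right inf_le_left _)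
  obtain ⟨c', hc'I, hc'⟩ := Ideal.exists_lift_generators hC1
  obtain ⟨f', hf'I, hf'⟩ := Ideal.exists_lift_generators hf1
  refine ⟨e₀, he₁, fun e => (he e).trans
    (sup_le_sup_left (Ideal.pow_le_pow_right (by omega)) _), Sum.elim c' f', by rintro (i | i) <;> simp [hc'I, hf'I], ?_⟩
  set J := Ideal.span (Set.range (Sum.elim c' f')) with hJ
  have hcJ : Ideal.span (Set.range c') ≤ J :=
    Ideal.span_mono (by rintro _ ⟨i, rfl⟩; exact ⟨Sum.inl i, rfl⟩)
  have hfJ : Ideal.span (Set.range f') ≤ J :=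
    Ideal.span_mono (by rintro _ ⟨i, rfl⟩; exact ⟨Sum.inr i, rfl⟩)
  have hJI : J ≤ I e₀ := Ideal.span_le.2 (by
    rintro _ ⟨i | i, rfl⟩
    · exact hc'I i
    · exact hf'I i)
  have key : ∀ k ≤ N, I e₀ ≤ J ⊔ (I e₀ ⊓ m ^ (d + k)) := by
    intro k
    induction k with
    | zero =>
      intro _
      have h1 : I e₀ ≤ J ⊔ m ^ d := by
        calc I e₀ ≤ C := le_iInf fun e => (he e).trans
              (sup_le_sup_left (Ideal.pow_le_pow_right (by omega)) _)
          _ = Ideal.span (Set.range c) := hc.symm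
          _ ≤ _ := hc'.trans (sup_le_sup_right hcJ _)
      rw [add_zero, inf_comm, ← sup_inf_assoc_of_le _ hJI]
      exact le_inf h1 le_rfl
    | succ k ih =>
      intro hk
      refine (ih (by omega)).trans (sup_le le_sup_left ?_)
      have h1 : I e₀ ⊓ m ^ (d + k) ≤ J ⊔ m ^ (d + (k + 1)) := by
        calc _ ≤ L.N (d + k) := hle _ (by omega)
          _ = m ^ k • L.N d := hd k
          _ ≤ m ^ k • (J ⊔ m ^ (d + 1)) := by
            refine smul_mono_right _ ?_
            rw [← hf]
            exact hf'.trans (sup_le_sup_right hfJ _)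
          _ ≤ _ := by
            rw [Submodule.smul_sup]
            refine sup_le_sup Submodule.smul_le_right ?_
            rw [smul_eq_mul, ← pow_add]
            exact Ideal.pow_le_pow_right (by omega)
      rw [inf_comm _ (m ^ (d + (k + 1))), ← sup_inf_assoc_of_le _ hJI]
      exact le_inf h1 inf_le_left
  exact (key N le_rfl).trans (sup_le_sup_left
    (inf_le_right.trans (Ideal.pow_le_pow_right (by omega))) _)

theorem isArtinianRing_quotient_of_pow_le [IsNoetherianRing R] {I : Ideal R} {k : ℕ}
    (h : maximalIdeal R ^ k ≤ I) : IsArtinianRing (R ⧸ I) := by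
  rcases subsingleton_or_nontrivial (R ⧸ I) with hs | hn
  · infer_instance
  · have hloc : IsLocalRing (R ⧸ I) := .of_surjective' _ Ideal.Quotient.mk_surjective
    rw [isArtinianRing_iff_isNilpotent_maximalIdeal]
    refine ⟨k, ?_⟩
    rw [Ideal.zero_eq_bot, eq_bot_iff]
    have : maximalIdeal (R ⧸ I) ≤ (maximalIdeal R).map (Ideal.Quotient.mk I) := by
      intro x hx
      obtain ⟨y, rfl⟩ := Ideal.Quotient.mk_surjective x
      refine Ideal.mem_map_of_mem _ fun hu => hx (hu.map _)
    refine (Ideal.pow_right_mono this k).trans ?_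
    rw [← Ideal.map_pow, Ideal.map_le_iff_le_comap, ← RingHom.ker_eq_comap_bot, Ideal.mk_ker]
    exact h

theorem exists_le_sup_maximalIdeal_pow [IsNoetherianRing R] {I : ℕ → Ideal R}
    (hI : Antitone I) (N : ℕ) : ∃ e₀, ∀ e ≥ e₀, I e₀ ≤ I e ⊔ maximalIdeal R ^ N := by
  have hart : IsArtinianRing (R ⧸ maximalIdeal R ^ N) :=
    isArtinianRing_quotient_of_pow_le le_rfl
  let f := Ideal.Quotient.mk (maximalIdeal R ^ N)
  obtain ⟨e₀, h⟩ := IsArtinian.monotone_stabilizes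
    (R := R ⧸ maximalIdeal R ^ N) (M := R ⧸ maximalIdeal R ^ N)
    ⟨fun e => OrderDual.toDual ((I e).map f), fun e e' hee => Ideal.map_mono (hI hee)⟩
  refine ⟨e₀, fun e he => ?_⟩
  have h2 : (I e₀).map f = (I e).map f := h e he
  have h3 := Ideal.le_comap_map (I := I e₀) (f := f)
  rwa [h2, Ideal.comap_map_of_surjective _ Ideal.Quotient.mk_surjective, ← RingHom.ker_eq_comap_bot,
    Ideal.mk_ker] at h3

variable (R) in
theorem maximalIdeal_le_radical_frobPow (N : ℕ) (q : ℕ) :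
    maximalIdeal R ≤ ((maximalIdeal R ^ N).frobPow q).radical := by
  intro x hx
  refine ⟨N * q, ?_⟩
  rw [pow_mul]
  exact Ideal.subset_span ⟨_, Ideal.pow_mem_pow hx N, rfl⟩

/-- Chevalley type statement: the ideals `nonSplitIdeal R p e` are cofinal with the powers of the
maximal ideal. -/
theorem exists_nonSplitIdeal_le_pow [IsNoetherianRing R] [IsReduced R] {p : ℕ} [Fact p.Prime]
    [CharP R p] (hR : IsStronglyFRegular R p) (hf : IsFFinite R p) (N : ℕ) :
    ∃ e₀, ∀ e ≥ e₀, nonSplitIdeal R p e ≤ maximalIdeal R ^ N := by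
  classical
  have hanti := nonSplitIdeal_antitone hR hf
  have hdom := hR.isDomain
  have hp : p.Prime := Fact.out
  obtain ⟨c, hc0, t, φ, hφ, hc⟩ := hf.exists_isCartierMap
  set a := c ^ p with ha
  have ha0 : a ≠ 0 := pow_ne_zero _ hc0
  have hmul : ∀ e, ∀ x ∈ nonSplitIdeal R p (e + 1), ∃ y ∈ nonSplitIdeal R p e ^ 2, a * x = y := by
    intro e x hx
    refine ⟨_, ?_, hc x⟩
    refine Ideal.sum_mem _ fun i _ => Ideal.mul_mem_right _ _ ?_
    exact Ideal.pow_le_pow_right hp.two_le (Ideal.pow_mem_pow ((hφ i).map_mem_nonSplitIdeal hx) p)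
  obtain ⟨ι, _, hι⟩ := exists_generators_mod_pow hanti (exists_le_sup_maximalIdeal_pow hanti)
  obtain ⟨e₁, θ, hθ, h1⟩ := hR (a ^ Fintype.card ι) (by
    intro P hP hcP
    rw [IsDomain.minimalPrimes_eq_singleton_bot, Set.mem_singleton_iff] at hP
    subst hP
    exact pow_ne_zero _ ha0 hcP)
  replace hθ : IsCartierMap p e₁ θ := hθ
  obtain ⟨N', hN'⟩ := Ideal.exists_pow_le_of_le_radical_of_fg
    (maximalIdeal_le_radical_frobPow R N (p ^ e₁)) (IsNoetherian.noetherian _)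
  obtain ⟨e₀, he₀, hstab, g, hg, hgen⟩ := hι N' e₁
  let I := nonSplitIdeal R p e₀
  have hag : ∀ i, ∃ b : ι → R, (∀ j, b j ∈ I) ∧ a * g i - ∑ j, b j * g j ∈ maximalIdeal R ^ N' := by
    intro i
    obtain ⟨y, hy, z, hz, hyz⟩ := Submodule.mem_sup.1 (hstab (e₀ + 1) (hg i))
    obtain ⟨w, hw, hyw⟩ := hmul _ _ hy
    have h2 : I ^ 2 ≤ I * Ideal.span (Set.range g) ⊔ maximalIdeal R ^ N' := by
      rw [pow_two]
      refine (Ideal.mul_mono_right hgen).trans ?_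
      rw [Ideal.mul_sup]
      exact sup_le_sup_left Ideal.mul_le_right _
    obtain ⟨u, hu, v, hv, huv⟩ := Submodule.mem_sup.1 (h2 hw)
    rw [← smul_eq_mul, Submodule.mem_ideal_smul_span_iff_exists_sum] at hu
    obtain ⟨b, hb, hbu⟩ := hu
    refine ⟨b, hb, ?_⟩
    rw [Finsupp.sum_fintype _ _ (by simp)] at hbu
    simp only [smul_eq_mul] at hbu
    rw [hbu, ← hyz, mul_add, hyw, ← huv, add_assoc, add_sub_cancel_left]
    exact add_mem hv (Ideal.mul_mem_left _ _ hz)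
  choose b hbI hb using hag
  let M : Matrix ι ι R := Matrix.scalar ι a - Matrix.of b
  have hMg : ∀ i, (M.mulVec g) i ∈ maximalIdeal R ^ N' := by
    intro i
    have := hb i
    simpa [M, Matrix.sub_mulVec, Matrix.mulVec, dotProduct, Matrix.diagonal_apply,
      sub_mul, Finset.sum_sub_distrib] using this
  have hdet : ∀ i, M.det * g i ∈ maximalIdeal R ^ N' := by
    intro i
    have : M.det • g = M.adjugate.mulVec (M.mulVec g) := by
      rw [Matrix.mulVec_mulVec, Matrix.adjugate_mul, Matrix.smul_mulVec, Matrix.one_mulVec]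
    have h2 : M.det * g i = _ := congr_fun this i
    rw [h2]
    exact Ideal.sum_mem _ fun j _ => Ideal.mul_mem_left _ _ (hMg j)
  have hdetI : a ^ Fintype.card ι - M.det ∈ I := by
    rw [← Ideal.Quotient.eq, RingHom.map_det]
    have : (Ideal.Quotient.mk I).mapMatrix M = Matrix.scalar ι (Ideal.Quotient.mk I a) := by
      ext i j
      have := fun i j => Ideal.Quotient.eq_zero_iff_mem.2 (hbI i j)
      by_cases hij : i = j <;> simp [M, this, hij]
    rw [this, map_pow]
    simp
  have hdetx : ∀ x ∈ I, x * M.det ∈ maximalIdeal R ^ N' := by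
    intro x hx
    obtain ⟨y, hy, z, hz, rfl⟩ := Submodule.mem_sup.1 (hgen hx)
    rw [add_mul]
    refine add_mem ?_ (Ideal.mul_mem_right _ _ hz)
    obtain ⟨r, rfl⟩ := (Ideal.mem_span_range_iff_exists_fun).1 hy
    rw [Finset.sum_mul]
    refine Ideal.sum_mem _ fun i _ => ?_
    rw [mul_assoc, mul_comm (g i)]
    exact Ideal.mul_mem_left _ _ (hdet i)
  refine ⟨e₀, fun e he => (hanti he).trans fun x hx => ?_⟩
  have hθu : IsUnit (θ M.det) := by
    have h2 := hanti he₀ hdetI θ hθ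
    rw [map_sub, h1] at h2
    by_contra hu
    have h3 : (1 : R) ∈ maximalIdeal R := by
      simpa using add_mem h2 ((mem_maximalIdeal _).2 hu)
    exact h3 isUnit_one
  have h3 : θ (x ^ p ^ e₁ * M.det) ∈ maximalIdeal R ^ N := hθ.map_mem_of_mem_frobPow (hN' (by
    rw [← Nat.succ_pred_eq_of_ne_zero (pow_ne_zero e₁ hp.ne_zero), pow_succ, mul_assoc]
    exact Ideal.mul_mem_left _ _ (hdetx x hx)))
  rw [hθ] at h3
  exact (Ideal.mul_unit_mem_iff_mem _ hθu).1 h3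

end FrobeniusInverseLinear

section SimpleSocle

/-- `u` generates the socle of the module `X` over the local ring `A`, and the socle is simple. -/
structure IsSocleGenerator (A : Type*) [CommRing A] [IsLocalRing A] {X : Type*} [AddCommGroup X]
    [Module A X] (u : X) : Prop where
  ne_zero : u ≠ 0
  smul_eq_zero : ∀ a ∈ maximalIdeal A, a • u = 0
  mem_span : ∀ x : X, (∀ a ∈ maximalIdeal A, a • x = 0) → x ∈ Submodule.span A {u}

variable {A : Type*} [CommRing A] [IsLocalRing A]

theorem IsLocalRing.length_span_singleton_le_one {X : Type*} [AddCommGroup X] [Module A X] {u : X}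
    (hu : ∀ a ∈ maximalIdeal A, a • u = 0) : Module.length A (Submodule.span A {u}) ≤ 1 := by
  have hs : IsSimpleModule A (A ⧸ maximalIdeal A) :=
    isSimpleModule_iff_isCoatom.2 (maximalIdeal.isMaximal A).out
  rw [← Module.length_eq_one_iff] at hs
  rw [← hs]
  let f : A ⧸ maximalIdeal A →ₗ[A] X := Submodule.liftQ _ (LinearMap.toSpanSingleton A X u)
    (fun a ha => by simpa using hu a ha)
  have hf : ∀ y, f y ∈ Submodule.span A {u} := by
    intro y
    obtain ⟨a, rfl⟩ := Submodule.Quotient.mk_surjective _ y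
    exact Submodule.mem_span_singleton.2 ⟨a, rfl⟩
  refine Module.length_le_of_surjective (f.codRestrict _ hf) ?_
  rintro ⟨x, hx⟩
  obtain ⟨a, rfl⟩ := Submodule.mem_span_singleton.1 hx
  exact ⟨Submodule.Quotient.mk a, rfl⟩

/-- Every nonzero element of a module over a local ring whose maximal ideal is nilpotent has a
nonzero multiple in the socle. -/
theorem IsLocalRing.exists_smul_ne_zero_socle {X : Type*} [AddCommGroup X] [Module A X]
    (hA : IsNilpotent (maximalIdeal A)) {x : X} (hx : x ≠ 0) :
    ∃ b : A, b • x ≠ 0 ∧ ∀ a ∈ maximalIdeal A, a • b • x = 0 := by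
  classical
  obtain ⟨k, hk⟩ := hA
  have hex : ∃ k, ∀ b ∈ maximalIdeal A ^ k, b • x = 0 := ⟨k, fun b hb => by
    rw [hk] at hb
    rw [Ideal.zero_eq_bot, Ideal.mem_bot] at hb
    rw [hb, zero_smul]⟩
  have hmin := Nat.find_spec hex
  have hpos : Nat.find hex ≠ 0 := by
    intro h0
    rw [h0] at hmin
    exact hx (by simpa using hmin 1 (by simp))
  have hlt := Nat.find_min hex (Nat.sub_one_lt hpos)
  push Not at hlt
  obtain ⟨b, hb, hbx⟩ := hlt
  refine ⟨b, hbx, fun a ha => ?_⟩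
  rw [smul_smul]
  refine hmin _ ?_
  rw [← Nat.sub_add_cancel (Nat.one_le_iff_ne_zero.2 hpos), pow_succ']
  exact Ideal.mul_mem_mul ha hb

theorem IsSocleGenerator.exists_smul_eq {X : Type*} [AddCommGroup X] [Module A X] {u : X}
    (hu : IsSocleGenerator A u) (hA : IsNilpotent (maximalIdeal A)) {x : X} (hx : x ≠ 0) :
    ∃ b : A, b • x = u := by
  obtain ⟨b, hbx, hb⟩ := exists_smul_ne_zero_socle hA hx
  obtain ⟨c, hc⟩ := Submodule.mem_span_singleton.1 (hu.mem_span _ hb)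
  have hcu : IsUnit c := by
    by_contra hn
    exact hbx (by rw [← hc, hu.smul_eq_zero c hn])
  obtain ⟨d, rfl⟩ := hcu
  exact ⟨↑d⁻¹ * b, by rw [mul_smul, ← hc, smul_smul]; simp⟩

/-- A nonzero element of a simple module over a local ring is killed by the maximal ideal. -/
theorem IsLocalRing.smul_mem_of_isSimpleModule_quotient {M : Type*} [AddCommGroup M] [Module A M]
    {N : Submodule A M} [IsSimpleModule A (M ⧸ N)] {a : A} (ha : a ∈ maximalIdeal A) (x : M) :
    a • x ∈ N := by
  rw [← Submodule.Quotient.mk_eq_zero, Submodule.Quotient.mk_smul]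
  have h1 := IsSimpleModule.annihilator_isMaximal (R := A) (M := M ⧸ N)
  have h2 := IsLocalRing.eq_maximalIdeal h1
  rw [← h2] at ha
  exact Module.mem_annihilator.1 ha _

omit [IsLocalRing A] in
theorem IsLocalRing.exists_span_sup_eq_top_of_isSimpleModule_quotient {M : Type*} [AddCommGroup M]
    [Module A M] (N : Submodule A M) [IsSimpleModule A (M ⧸ N)] :
    ∃ q : M, q ∉ N ∧ ∀ x, ∃ a : A, x - a • q ∈ N := by
  have := IsSimpleModule.nontrivial A (M ⧸ N)
  obtain ⟨y, hy⟩ := exists_ne (0 : M ⧸ N)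
  obtain ⟨q, rfl⟩ := Submodule.Quotient.mk_surjective _ y
  refine ⟨q, fun h => hy ((Submodule.Quotient.mk_eq_zero _).2 h), fun x => ?_⟩
  have := IsSimpleModule.toSpanSingleton_surjective A hy (Submodule.Quotient.mk x)
  obtain ⟨a, ha⟩ := this
  refine ⟨a, ?_⟩
  rw [← Submodule.Quotient.mk_eq_zero, Submodule.Quotient.mk_sub, ← ha]
  simp

theorem IsSocleGenerator.length_hom_le {X : Type*} [AddCommGroup X] [Module A X] {u : X}
    (hu : IsSocleGenerator A u) {N : Type*} [AddCommGroup N] [Module A N]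
    (hN : IsFiniteLength A N) : Module.length A (N →ₗ[A] X) ≤ Module.length A N := by
  induction hN with
  | of_subsingleton => simp
  | @of_simple_quotient M _ _ N _ hN ih =>
    let f : (M →ₗ[A] X) →ₗ[A] (N →ₗ[A] X) := LinearMap.lcomp A X N.subtype
    have h1 := Module.length_eq_add_of_exact (LinearMap.ker f).subtype f.rangeRestrict
      (Submodule.subtype_injective _) (LinearMap.surjective_rangeRestrict f) (by
        rw [LinearMap.exact_iff]; simp)
    have h2 := Module.length_eq_add_of_exact N.subtype N.mkQ (Submodule.subtype_injective _)
      (Submodule.mkQ_surjective _) (LinearMap.exact_subtype_mkQ N)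
    have h3 : Module.length A (M ⧸ N) = 1 := Module.length_eq_one_iff.2 inferInstance
    have h4 : Module.length A (LinearMap.range f) ≤ Module.length A (N →ₗ[A] X) :=
      Module.length_le_of_injective (LinearMap.range f).subtype (Submodule.subtype_injective _)
    have h5 : Module.length A (LinearMap.ker f) ≤ 1 := by
      refine le_trans ?_ (length_span_singleton_le_one hu.smul_eq_zero)
      obtain ⟨q, hq, hq'⟩ := exists_span_sup_eq_top_of_isSimpleModule_quotient N
      have hker : ∀ g ∈ LinearMap.ker f, ∀ x ∈ N, g x = 0 := fun g hg x hx =>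
        LinearMap.congr_fun (LinearMap.mem_ker.1 hg) ⟨x, hx⟩
      let ev : LinearMap.ker f →ₗ[A] X := (LinearMap.applyₗ q).comp (LinearMap.ker f).subtype
      refine Module.length_le_of_injective (ev.codRestrict (Submodule.span A {u}) ?_) ?_
      · rintro ⟨g, hg⟩
        refine hu.mem_span _ fun a ha => ?_
        change a • g q = 0
        rw [← map_smul]
        exact hker g hg _ (smul_mem_of_isSimpleModule_quotient ha q)
      · rw [← LinearMap.ker_eq_bot, LinearMap.ker_codRestrict, LinearMap.ker_eq_bot']
        rintro ⟨g, hg⟩ h0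
        change g q = 0 at h0
        ext x
        obtain ⟨a, ha⟩ := hq' x
        have := hker g hg _ ha
        rw [map_sub, map_smul, h0, smul_zero, sub_zero] at this
        exact this
    rw [h1, h2, h3, add_comm]
    exact add_le_add (h4.trans ih) h5

end SimpleSocle

section SimpleSocle

variable {A : Type*} [CommRing A] [IsLocalRing A]

theorem isNilpotent_maximalIdeal [IsArtinianRing A] : IsNilpotent (maximalIdeal A) :=
  (isArtinianRing_iff_isNilpotent_maximalIdeal A).1 inferInstance

theorem isFiniteLength_self (A : Type*) [CommRing A] [IsArtinianRing A] : IsFiniteLength A A :=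
  (isArtinianRing_iff_isFiniteLength A).1 inferInstance

theorem IsSocleGenerator.length_le [IsArtinianRing A] {X : Type*} [AddCommGroup X] [Module A X]
    {u : X} (hu : IsSocleGenerator A u) : Module.length A X ≤ Module.length A A := by
  rw [← (LinearMap.ringLmapEquivSelf A A X).length_eq]
  exact hu.length_hom_le (isFiniteLength_self A)

theorem length_self_ne_top (A : Type*) [CommRing A] [IsArtinianRing A] : Module.length A A ≠ ⊤ :=
  Module.length_ne_top_iff.2 (isFiniteLength_self A)

/-- A module with simple socle whose length is maximal among such modules is injective. -/
theorem IsSocleGenerator.baer {A : Type*} [CommRing A] [IsLocalRing A] [IsArtinianRing A]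
    {X : Type*} [AddCommGroup X] [Module A X]
    {u : X} (hu : IsSocleGenerator A u)
    (hmax : ∀ (U : Submodule A (A × X)) (u' : (A × X) ⧸ U), IsSocleGenerator A u' →
      Module.length A ((A × X) ⧸ U) ≤ Module.length A X) :
    Module.Baer A X := by
  have hXfl : IsFiniteLength A X := Module.length_ne_top_iff.1
    (ne_top_of_le_ne_top (length_self_ne_top A) hu.length_le)
  obtain ⟨_, _⟩ := isFiniteLength_iff_isNoetherian_isArtinian.1 hXfl
  intro I g
  let P : Submodule A (A × X) := LinearMap.range (I.subtype.prod (-g))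
  let S : Set (Submodule A (A × X)) := {U | P ≤ U ∧ ∀ x : X, ((0 : A), x) ∈ U → x = 0}
  have hS : S.Nonempty := by
    refine ⟨P, le_rfl, ?_⟩
    rintro x ⟨a, ha⟩
    replace ha := Prod.mk.inj (show ((a : A), -g a) = (0, x) from ha)
    have ha0 : a = 0 := Subtype.ext ha.1
    rw [← ha.2, ha0, map_zero, neg_zero]
  obtain ⟨U, ⟨hPU, hU⟩, hUmax⟩ := WellFounded.has_min
    (wellFounded_gt (α := Submodule A (A × X))) S hS
  let j : X →ₗ[A] (A × X) ⧸ U := U.mkQ.comp (LinearMap.inr A A X)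
  have hj : Function.Injective j := by
    rw [← LinearMap.ker_eq_bot, LinearMap.ker_eq_bot']
    intro x hx
    exact hU x ((Submodule.Quotient.mk_eq_zero _).1 hx)
  have hju : IsSocleGenerator A (j u) := by
    refine ⟨fun h => hu.ne_zero (hj (by rw [h, map_zero])), fun a ha => ?_, fun w hw => ?_⟩
    · rw [← map_smul, hu.smul_eq_zero a ha, map_zero]
    · by_cases hw0 : w = 0
      · rw [hw0]; exact zero_mem _
      obtain ⟨z, rfl⟩ := Submodule.mkQ_surjective _ w
      have hz : U < U ⊔ Submodule.span A {z} := by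
        refine lt_of_le_of_ne le_sup_left fun h => hw0 ?_
        have : z ∈ U := by
          rw [h]; exact Submodule.mem_sup_right (Submodule.mem_span_singleton_self z)
        simpa using this
      have hnot : U ⊔ Submodule.span A {z} ∉ S := fun h => hUmax _ h hz
      have : ∃ x : X, ((0 : A), x) ∈ U ⊔ Submodule.span A {z} ∧ x ≠ 0 := by
        by_contra! hcon
        exact hnot ⟨hPU.trans le_sup_left, hcon⟩
      obtain ⟨x, hx, hx0⟩ := this
      obtain ⟨y, hy, v, hv, hyv⟩ := Submodule.mem_sup.1 hx
      obtain ⟨a, rfl⟩ := Submodule.mem_span_singleton.1 hv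
      have hjx : j x = a • U.mkQ z := by
        change U.mkQ (0, x) = _
        rw [← hyv, map_add, map_smul, add_eq_right]
        simpa using hy
      have hau : IsUnit a := by
        by_contra hn
        rw [hw a hn] at hjx
        exact hx0 (hj (by rw [hjx, map_zero]))
      obtain ⟨d, rfl⟩ := hau
      have hzx : U.mkQ z = j ((↑d⁻¹ : A) • x) := by
        rw [map_smul, hjx, smul_smul]; simp
      rw [hzx] at hw ⊢
      have : (↑d⁻¹ : A) • x ∈ Submodule.span A {u} := hu.mem_span _ fun b hb => by
        apply hj
        rw [map_smul, hw b hb, map_zero]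
      obtain ⟨b, hb⟩ := Submodule.mem_span_singleton.1 this
      rw [← hb, map_smul]
      exact Submodule.smul_mem _ _ (Submodule.mem_span_singleton_self _)
  have hjs : Function.Surjective j := by
    rw [← LinearMap.range_eq_top]
    by_contra hne
    have h1 := Submodule.length_lt hne
    rw [← (LinearEquiv.ofInjective j hj).length_eq] at h1
    exact absurd (hmax U _ hju) (not_le.2 h1)
  let E := LinearEquiv.ofBijective j ⟨hj, hjs⟩
  refine ⟨(E.symm : _ →ₗ[A] X).comp (U.mkQ.comp (LinearMap.inl A A X)), fun x hx => ?_⟩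
  change E.symm (U.mkQ (x, 0)) = _
  rw [LinearEquiv.symm_apply_eq]
  change U.mkQ (x, 0) = U.mkQ (0, g ⟨x, hx⟩)
  rw [← sub_eq_zero, ← map_sub, Submodule.mkQ_apply, Submodule.Quotient.mk_eq_zero]
  exact hPU ⟨⟨x, hx⟩, by simp⟩

theorem Module.Baer.length_le_length_hom {X : Type*} [AddCommGroup X] [Module A X] {u : X}
    (hu : IsSocleGenerator A u) (hX : Module.Baer A X) {N : Type*} [AddCommGroup N] [Module A N]
    (hN : IsFiniteLength A N) : Module.length A N ≤ Module.length A (N →ₗ[A] X) := by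
  induction hN with
  | of_subsingleton => simp
  | @of_simple_quotient M _ _ N _ hN ih =>
    let f : (M →ₗ[A] X) →ₗ[A] (N →ₗ[A] X) := LinearMap.lcomp A X N.subtype
    have hf : Function.Surjective f := fun g => by
      obtain ⟨h, hh⟩ := Module.Baer.extension_property hX N.subtype (Submodule.subtype_injective _) g
      exact ⟨h, hh⟩
    have h1 := Module.length_eq_add_of_exact (LinearMap.ker f).subtype f
      (Submodule.subtype_injective _) hf (by rw [LinearMap.exact_iff]; simp)
    have h2 := Module.length_eq_add_of_exact N.subtype N.mkQ (Submodule.subtype_injective _)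
      (Submodule.mkQ_surjective _) (LinearMap.exact_subtype_mkQ N)
    have h3 : Module.length A (M ⧸ N) = 1 := Module.length_eq_one_iff.2 inferInstance
    have h5 : 1 ≤ Module.length A (LinearMap.ker f) := by
      rw [Order.one_le_iff_pos, Module.length_pos_iff]
      obtain ⟨q, hq, hq'⟩ := exists_span_sup_eq_top_of_isSimpleModule_quotient N
      have hq0 : N.mkQ q ≠ 0 := fun h => hq (by simpa using h)
      have hker : LinearMap.ker (LinearMap.toSpanSingleton A (M ⧸ N) (N.mkQ q)) ≤
          LinearMap.ker (LinearMap.toSpanSingleton A X u) := by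
        intro a ha
        simp only [LinearMap.mem_ker, LinearMap.toSpanSingleton_apply] at ha ⊢
        refine hu.smul_eq_zero a ?_
        by_contra hn
        have : IsUnit a := by simpa using hn
        exact hq0 ((this.smul_eq_zero).1 ha)
      have hsurj : Function.Surjective (LinearMap.toSpanSingleton A (M ⧸ N) (N.mkQ q)) :=
        IsSimpleModule.toSpanSingleton_surjective A hq0
      let ψ : (M ⧸ N) →ₗ[A] X := (Submodule.liftQ _ _ hker).comp
        ((LinearMap.toSpanSingleton A (M ⧸ N) (N.mkQ q)).quotKerEquivOfSurjective
          hsurj).symm.toLinearMap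
      have hψ : ψ (N.mkQ q) = u := by
        have : N.mkQ q = (LinearMap.toSpanSingleton A (M ⧸ N) (N.mkQ q)).quotKerEquivOfSurjective
          hsurj (Submodule.Quotient.mk 1) := (one_smul A (N.mkQ q)).symm
        simp only [ψ, LinearMap.comp_apply, LinearEquiv.coe_coe]
        rw [(LinearEquiv.symm_apply_eq _).2 this]
        exact one_smul A u
      refine ⟨⟨⟨ψ.comp N.mkQ, ?_⟩, 0, fun h => hu.ne_zero ?_⟩⟩
      · rw [LinearMap.mem_ker]
        ext x
        change ψ (N.mkQ x) = 0
        rw [(by simp : N.mkQ x = 0), map_zero]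
      · rw [← hψ]
        exact LinearMap.congr_fun (congrArg Subtype.val h) q
    rw [h1, h2, h3, add_comm]
    exact add_le_add h5 ih

universe u in
/-- Existence of the injective hull of the residue field of an Artinian local ring, together with
its length. -/
theorem exists_isSocleGenerator (A : Type u) [CommRing A] [IsLocalRing A] [IsArtinianRing A] :
    ∃ (V : Type u) (_ : AddCommGroup V) (_ : Module A V) (u : V), IsSocleGenerator A u ∧
      Module.length A V = Module.length A A := by
  classical
  obtain ⟨n, hn⟩ := ENat.ne_top_iff_exists.1 (length_self_ne_top A)
  let T : Set ℕ := {k | ∃ (V : Type u) (_ : AddCommGroup V) (_ : Module A V) (u : V),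
    IsSocleGenerator A u ∧ Module.length A V = k}
  have hbd : ∀ (V : Type u) (_ : AddCommGroup V) (_ : Module A V) (u : V),
    IsSocleGenerator A u → ∃ k ∈ T, Module.length A V = k := by
    intro V _ _ u hu
    obtain ⟨k, hk⟩ := ENat.ne_top_iff_exists.1
      (ne_top_of_le_ne_top (length_self_ne_top A) hu.length_le)
    exact ⟨k, ⟨V, _, _, u, hu, hk.symm⟩, hk.symm⟩
  have hTb : ∀ k ∈ T, k ≤ n := by
    rintro k ⟨V, _, _, u, hu, hk⟩
    have := hu.length_le
    rw [hk, ← hn] at this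
    exact_mod_cast this
  have hTne : T.Nonempty := by
    have hk : IsSocleGenerator A (1 : ResidueField A) := by
      refine ⟨one_ne_zero, fun a ha => ?_, fun x _ => ?_⟩
      · rw [Algebra.smul_def, mul_one]
        exact (residue_eq_zero_iff a).2 ha
      · obtain ⟨a, rfl⟩ := residue_surjective x
        refine Submodule.mem_span_singleton.2 ⟨a, ?_⟩
        rw [Algebra.smul_def, mul_one]; rfl
    obtain ⟨k, hk, _⟩ := hbd _ _ _ _ hk
    exact ⟨k, hk⟩
  obtain ⟨k, hkT, hkmax⟩ : ∃ k ∈ T, ∀ l ∈ T, l ≤ k := by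
    have hfin : T.Finite := (Set.finite_Iic n).subset hTb
    exact ⟨_, hTne.csSup_mem hfin, fun l hl => le_csSup hfin.bddAbove hl⟩
  obtain ⟨V, _, _, u, hu, hVk⟩ := hkT
  refine ⟨V, _, _, u, hu, le_antisymm hu.length_le ?_⟩
  have hB : Module.Baer A V := hu.baer fun U u' hu' => by
    obtain ⟨l, hl, hl'⟩ := hbd _ _ _ _ hu'
    rw [hl', hVk]
    exact_mod_cast hkmax l hl
  rw [← (LinearMap.ringLmapEquivSelf A A V).length_eq]
  exact hB.length_le_length_hom hu (isFiniteLength_self A)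

end SimpleSocle

section FlatSocle

open TensorProduct

/-- Over a flat algebra the annihilator of `1 ⊗ v` is extended from the annihilator of `v`. -/
theorem mem_map_torsionOf_of_tmul_eq_zero {A B V : Type*} [CommRing A] [CommRing B] [Algebra A B]
    [Module.Flat A B] [AddCommGroup V] [Module A V] {b : B} {v : V} (h : b ⊗ₜ[A] v = 0) :
    b ∈ (Ideal.torsionOf A V v).map (algebraMap A B) := by
  have hex : Function.Exact (Ideal.torsionOf A V v).subtype (LinearMap.toSpanSingleton A V v) :=
    LinearMap.exact_iff.2 (by rw [Submodule.range_subtype]; rfl)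
  obtain ⟨y, hy⟩ := (Module.Flat.lTensor_exact B hex (b ⊗ₜ[A] (1 : A))).1 (by simpa using h)
  have hb : b = TensorProduct.rid A B (LinearMap.lTensor B (Ideal.torsionOf A V v).subtype y) := by
    rw [hy]; simp
  rw [hb]
  clear hy hb
  induction y with
  | zero => simp
  | add x y hx hy => rw [map_add, map_add]; exact add_mem hx hy
  | tmul s i =>
    simp only [LinearMap.lTensor_tmul, Submodule.subtype_apply, TensorProduct.rid_tmul]
    rw [Algebra.smul_def]
    exact Ideal.mul_mem_right _ _ (Ideal.mem_map_of_mem _ i.2)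

/-- Over a flat algebra the elements of `B ⊗ V` killed by a finitely generated ideal of `A` come
from the elements of `V` killed by it. -/
theorem exists_eq_tmul_of_forall_smul_eq_zero {A B V : Type*} [CommRing A] [CommRing B]
    [Algebra A B] [Module.Flat A B] [AddCommGroup V] [Module A V] {I : Ideal A} (hI : I.FG) {u : V}
    (hu : ∀ x : V, (∀ a ∈ I, a • x = 0) → x ∈ Submodule.span A {u})
    (hu' : ∀ a ∈ I, a • u = 0) (y : B ⊗[A] V)
    (hy : ∀ a ∈ I, a • y = 0) : ∃ b : B, y = b ⊗ₜ[A] u := by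
  classical
  obtain ⟨s, rfl⟩ := hI
  let f : V →ₗ[A] s → V := LinearMap.pi fun i => LinearMap.lsmul A V i.1
  have hex : Function.Exact (Submodule.span A {u}).subtype f := by
    rw [LinearMap.exact_iff, Submodule.range_subtype]
    refine le_antisymm (fun x hx => hu x fun a ha => ?_) ?_
    · have : Ideal.span (s : Set A) ≤ Ideal.torsionOf A V x := Ideal.span_le.2 fun b hb =>
        (Ideal.mem_torsionOf_iff _ _).2 (congrFun hx ⟨b, hb⟩)
      exact (Ideal.mem_torsionOf_iff _ _).1 (this ha)
    · rw [Submodule.span_singleton_le_iff_mem]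
      exact funext fun i => hu' _ (Ideal.subset_span i.2)
  have hpi : ∀ z : B ⊗[A] V, ∀ i : s,
      TensorProduct.piRight A A B (fun _ : s => V) (LinearMap.lTensor B f z) i = i.1 • z := by
    intro z i
    induction z with
    | zero => simp
    | add x y hx hy => rw [map_add, map_add, Pi.add_apply, hx, hy, smul_add]
    | tmul b v => simp [f]
  obtain ⟨z, rfl⟩ := (Module.Flat.lTensor_exact B hex y).1 <|
    (TensorProduct.piRight A A B (fun _ : s => V)).injective <| by
      rw [map_zero]
      exact funext fun i => (hpi y i).trans (hy _ (Ideal.subset_span i.2))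
  clear hy
  induction z with
  | zero => exact ⟨0, by simp⟩
  | add x y hx hy =>
    obtain ⟨b, hb⟩ := hx
    obtain ⟨b', hb'⟩ := hy
    exact ⟨b + b', by rw [map_add, hb, hb', TensorProduct.add_tmul]⟩
  | tmul b v =>
    obtain ⟨a, ha⟩ := Submodule.mem_span_singleton.1 v.2
    refine ⟨a • b, ?_⟩
    rw [LinearMap.lTensor_tmul, Submodule.subtype_apply, ← ha, TensorProduct.tmul_smul,
      TensorProduct.smul_tmul']

variable {A B V : Type*} [CommRing A] [IsLocalRing A] [CommRing B] [Algebra A B]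
  [AddCommGroup V] [Module A V]

theorem IsSocleGenerator.tmul_eq_zero {u : V} (hu : IsSocleGenerator A u) {b : B}
    (hb : b ∈ (maximalIdeal A).map (algebraMap A B)) : b ⊗ₜ[A] u = 0 := by
  induction hb using Submodule.span_induction with
  | mem x hx =>
    obtain ⟨a, ha, rfl⟩ := hx
    rw [Algebra.algebraMap_eq_smul_one, TensorProduct.smul_tmul, hu.smul_eq_zero a ha,
      TensorProduct.tmul_zero]
  | zero => rw [TensorProduct.zero_tmul]
  | add x y _ _ hx hy => rw [TensorProduct.add_tmul, hx, hy, add_zero]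
  | smul c x _ hx => rw [← TensorProduct.smul_tmul', hx, smul_zero]

theorem IsSocleGenerator.mem_map_of_tmul_eq_zero [Module.Flat A B] {u : V}
    (hu : IsSocleGenerator A u) {b : B} (hb : b ⊗ₜ[A] u = 0) :
    b ∈ (maximalIdeal A).map (algebraMap A B) := by
  refine Ideal.map_mono (le_maximalIdeal fun h => hu.ne_zero ?_) (mem_map_torsionOf_of_tmul_eq_zero hb)
  simpa using (Ideal.mem_torsionOf_iff u (1 : A)).1 (h ▸ Submodule.mem_top)

/-- If `w` generates the socle of the closed fibre then `w ⊗ u` generates the socle of `B ⊗ V`. -/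
theorem IsSocleGenerator.tmul [IsNoetherianRing A] [IsLocalRing B] [Module.Flat A B] [IsLocalHom (algebraMap A B)]
    {u : V}
    (hu : IsSocleGenerator A u) {w : B} (hw : w ∉ (maximalIdeal A).map (algebraMap A B))
    (hw1 : ∀ s ∈ maximalIdeal B, s * w ∈ (maximalIdeal A).map (algebraMap A B))
    (hw2 : ∀ b : B, (∀ s ∈ maximalIdeal B, s * b ∈ (maximalIdeal A).map (algebraMap A B)) →
      b ∈ Ideal.span {w} ⊔ (maximalIdeal A).map (algebraMap A B)) :
    IsSocleGenerator B (w ⊗ₜ[A] u) := by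
  refine ⟨fun h => hw (hu.mem_map_of_tmul_eq_zero h), fun s hs => ?_, fun y hy => ?_⟩
  · rw [TensorProduct.smul_tmul', smul_eq_mul]
    exact hu.tmul_eq_zero (hw1 s hs)
  · obtain ⟨b, rfl⟩ := exists_eq_tmul_of_forall_smul_eq_zero
      (IsNoetherian.noetherian (maximalIdeal A)) hu.mem_span hu.smul_eq_zero y fun a ha => by
        rw [← algebraMap_smul B a y]
        exact hy _ (map_nonunit (algebraMap A B) a ha)
    obtain ⟨c, hc, t, ht, rfl⟩ := Submodule.mem_sup.1 (hw2 b fun s hs =>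
      hu.mem_map_of_tmul_eq_zero (by
        rw [← smul_eq_mul, ← TensorProduct.smul_tmul']; exact hy s hs))
    obtain ⟨s, rfl⟩ := Ideal.mem_span_singleton'.1 hc
    rw [TensorProduct.add_tmul, hu.tmul_eq_zero ht, add_zero, ← smul_eq_mul,
      ← TensorProduct.smul_tmul']
    exact Submodule.smul_mem _ _ (Submodule.mem_span_singleton_self _)

/-- Length is multiplicative along flat local base change. -/
theorem length_tensorProduct_eq_mul [Module.Flat A B] {N : Type*} [AddCommGroup N] [Module A N]
    (hN : IsFiniteLength A N) : Module.length B (B ⊗[A] N) =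
      Module.length A N * Module.length B (B ⊗[A] (A ⧸ maximalIdeal A)) := by
  induction hN with
  | of_subsingleton => rw [Module.length_eq_zero, Module.length_eq_zero, zero_mul]
  | @of_simple_quotient M _ _ N hs hN ih =>
    have h1 := Module.length_eq_add_of_exact N.subtype N.mkQ (Submodule.subtype_injective _)
      (Submodule.mkQ_surjective _) (LinearMap.exact_subtype_mkQ N)
    rw [Module.length_eq_one_iff.2 hs] at h1
    have h2 := Module.length_eq_add_of_exact (R := B)
      (TensorProduct.AlgebraTensorModule.lTensor B B N.subtype)
      (TensorProduct.AlgebraTensorModule.lTensor B B N.mkQ)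
      (Module.Flat.lTensor_preserves_injective_linearMap _ (Submodule.subtype_injective _))
      (LinearMap.lTensor_surjective _ (Submodule.mkQ_surjective _))
      (lTensor_exact B (LinearMap.exact_subtype_mkQ N) (Submodule.mkQ_surjective _))
    obtain ⟨I, hI, ⟨e⟩⟩ := isSimpleModule_iff_quot_maximal.1 hs
    obtain rfl := eq_maximalIdeal hI
    rw [h2, h1, ih, add_mul, one_mul,
      (TensorProduct.AlgebraTensorModule.congr (LinearEquiv.refl B B) e).length_eq]

theorem length_tensorProduct_eq [IsArtinianRing A] [Module.Flat A B]
    (hV : Module.length A V = Module.length A A) :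
    Module.length B (B ⊗[A] V) = Module.length B B := by
  have hV' : IsFiniteLength A V := Module.length_ne_top_iff.1 (hV ▸ length_self_ne_top A)
  rw [length_tensorProduct_eq_mul hV', hV, ← length_tensorProduct_eq_mul (isFiniteLength_self A),
    (TensorProduct.AlgebraTensorModule.rid A B B).length_eq]

end FlatSocle

section Splitting

open TensorProduct

variable {B E : Type*} [CommRing B] [IsLocalRing B] [IsArtinianRing B] [AddCommGroup E] [Module B E]

theorem IsSocleGenerator.baer_of_length_eq {u : E} (hu : IsSocleGenerator B u)
    (hE : Module.length B E = Module.length B B) : Module.Baer B E :=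
  hu.baer fun _ _ hu' => hE ▸ hu'.length_le

theorem IsSocleGenerator.eq_zero_of_forall_smul_eq_zero {u : E} (hu : IsSocleGenerator B u)
    (hE : Module.length B E = Module.length B B) {b : B} (hb : ∀ x : E, b • x = 0) : b = 0 := by
  by_contra hb0
  have hI : Ideal.span {b} ≠ ⊥ := by rwa [Ne, Ideal.span_singleton_eq_bot]
  have hfl : IsFiniteLength B (B ⧸ Ideal.span {b}) := Module.length_ne_top_iff.1 <|
    ne_top_of_le_ne_top (length_self_ne_top B)
      (Module.length_le_of_surjective (Ideal.span {b}).mkQ (Submodule.mkQ_surjective _))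
  let ev : ((B ⧸ Ideal.span {b}) →ₗ[B] E) →ₗ[B] E :=
    LinearMap.applyₗ ((Ideal.span {b}).mkQ 1)
  have hev : Function.Surjective ev := fun x => by
    refine ⟨Submodule.liftQ _ (LinearMap.toSpanSingleton B E x) ?_, ?_⟩
    · rw [Ideal.span, Submodule.span_singleton_le_iff_mem]
      exact hb x
    · exact one_smul B x
  have h1 := (Module.length_le_of_surjective ev hev).trans (hu.length_hom_le hfl)
  have h2 := Module.length_eq_add_of_exact (Ideal.span {b}).subtype (Ideal.span {b}).mkQ
    (Submodule.subtype_injective _) (Submodule.mkQ_surjective _)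
    (LinearMap.exact_subtype_mkQ (Ideal.span {b}))
  have h3 : Module.length B (Ideal.span {b}) ≠ 0 := fun h => hI <|
    (Submodule.subsingleton_iff_eq_bot).1 (Module.length_eq_zero_iff.1 h)
  have h4 := length_self_ne_top B
  rw [hE, h2] at h1
  have h5 := Module.length_ne_top_iff.2 hfl
  exact h3 (by
    have := (ENat.add_le_add_iff_right h5).1 (h1.trans_eq (zero_add _).symm)
    exact le_antisymm this bot_le)

/-- Endomorphisms of the injective hull of the residue field are multiplications. -/
theorem IsSocleGenerator.exists_eq_smul {u : E} (hu : IsSocleGenerator B u)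
    (hE : Module.length B E = Module.length B B) (f : E →ₗ[B] E) :
    ∃! b : B, ∀ x, f x = b • x := by
  let m : B →ₗ[B] (E →ₗ[B] E) := LinearMap.lsmul B E
  have hm : Function.Injective m := by
    rw [← LinearMap.ker_eq_bot, LinearMap.ker_eq_bot']
    exact fun b hb => hu.eq_zero_of_forall_smul_eq_zero hE fun x => LinearMap.congr_fun hb x
  have hEfl : IsFiniteLength B E := Module.length_ne_top_iff.1 (hE ▸ length_self_ne_top B)
  have hle := hE ▸ hu.length_hom_le hEfl
  have hsurj : LinearMap.range m = ⊤ := by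
    by_contra hne
    have hfl : IsFiniteLength B (E →ₗ[B] E) := Module.length_ne_top_iff.1
      (ne_top_of_le_ne_top (length_self_ne_top B) hle)
    obtain ⟨_, _⟩ := isFiniteLength_iff_isNoetherian_isArtinian.1 hfl
    have h1 := Submodule.length_lt hne
    rw [← (LinearEquiv.ofInjective m hm).length_eq] at h1
    exact absurd hle (not_le.2 h1)
  obtain ⟨b, hb⟩ := LinearMap.range_eq_top.1 hsurj f
  refine ⟨b, fun x => (LinearMap.congr_fun hb x).symm, fun b' hb' => hm ?_⟩
  rw [hb]
  exact (LinearMap.ext hb').symm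

/-- A module element which does not kill the socle of the injective hull of the residue field
generates a free direct summand. -/
theorem IsSocleGenerator.exists_linearMap_eq_one {u : E} (hu : IsSocleGenerator B u)
    (hE : Module.length B E = Module.length B B) {M : Type*} [AddCommGroup M] [Module B M] {x : M}
    (hx : x ⊗ₜ[B] u ≠ 0) : ∃ φ : M →ₗ[B] B, φ x = 1 := by
  let j : E →ₗ[B] M ⊗[B] E := TensorProduct.mk B M E x
  have hj : Function.Injective j := by
    rw [← LinearMap.ker_eq_bot, LinearMap.ker_eq_bot']
    intro y hy
    by_contra hy0
    obtain ⟨b, hb⟩ := hu.exists_smul_eq isNilpotent_maximalIdeal hy0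
    apply hx
    change j u = 0
    rw [← hb, map_smul, hy, smul_zero]
  obtain ⟨g, hg⟩ := (hu.baer_of_length_eq hE).extension_property j hj LinearMap.id
  choose φ hφ hφ' using fun m : M => hu.exists_eq_smul hE (g.comp (TensorProduct.mk B M E m))
  refine ⟨⟨⟨φ, fun m m' => ?_⟩, fun b m => ?_⟩, ?_⟩
  · refine (hφ' _ _ fun y => ?_).symm
    rw [map_add, add_smul, ← hφ, ← hφ]
    simp
  · refine (hφ' _ _ fun y => ?_).symm
    rw [RingHom.id_apply, smul_eq_mul, mul_smul, ← hφ]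
    simp
  · refine (hφ' _ _ fun y => ?_).symm
    rw [one_smul]
    exact LinearMap.congr_fun hg y

end Splitting

section FrobeniusSquare

open TensorProduct

theorem mem_map_torsionOf_of_tmul_tmul_eq_zero {A B A₂ B₂ V : Type*} [CommRing A] [CommRing B]
    [CommRing A₂] [CommRing B₂] [Algebra A B] [Algebra A A₂] [Algebra A B₂] [Algebra B B₂]
    [Algebra A₂ B₂] [IsScalarTower A B B₂] [IsScalarTower A A₂ B₂] [Module.Flat A₂ B₂]
    [AddCommGroup V] [Module A V] {u : V} {w : B} {c : B₂}
    (h : c ⊗ₜ[B] (w ⊗ₜ[A] u : B ⊗[A] V) = 0) :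
    c * algebraMap B B₂ w ∈
      (Ideal.torsionOf A₂ (A₂ ⊗[A] V) ((1 : A₂) ⊗ₜ[A] u)).map (algebraMap A₂ B₂) := by
  apply mem_map_torsionOf_of_tmul_eq_zero
  apply (TensorProduct.AlgebraTensorModule.cancelBaseChange A A₂ B₂ B₂ V).injective
  rw [map_zero, TensorProduct.AlgebraTensorModule.cancelBaseChange_tmul, one_smul]
  have h1 := congrArg (TensorProduct.AlgebraTensorModule.cancelBaseChange A B B₂ B₂ V) h
  rw [map_zero, TensorProduct.AlgebraTensorModule.cancelBaseChange_tmul, Algebra.smul_def] at h1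
  rw [mul_comm]
  exact h1

variable {R T T₂ : Type*} [CommRing R] [CommRing T] [CommRing T₂] [Algebra R T] [Algebra R T₂]

theorem flat_quotient_map (R T : Type*) [CommRing R] [CommRing T] [Algebra R T] [Module.Flat R T]
    (J : Ideal R) : Module.Flat (R ⧸ J) (T ⧸ J.map (algebraMap R T)) :=
  Module.Flat.of_linearEquiv
    (Algebra.TensorProduct.quotIdealMapEquivQuotTensor T J).toLinearEquiv

theorem mk_mem_map_maximalIdeal_iff [IsLocalRing R] {J : Ideal R} [IsLocalRing (R ⧸ J)]
    (hJ : J ≤ maximalIdeal R) {t : T} :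
    Ideal.Quotient.mk (J.map (algebraMap R T)) t ∈
      (maximalIdeal (R ⧸ J)).map (algebraMap (R ⧸ J) (T ⧸ J.map (algebraMap R T))) ↔
      t ∈ (maximalIdeal R).map (algebraMap R T) := by
  rw [← IsLocalRing.map_maximalIdeal_of_surjective (Ideal.Quotient.mk J)
    Ideal.Quotient.mk_surjective, Ideal.map_map]
  change _ ∈ (maximalIdeal R).map ((Ideal.Quotient.mk (J.map (algebraMap R T))).comp
    (algebraMap R T)) ↔ _
  rw [← Ideal.map_map, Ideal.mem_quotient_iff_mem (Ideal.map_mono hJ)]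

/-- The dichotomy behind the splitting criterion: either `c` splits off the Frobenius pushforward
of the Artinian algebra `T₂`, or `c` multiplies the Frobenius image of a socle generator into the
extension of the non-splitting ideal of `R`. -/
theorem exists_addMonoidHom_eq_one_or_mem (p e : ℕ) [Fact p.Prime] [CharP R p]
    [IsLocalRing R] [IsNoetherianRing R] [IsLocalRing T] [IsNoetherianRing T]
    [Module.Flat R T] [Module.Flat R T₂] [IsLocalHom (algebraMap R T)]
    (F : T →+* T₂) (hF : ∀ r : R, F (algebraMap R T r) = algebraMap R T₂ (r ^ p ^ e))
    {J : Ideal R} (hJ : J ≤ maximalIdeal R) {k l : ℕ} (hk : maximalIdeal R ^ k ≤ J)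
    (hl : maximalIdeal T ^ l ≤ J.map (algebraMap R T))
    {w : T} (hw : w ∉ (maximalIdeal R).map (algebraMap R T))
    (hw1 : ∀ s ∈ maximalIdeal T, s * w ∈ (maximalIdeal R).map (algebraMap R T))
    (hw2 : ∀ b : T, (∀ s ∈ maximalIdeal T, s * b ∈ (maximalIdeal R).map (algebraMap R T)) →
      b ∈ Ideal.span {w} ⊔ (maximalIdeal R).map (algebraMap R T)) (c : T₂) :
    (∃ θ : T₂ →+ T ⧸ J.map (algebraMap R T),
      (∀ t x, θ (F t * x) = Ideal.Quotient.mk _ t * θ x) ∧ θ c = 1) ∨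
    c * F w ∈ (nonSplitIdeal R p e).map (algebraMap R T₂) := by
  have hJtop : J ≠ ⊤ := fun h => (maximalIdeal.isMaximal R).ne_top (top_le_iff.1 (h ▸ hJ))
  have hJT : J.map (algebraMap R T) ≤ (maximalIdeal R).map (algebraMap R T) := Ideal.map_mono hJ
  have hJTtop : J.map (algebraMap R T) ≠ ⊤ := fun h => hw (hJT (h ▸ Submodule.mem_top))
  have _ : Nontrivial (R ⧸ J) := Ideal.Quotient.nontrivial_iff.2 hJtop
  have _ : Nontrivial (T ⧸ J.map (algebraMap R T)) := Ideal.Quotient.nontrivial_iff.2 hJTtop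
  have _ : IsLocalRing (R ⧸ J) :=
    IsLocalRing.of_surjective' (Ideal.Quotient.mk J) Ideal.Quotient.mk_surjective
  have _ : IsLocalRing (T ⧸ J.map (algebraMap R T)) :=
    IsLocalRing.of_surjective' (Ideal.Quotient.mk _) Ideal.Quotient.mk_surjective
  have _ : IsArtinianRing (R ⧸ J) := isArtinianRing_quotient_of_pow_le hk
  have _ : IsArtinianRing (T ⧸ J.map (algebraMap R T)) := isArtinianRing_quotient_of_pow_le hl
  have _ := flat_quotient_map R T J
  let J₂ : Ideal R := J.frobPow (p ^ e)
  have _ := flat_quotient_map R T₂ J₂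
  have hmax : maximalIdeal (T ⧸ J.map (algebraMap R T)) =
      (maximalIdeal T).map (Ideal.Quotient.mk (J.map (algebraMap R T))) :=
    (IsLocalRing.map_maximalIdeal_of_surjective _ Ideal.Quotient.mk_surjective).symm
  have _ : IsLocalHom (algebraMap (R ⧸ J) (T ⧸ J.map (algebraMap R T))) := by
    refine ((local_hom_TFAE _).out 0 2).2 ?_
    rw [← IsLocalRing.map_maximalIdeal_of_surjective (Ideal.Quotient.mk J)
      Ideal.Quotient.mk_surjective, Ideal.map_map, Ideal.map_le_iff_le_comap]
    intro r hr
    rw [Ideal.mem_comap, hmax]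
    exact Ideal.mem_map_of_mem _ (map_nonunit (algebraMap R T) r hr)
  have hA : J ≤ J₂.comap (iterateFrobenius R p e) := fun r hr =>
    Ideal.subset_span ⟨r, hr, rfl⟩
  have hB : J.map (algebraMap R T) ≤ (J₂.map (algebraMap R T₂)).comap F := by
    rw [Ideal.map_le_iff_le_comap]
    intro r hr
    rw [Ideal.mem_comap, Ideal.mem_comap, hF]
    exact Ideal.mem_map_of_mem _ (hA hr)
  let fA : R ⧸ J →+* R ⧸ J₂ := Ideal.quotientMap J₂ (iterateFrobenius R p e) hA
  let fB : T ⧸ J.map (algebraMap R T) →+* T₂ ⧸ J₂.map (algebraMap R T₂) :=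
    Ideal.quotientMap _ F hB
  let _ : Algebra (R ⧸ J) (R ⧸ J₂) := fA.toAlgebra
  let _ : Algebra (T ⧸ J.map (algebraMap R T)) (T₂ ⧸ J₂.map (algebraMap R T₂)) := fB.toAlgebra
  let _ : Algebra (R ⧸ J) (T₂ ⧸ J₂.map (algebraMap R T₂)) :=
    (fB.comp (algebraMap (R ⧸ J) (T ⧸ J.map (algebraMap R T)))).toAlgebra
  have _ : IsScalarTower (R ⧸ J) (T ⧸ J.map (algebraMap R T)) (T₂ ⧸ J₂.map (algebraMap R T₂)) :=
    IsScalarTower.of_algebraMap_eq' rfl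
  have _ : IsScalarTower (R ⧸ J) (R ⧸ J₂) (T₂ ⧸ J₂.map (algebraMap R T₂)) := by
    refine IsScalarTower.of_algebraMap_eq fun x => ?_
    obtain ⟨r, rfl⟩ := Ideal.Quotient.mk_surjective x
    exact congrArg (Ideal.Quotient.mk _) (hF r)
  obtain ⟨V, _, _, u, hu, hV⟩ := exists_isSocleGenerator (R ⧸ J)
  let w' : T ⧸ J.map (algebraMap R T) := Ideal.Quotient.mk _ w
  have hmul : ∀ b : T, (∀ s ∈ maximalIdeal (T ⧸ J.map (algebraMap R T)),
      s * Ideal.Quotient.mk _ b ∈ (maximalIdeal (R ⧸ J)).map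
        (algebraMap (R ⧸ J) (T ⧸ J.map (algebraMap R T)))) ↔
      ∀ s ∈ maximalIdeal T, s * b ∈ (maximalIdeal R).map (algebraMap R T) := by
    intro b
    constructor
    · intro h s hs
      have := h (Ideal.Quotient.mk _ s) (hmax ▸ Ideal.mem_map_of_mem _ hs)
      rwa [← map_mul, mk_mem_map_maximalIdeal_iff hJ] at this
    · intro h s hs
      rw [hmax] at hs
      obtain ⟨s, hs', rfl⟩ :=
        (Ideal.mem_map_iff_of_surjective _ Ideal.Quotient.mk_surjective).1 hs
      rw [← map_mul, mk_mem_map_maximalIdeal_iff hJ]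
      exact h s hs'
  have hδ : IsSocleGenerator (T ⧸ J.map (algebraMap R T))
      (w' ⊗ₜ[R ⧸ J] u : (T ⧸ J.map (algebraMap R T)) ⊗[R ⧸ J] V) := by
    refine hu.tmul (fun h => hw ((mk_mem_map_maximalIdeal_iff hJ).1 h)) ((hmul w).2 hw1) ?_
    intro b hb
    obtain ⟨b, rfl⟩ := Ideal.Quotient.mk_surjective b
    obtain ⟨x, hx, t, ht, rfl⟩ := Submodule.mem_sup.1 (hw2 b ((hmul b).1 hb))
    obtain ⟨s, rfl⟩ := Ideal.mem_span_singleton'.1 hx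
    rw [map_add, map_mul]
    exact Submodule.add_mem_sup (Ideal.mul_mem_left _ _ (Ideal.mem_span_singleton_self _))
      ((mk_mem_map_maximalIdeal_iff hJ).2 ht)
  by_cases h0 : (Ideal.Quotient.mk (J₂.map (algebraMap R T₂)) c) ⊗ₜ[T ⧸ J.map (algebraMap R T)]
      (w' ⊗ₜ[R ⧸ J] u : (T ⧸ J.map (algebraMap R T)) ⊗[R ⧸ J] V) = 0
  · right
    have hmem := mem_map_torsionOf_of_tmul_tmul_eq_zero (A₂ := R ⧸ J₂) h0
    have hle : J₂ ≤ nonSplitIdeal R p e := (Ideal.span_mono (Set.image_mono hJ)).trans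
      (frobPow_maximalIdeal_le_nonSplitIdeal p e)
    have htor : Ideal.torsionOf (R ⧸ J₂) ((R ⧸ J₂) ⊗[R ⧸ J] V) ((1 : R ⧸ J₂) ⊗ₜ[R ⧸ J] u) ≤
        (nonSplitIdeal R p e).map (Ideal.Quotient.mk J₂) := by
      intro r hr
      obtain ⟨r, rfl⟩ := Ideal.Quotient.mk_surjective r
      refine Ideal.mem_map_of_mem _ ?_
      by_contra hns
      obtain ⟨θ, hθ, hθ1⟩ := notMem_nonSplitIdeal_iff.1 hns
      have hθ' : IsCartierMap p e θ := hθ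
      let θ₁ : R ⧸ J₂ →+ R ⧸ J := QuotientAddGroup.map _ _ θ
        fun x hx => hθ'.map_mem_of_mem_frobPow hx
      let θ₂ : R ⧸ J₂ →ₗ[R ⧸ J] R ⧸ J :=
        { θ₁ with
          map_smul' := fun a x => by
            obtain ⟨a, rfl⟩ := Ideal.Quotient.mk_surjective a
            obtain ⟨x, rfl⟩ := Ideal.Quotient.mk_surjective x
            exact congrArg (Ideal.Quotient.mk J) (hθ a x) }
      have hr' := (Ideal.mem_torsionOf_iff _ _).1 hr
      rw [TensorProduct.smul_tmul', smul_eq_mul, mul_one] at hr'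
      have h1 := congrArg ((TensorProduct.lid (R ⧸ J) V).toLinearMap ∘ₗ
        LinearMap.rTensor V θ₂) hr'
      rw [map_zero, LinearMap.comp_apply, LinearMap.rTensor_tmul] at h1
      have h2 : θ₂ (Ideal.Quotient.mk J₂ r) = 1 := congrArg (Ideal.Quotient.mk J) hθ1
      rw [h2, LinearEquiv.coe_coe, TensorProduct.lid_tmul, one_smul] at h1
      exact hu.ne_zero h1
    have h3 := Ideal.map_mono htor hmem
    rw [Ideal.map_map] at h3
    change _ ∈ (nonSplitIdeal R p e).map ((Ideal.Quotient.mk (J₂.map (algebraMap R T₂))).comp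
      (algebraMap R T₂)) at h3
    rw [← Ideal.map_map] at h3
    exact (Ideal.mem_quotient_iff_mem (Ideal.map_mono hle)).1 h3
  · left
    obtain ⟨φ, hφ⟩ := hδ.exists_linearMap_eq_one (length_tensorProduct_eq hV) h0
    refine ⟨φ.toAddMonoidHom.comp (Ideal.Quotient.mk (J₂.map (algebraMap R T₂))).toAddMonoidHom,
      fun t x => ?_, hφ⟩
    exact φ.map_smul (Ideal.Quotient.mk _ t) (Ideal.Quotient.mk _ x)

end FrobeniusSquare

/-- If `x` splits off modulo arbitrarily small ideals, then `x` splits off. -/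
theorem exists_linearMap_eq_one_of_forall_pow {S M : Type*} [CommRing S] [IsLocalRing S]
    [IsNoetherianRing S] [AddCommGroup M] [Module S M] [Module.Finite S M] (x : M)
    (h : ∀ N : ℕ, ∃ I : Ideal S, I ≤ maximalIdeal S ^ N ∧ ∃ φ : M →ₗ[S] S ⧸ I, φ x = 1) :
    ∃ φ : M →ₗ[S] S, φ x = 1 := by
  obtain ⟨a, π, hπ⟩ := Module.Finite.exists_fin' S M
  obtain ⟨ξ, rfl⟩ := hπ x
  obtain ⟨b, g, hg⟩ := Submodule.fg_iff_exists_fin_generating_family.1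
    (IsNoetherian.noetherian (LinearMap.ker π))
  let T : ((Fin a → S) →ₗ[S] S) →ₗ[S] (Fin b → S) := LinearMap.pi fun j => LinearMap.applyₗ (g j)
  obtain ⟨k, hk⟩ := (maximalIdeal S).exists_pow_inf_eq_pow_smul (LinearMap.range T)
  obtain ⟨I, hI, φ, hφ⟩ := h (k + 1)
  obtain ⟨f, hf⟩ := Module.projective_lifting_property I.mkQ (φ.comp π) I.mkQ_surjective
  have hTf : T f ∈ maximalIdeal S ^ (k + 1) • (⊤ : Submodule S (Fin b → S)) := by
    rw [pi_eq_sum_univ' (T f)]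
    refine Submodule.sum_mem _ fun j _ => Submodule.smul_mem_smul (hI ?_) Submodule.mem_top
    have h1 : g j ∈ LinearMap.ker π := hg ▸ Submodule.subset_span ⟨j, rfl⟩
    have h2 := LinearMap.congr_fun hf (g j)
    rw [LinearMap.comp_apply, LinearMap.comp_apply, h1, map_zero] at h2
    exact (Submodule.Quotient.mk_eq_zero _).1 h2
  have hmem : T f ∈ maximalIdeal S • LinearMap.range T := by
    have h1 : T f ∈ maximalIdeal S ^ (k + 1) • (⊤ : Submodule S (Fin b → S)) ⊓ LinearMap.range T :=
      ⟨hTf, f, rfl⟩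
    rw [hk _ (Nat.le_add_right k 1), Nat.add_sub_cancel_left, pow_one] at h1
    exact (smul_mono_right _ inf_le_right : _ ≤ maximalIdeal S • LinearMap.range T) h1
  rw [LinearMap.range_eq_map, ← Submodule.map_smul''] at hmem
  obtain ⟨f', hf', hff'⟩ := hmem
  have hξ : ∀ f' ∈ maximalIdeal S • (⊤ : Submodule S ((Fin a → S) →ₗ[S] S)),
      f' ξ ∈ maximalIdeal S := by
    intro f' hf'
    refine Submodule.smul_induction_on hf' (fun r hr f _ => Ideal.mul_mem_right _ _ hr) ?_
    exact fun f₁ f₂ h₁ h₂ => add_mem h₁ h₂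
  have hker : LinearMap.ker π ≤ LinearMap.ker (f - f') := by
    rw [← hg, Submodule.span_le]
    rintro _ ⟨j, rfl⟩
    have := congrFun hff' j
    exact sub_eq_zero.2 this.symm
  have hunit : IsUnit ((f - f') ξ) := by
    by_contra hn
    have h1 : f ξ ∈ maximalIdeal S := by
      simpa using add_mem ((mem_maximalIdeal _).2 hn) (hξ f' hf')
    have h2 : I.mkQ (f ξ) = 1 := (LinearMap.congr_fun hf ξ).trans hφ
    have h3 : f ξ - 1 ∈ I := (Submodule.Quotient.eq I).1 h2
    refine (maximalIdeal.isMaximal S).ne_top ((Ideal.eq_top_iff_one _).2 ?_)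
    simpa using sub_mem h1 (Ideal.pow_le_self (Nat.succ_ne_zero k) (hI h3))
  obtain ⟨v, hv⟩ := hunit
  let e := π.quotKerEquivOfSurjective hπ
  refine ⟨(↑v⁻¹ : S) • ((LinearMap.ker π).liftQ _ hker).comp e.symm.toLinearMap, ?_⟩
  have he : e.symm (π ξ) = (LinearMap.ker π).mkQ ξ := (LinearEquiv.symm_apply_eq _).2 rfl
  rw [LinearMap.smul_apply, LinearMap.comp_apply, LinearEquiv.coe_coe, he, Submodule.mkQ_apply,
    Submodule.liftQ_apply, ← hv, smul_eq_mul, Units.inv_mul]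

/-- The ring `S` regarded as a module over itself through a ring endomorphism. -/
def RestrictAlong {S : Type*} [CommRing S] (_ : S →+* S) : Type _ := S

instance {S : Type*} [CommRing S] (f : S →+* S) : AddCommGroup (RestrictAlong f) :=
  inferInstanceAs (AddCommGroup S)

instance {S : Type*} [CommRing S] (f : S →+* S) : Module S (RestrictAlong f) :=
  f.toAlgebra.toModule

theorem IsFFinite.finite_iterateFrobenius {S : Type*} [CommRing S] {p : ℕ} [Fact p.Prime]
    [CharP S p] (h : IsFFinite S p) (e : ℕ) : (iterateFrobenius S p e).Finite := by
  have hp : (frobenius S p).Finite := by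
    obtain ⟨s, hs⟩ := h
    change Module.Finite S (RestrictAlong (frobenius S p))
    refine ⟨Finset.map ⟨show S → RestrictAlong (frobenius S p) from id, fun _ _ h => h⟩ s,
      top_le_iff.1 fun x _ => ?_⟩
    obtain ⟨a, ha⟩ := hs x
    rw [show x = _ from ha]
    exact Submodule.sum_mem (Submodule.span S _) fun i hi =>
      Submodule.smul_mem _ (a i) (Submodule.subset_span (Finset.mem_map_of_mem _ hi))
  induction e with
  | zero => rw [iterateFrobenius_zero]; exact RingHom.Finite.id S
  | succ e ih =>
    have : iterateFrobenius S p (e + 1) = (iterateFrobenius S p e).comp (frobenius S p) :=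
      RingHom.ext fun x => by
        simp [iterateFrobenius_def, frobenius_def, ← pow_mul, pow_succ']
    rw [this]
    exact ih.comp hp

/-- An element `c` splits off the Frobenius pushforward of an F-finite local ring if it does so
modulo arbitrarily small ideals. -/
theorem frobSplits_of_forall_pow {S : Type*} [CommRing S] [IsLocalRing S] [IsNoetherianRing S]
    {p : ℕ} [Fact p.Prime] [CharP S p] (hS : IsFFinite S p) {c : S} {e : ℕ}
    (h : ∀ N : ℕ, ∃ I : Ideal S, I ≤ maximalIdeal S ^ N ∧ ∃ θ : S →+ S ⧸ I,
      (∀ a x, θ (a ^ p ^ e * x) = Ideal.Quotient.mk I a * θ x) ∧ θ c = 1) :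
    FrobSplits p c e := by
  have _ : Module.Finite S (RestrictAlong (iterateFrobenius S p e)) :=
    hS.finite_iterateFrobenius e
  obtain ⟨φ, hφ⟩ := exists_linearMap_eq_one_of_forall_pow
    (M := RestrictAlong (iterateFrobenius S p e)) (show S from c) fun N => by
      obtain ⟨I, hI, θ, hθ, hθ1⟩ := h N
      exact ⟨I, hI, { toFun := θ, map_add' := map_add θ, map_smul' := hθ }, hθ1⟩
  exact ⟨φ.toAddMonoidHom, fun a x => φ.map_smul a x, hφ⟩

section FlatSlices

open TensorProduct

variable {R S : Type*} [CommRing R] [CommRing S] [Algebra R S]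

/-- Multiplication by `y` is injective modulo the ideal `K`. -/
def IsRegularMod (K : Ideal S) (y : S) : Prop :=
  ∀ x : S, x * y ∈ K → x ∈ K

theorem IsRegularMod.pow {K : Ideal S} {y : S} (h : IsRegularMod K y) (n : ℕ) :
    IsRegularMod K (y ^ n) := by
  induction n with
  | zero => intro x hx; simpa using hx
  | succ n ih =>
    intro x hx
    rw [pow_succ', ← mul_assoc] at hx
    exact h _ (ih _ hx)

/-- If `z` and `y` are regular modulo `K` and `y` is regular modulo `K + (z)`, then `y` is regular
modulo `K + (z ^ n)`. -/
theorem IsRegularMod.sup_span_pow {K : Ideal S} {y z : S} (hz : IsRegularMod K z)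
    (hzy : IsRegularMod (K ⊔ Ideal.span {z}) y) (n : ℕ) :
    IsRegularMod (K ⊔ Ideal.span {z ^ n}) y := by
  induction n with
  | zero => intro x _; simp
  | succ n ih =>
    intro x hx
    have hle : K ⊔ Ideal.span {z ^ (n + 1)} ≤ K ⊔ Ideal.span {z} :=
      sup_le_sup_left (Ideal.span_singleton_le_span_singleton.2 ⟨z ^ n, pow_succ' z n⟩) _
    obtain ⟨k, hk, a, ha, rfl⟩ := Submodule.mem_sup.1 (hzy x (hle hx))
    obtain ⟨r, rfl⟩ := Ideal.mem_span_singleton'.1 ha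
    obtain ⟨k', hk', b, hb, hkb⟩ := Submodule.mem_sup.1 hx
    obtain ⟨t, rfl⟩ := Ideal.mem_span_singleton'.1 hb
    have h1 : r * y - t * z ^ n ∈ K := hz _ (by
      have : (r * y - t * z ^ n) * z = k' - k * y := by linear_combination -hkb
      rw [this]
      exact sub_mem hk' (Ideal.mul_mem_right _ _ hk))
    have h2 : r * y ∈ K ⊔ Ideal.span {z ^ n} := by
      rw [← sub_add_cancel (r * y) (t * z ^ n)]
      exact Submodule.add_mem_sup h1 (Ideal.mul_mem_left _ _ (Ideal.mem_span_singleton_self _))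
    obtain ⟨k₂, hk₂, c, hc, hr⟩ := Submodule.mem_sup.1 (ih r h2)
    obtain ⟨t', rfl⟩ := Ideal.mem_span_singleton'.1 hc
    rw [← hr, add_mul, ← add_assoc, mul_assoc, ← pow_succ]
    exact Submodule.add_mem_sup (add_mem hk (Ideal.mul_mem_right _ _ hk₂))
      (Ideal.mul_mem_left _ _ (Ideal.mem_span_singleton_self _))

theorem mk_mem_map_iff (J : Ideal R) (Z : Ideal S) {s : S} :
    Ideal.Quotient.mk Z s ∈ J.map (algebraMap R (S ⧸ Z)) ↔ s ∈ J.map (algebraMap R S) ⊔ Z := by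
  have h : J.map (algebraMap R (S ⧸ Z)) = (J.map (algebraMap R S)).map (Ideal.Quotient.mk Z) := by
    rw [Ideal.map_map]; rfl
  rw [h, ← Ideal.mem_comap, Ideal.comap_map_of_surjective _ Ideal.Quotient.mk_surjective,
    ← RingHom.ker_eq_comap_bot, Ideal.mk_ker]

/-- Colon ideals extend along a flat quotient. -/
theorem mem_map_sup_of_smul_mem {Z : Ideal S} [Module.Flat R (S ⧸ Z)] {I J : Ideal R} {a : R}
    (h : ∀ r, r * a ∈ J → r ∈ I) {t : S}
    (ht : algebraMap R S a * t ∈ J.map (algebraMap R S) ⊔ Z) :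
    t ∈ I.map (algebraMap R S) ⊔ Z := by
  rw [← mk_mem_map_iff] at ht ⊢
  have h0 : (Ideal.Quotient.mk Z t) ⊗ₜ[R] (Ideal.Quotient.mk J a) = 0 := by
    apply (TensorProduct.tensorQuotEquivQuotSMul (S ⧸ Z) J).injective
    rw [TensorProduct.tensorQuotEquivQuotSMul_tmul_mk, map_zero, Submodule.Quotient.mk_eq_zero,
      Ideal.smul_top_eq_map]
    rw [map_mul] at ht
    rw [Algebra.smul_def]
    exact ht
  refine Ideal.map_mono (fun r hr => h r ?_) (mem_map_torsionOf_of_tmul_eq_zero h0)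
  have := (Ideal.mem_torsionOf_iff _ _).1 hr
  exact (Submodule.Quotient.mk_eq_zero J).1 this

theorem exists_sum_of_mem_map_range_sup {Z : Ideal S} {l : ℕ} {f : Fin l → R} {s : S}
    (hs : s ∈ (Ideal.span (Set.range f)).map (algebraMap R S) ⊔ Z) :
    ∃ g : Fin l → S, s - ∑ i, algebraMap R S (f i) * g i ∈ Z := by
  obtain ⟨a, ha, z, hz, rfl⟩ := Submodule.mem_sup.1 hs
  rw [Ideal.map_span, ← Set.range_comp] at ha
  obtain ⟨g, rfl⟩ := Ideal.mem_span_range_iff_exists_fun.1 ha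
  refine ⟨g, ?_⟩
  have : ∑ i, g i * (algebraMap R S ∘ f) i = ∑ i, algebraMap R S (f i) * g i :=
    Finset.sum_congr rfl fun i _ => mul_comm _ _
  rwa [this, add_sub_cancel_left]

theorem isTrivialRelation_map {M N : Type*} [AddCommGroup M] [Module R M] [AddCommGroup N]
    [Module R N] {l : ℕ} {f : Fin l → R} {x : Fin l → M} (h : Module.IsTrivialRelation f x)
    (q : M →ₗ[R] N) : Module.IsTrivialRelation f fun i => q (x i) := by
  obtain ⟨k, a, v, hv, ha⟩ := h
  refine ⟨k, a, fun j => q (v j), fun i => ?_, ha⟩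
  beta_reduce
  rw [hv i, map_sum]
  exact Finset.sum_congr rfl fun j _ => map_smul q _ _

/-- Slicing a flat quotient by an element regular on all its reductions preserves flatness. -/
theorem flat_quotient_sup_span {Z : Ideal S} [Module.Flat R (S ⧸ Z)] {y : S}
    (hy : ∀ J : Ideal R, IsRegularMod (J.map (algebraMap R S) ⊔ Z) y) :
    Module.Flat R (S ⧸ (Z ⊔ Ideal.span {y})) := by
  refine Module.Flat.of_forall_isTrivialRelation fun {l f x} hfx => ?_
  choose x' hx' using fun i => Ideal.Quotient.mk_surjective (x i)
  have h1 : ∑ i, algebraMap R S (f i) * x' i ∈ Z ⊔ Ideal.span {y} := by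
    rw [← Ideal.Quotient.eq_zero_iff_mem, map_sum, ← hfx]
    refine Finset.sum_congr rfl fun i _ => ?_
    rw [map_mul, hx', Algebra.smul_def]; rfl
  obtain ⟨z, hz, b, hb, hzb⟩ := Submodule.mem_sup.1 h1
  obtain ⟨s, rfl⟩ := Ideal.mem_span_singleton'.1 hb
  have h2 : s * y ∈ (Ideal.span (Set.range f)).map (algebraMap R S) ⊔ Z := by
    rw [eq_sub_of_add_eq' hzb]
    refine sub_mem (Ideal.mem_sup_left (Ideal.sum_mem _ fun i _ => Ideal.mul_mem_right _ _ ?_))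
      (Ideal.mem_sup_right hz)
    exact Ideal.mem_map_of_mem _ (Ideal.subset_span ⟨i, rfl⟩)
  obtain ⟨g, hg⟩ := exists_sum_of_mem_map_range_sup (hy _ s h2)
  have h3 : ∑ i, f i • Ideal.Quotient.mk Z (x' i - y * g i) = 0 := by
    have : ∑ i, f i • Ideal.Quotient.mk Z (x' i - y * g i) =
        Ideal.Quotient.mk Z (∑ i, algebraMap R S (f i) * (x' i - y * g i)) := by
      rw [map_sum]
      refine Finset.sum_congr rfl fun i _ => ?_
      rw [map_mul, Algebra.smul_def]; rfl
    rw [this, Ideal.Quotient.eq_zero_iff_mem]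
    have h4 : ∑ i, algebraMap R S (f i) * (x' i - y * g i) =
        z + (s - ∑ i, algebraMap R S (f i) * g i) * y := by
      rw [sub_mul, ← add_sub_assoc, hzb, Finset.sum_mul, ← Finset.sum_sub_distrib]
      exact Finset.sum_congr rfl fun i _ => by ring
    rw [h4]
    exact add_mem hz (Ideal.mul_mem_right _ _ hg)
  have hxq : ∀ i, Ideal.Quotient.factorₐ R (le_sup_left : Z ≤ Z ⊔ Ideal.span {y})
      (Ideal.Quotient.mk Z (x' i - y * g i)) = x i := fun i => by
    change Ideal.Quotient.mk _ (x' i - y * g i) = x i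
    rw [← hx', Ideal.Quotient.eq]
    refine Ideal.mem_sup_right ?_
    rw [sub_sub_cancel_left]
    exact neg_mem (Ideal.mul_mem_right _ _ (Ideal.mem_span_singleton_self _))
  rw [← funext hxq]
  exact isTrivialRelation_map (Module.Flat.isTrivialRelation_of_sum_smul_eq_zero h3)
    (Ideal.Quotient.factorₐ R (le_sup_left : Z ≤ Z ⊔ Ideal.span {y})).toLinearMap

theorem mul_algebraMap_mem_map {I J : Ideal R} {a : R} (ha : ∀ r ∈ I, r * a ∈ J) {b : S}
    (hb : b ∈ I.map (algebraMap R S)) : b * algebraMap R S a ∈ J.map (algebraMap R S) := by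
  induction hb using Submodule.span_induction with
  | mem x hx =>
    obtain ⟨r, hr, rfl⟩ := hx
    rw [← map_mul]
    exact Ideal.mem_map_of_mem _ (ha r hr)
  | zero => rw [zero_mul]; exact zero_mem _
  | add x y _ _ hx hy => rw [add_mul]; exact add_mem hx hy
  | smul c x _ hx => rw [smul_eq_mul, mul_assoc]; exact Ideal.mul_mem_left _ _ hx

variable [IsLocalRing R]

theorem exists_socle_of_maximalIdeal_pow_le {J : Ideal R} (hJ : J ≠ ⊤) {k : ℕ}
    (hk : maximalIdeal R ^ k ≤ J) : ∃ a, a ∉ J ∧ ∀ r ∈ maximalIdeal R, r * a ∈ J := by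
  classical
  have hex : ∃ k, maximalIdeal R ^ k ≤ J := ⟨k, hk⟩
  have hmin := Nat.find_spec hex
  have hpos : Nat.find hex ≠ 0 := fun h0 => hJ <| top_le_iff.1 <| by
    rwa [h0, pow_zero, Ideal.one_eq_top] at hmin
  obtain ⟨a, ha, haJ⟩ := Set.not_subset.1 (Nat.find_min hex (Nat.sub_one_lt hpos))
  refine ⟨a, haJ, fun r hr => hmin ?_⟩
  rw [← Nat.sub_add_cancel (Nat.one_le_iff_ne_zero.2 hpos), pow_succ']
  exact Ideal.mul_mem_mul hr ha

theorem mem_maximalIdeal_of_mul_mem {J : Ideal R} {a r : R} (ha : a ∉ J) (hr : r * a ∈ J) :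
    r ∈ maximalIdeal R := by
  by_contra hn
  have : IsUnit r := by simpa using hn
  exact ha ((Ideal.unit_mul_mem_iff_mem J this).1 hr)

variable [IsNoetherianRing R]

theorem isRegularMod_map_sup_of_pow_le {Z : Ideal S} [Module.Flat R (S ⧸ Z)] {y : S}
    (hy : IsRegularMod ((maximalIdeal R).map (algebraMap R S) ⊔ Z) y) {k : ℕ} (J : Ideal R)
    (hk : maximalIdeal R ^ k ≤ J) : IsRegularMod (J.map (algebraMap R S) ⊔ Z) y := by
  induction J using WellFoundedGT.induction with
  | _ J ih =>
    intro x hx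
    by_cases hJ : J = ⊤
    · rw [hJ, Ideal.map_top, top_sup_eq]; exact Submodule.mem_top
    obtain ⟨a, haJ, ha⟩ := exists_socle_of_maximalIdeal_pow_le hJ hk
    have hlt : J < J ⊔ Ideal.span {a} := lt_of_le_of_ne le_sup_left fun h => haJ <| by
      rw [h]; exact Ideal.mem_sup_right (Ideal.mem_span_singleton_self a)
    have hle : J.map (algebraMap R S) ⊔ Z ≤ (J ⊔ Ideal.span {a}).map (algebraMap R S) ⊔ Z :=
      sup_le_sup_right (Ideal.map_mono le_sup_left) _
    have hx1 := ih _ hlt (hk.trans le_sup_left) x (hle hx)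
    rw [Ideal.map_sup, Ideal.map_span, Set.image_singleton, sup_right_comm] at hx1
    obtain ⟨j, hj, b, hb, rfl⟩ := Submodule.mem_sup.1 hx1
    obtain ⟨t, rfl⟩ := Ideal.mem_span_singleton'.1 hb
    refine add_mem hj ?_
    have h1 : algebraMap R S a * (t * y) ∈ J.map (algebraMap R S) ⊔ Z := by
      have : algebraMap R S a * (t * y) = (j + t * algebraMap R S a) * y - j * y := by ring
      rw [this]
      exact sub_mem hx (Ideal.mul_mem_right _ _ hj)
    have h2 := hy t (mem_map_sup_of_smul_mem (fun r => mem_maximalIdeal_of_mul_mem haJ) h1)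
    obtain ⟨c, hc, z, hz, rfl⟩ := Submodule.mem_sup.1 h2
    rw [add_mul]
    exact Submodule.add_mem_sup (mul_algebraMap_mem_map ha hc) (Ideal.mul_mem_right _ _ hz)

variable [IsLocalRing S] [IsNoetherianRing S]

/-- Krull intersection theorem in the form: ideals of a Noetherian local ring are closed. -/
theorem mem_of_forall_mem_sup_pow {K : Ideal S} {x : S}
    (h : ∀ k, x ∈ K ⊔ maximalIdeal S ^ k) : x ∈ K := by
  have h1 := (maximalIdeal S).iInf_pow_smul_eq_bot_of_isLocalRing (M := S ⧸ K)
    (maximalIdeal.isMaximal S).ne_top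
  rw [← Ideal.Quotient.eq_zero_iff_mem, ← Submodule.mem_bot S, ← h1, Submodule.mem_iInf]
  intro k
  obtain ⟨a, ha, b, hb, rfl⟩ := Submodule.mem_sup.1 (h k)
  rw [map_add, Ideal.Quotient.eq_zero_iff_mem.2 ha, zero_add]
  have : Ideal.Quotient.mk K b = b • (1 : S ⧸ K) := by
    rw [Algebra.smul_def, mul_one]; rfl
  rw [this]
  exact Submodule.smul_mem_smul hb Submodule.mem_top

theorem isRegularMod_map_sup [IsLocalHom (algebraMap R S)] {Z : Ideal S} [Module.Flat R (S ⧸ Z)]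
    {y : S} (hy : IsRegularMod ((maximalIdeal R).map (algebraMap R S) ⊔ Z) y) (J : Ideal R) :
    IsRegularMod (J.map (algebraMap R S) ⊔ Z) y := by
  intro x hx
  refine mem_of_forall_mem_sup_pow fun k => ?_
  have hle : J.map (algebraMap R S) ⊔ Z ≤ (J ⊔ maximalIdeal R ^ k).map (algebraMap R S) ⊔ Z :=
    sup_le_sup_right (Ideal.map_mono le_sup_left) _
  have h1 := isRegularMod_map_sup_of_pow_le hy (J ⊔ maximalIdeal R ^ k) le_sup_right x (hle hx)
  refine (?_ : _ ≤ J.map (algebraMap R S) ⊔ Z ⊔ maximalIdeal S ^ k) h1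
  rw [Ideal.map_sup, Ideal.map_pow, sup_right_comm]
  refine sup_le_sup_left (Ideal.pow_right_mono ?_ k) _
  exact Ideal.map_le_iff_le_comap.2 fun r hr => map_nonunit (algebraMap R S) r hr

end FlatSlices

section PermRegular

theorem isRegularMod_span_image_of_isRegular {F : Type*} [CommRing F] [IsLocalRing F]
    [IsNoetherianRing F] {d : ℕ} {x : Fin d → F}
    (h : RingTheory.Sequence.IsRegular F (List.ofFn x)) {s : Finset (Fin d)} {i : Fin d}
    (hi : i ∉ s) : IsRegularMod (Ideal.span (x '' s)) (x i) := by
  classical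
  have hperm : (List.finRange d).Perm (s.toList ++ i :: (insert i s)ᶜ.toList) := by
    refine (List.perm_ext_iff_of_nodup (List.nodup_finRange d) ?_).2 fun j => ?_
    · rw [List.nodup_append', List.nodup_cons]
      refine ⟨s.nodup_toList, ⟨by simp, Finset.nodup_toList _⟩, fun j hj hj' => ?_⟩
      simp only [Finset.mem_toList, List.mem_cons, Finset.mem_compl, Finset.mem_insert] at hj hj'
      rcases hj' with rfl | hj'
      · exact hi hj
      · exact hj' (Or.inr hj)
    · simp only [List.mem_finRange, List.mem_append, Finset.mem_toList, List.mem_cons,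
        Finset.mem_compl, Finset.mem_insert, true_iff]
      tauto
  have hreg := (IsLocalRing.isRegular_of_perm h
    (List.ofFn_eq_map (f := x) ▸ hperm.map x)).toIsWeaklyRegular
  rw [List.map_append, List.map_cons, RingTheory.Sequence.isWeaklyRegular_append_iff,
    RingTheory.Sequence.isWeaklyRegular_cons_iff] at hreg
  have h2 := (isSMulRegular_quotient_iff_mem_of_smul_mem _ _).1 hreg.2.1
  have h3 : (Ideal.ofList (s.toList.map x) • ⊤ : Submodule F F) = Ideal.span (x '' s) := by
    rw [smul_eq_mul, Ideal.mul_top, Ideal.ofList]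
    congr 1
    ext y
    simp
  rw [h3] at h2
  exact fun y hy => h2 y (by rwa [smul_eq_mul, mul_comm])

variable {S : Type*} [CommRing S] {ι : Type*}

theorem mk_mem_span_image_iff (M : Ideal S) (Y : Set S) {g : S} :
    Ideal.Quotient.mk M g ∈ Ideal.span (Ideal.Quotient.mk M '' Y) ↔ g ∈ M ⊔ Ideal.span Y := by
  rw [← Ideal.map_span, ← Ideal.mem_comap,
    Ideal.comap_map_of_surjective _ Ideal.Quotient.mk_surjective,
    ← RingHom.ker_eq_comap_bot, Ideal.mk_ker, sup_comm]

/-- The family `z` is a regular sequence modulo `K` in every order. -/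
def IsPermRegularMod (K : Ideal S) (z : ι → S) : Prop :=
  ∀ (s : Finset ι) (i : ι), i ∉ s → IsRegularMod (K ⊔ Ideal.span (z '' s)) (z i)

theorem isPermRegularMod_of_isRegular {M : Ideal S} [IsLocalRing (S ⧸ M)]
    [IsNoetherianRing (S ⧸ M)] {d : ℕ} {z : Fin d → S}
    (h : RingTheory.Sequence.IsRegular (S ⧸ M) (List.ofFn fun i => Ideal.Quotient.mk M (z i))) :
    IsPermRegularMod M z := by
  intro s i hi y hy
  rw [← mk_mem_span_image_iff, ← Set.image_comp] at hy ⊢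
  exact isRegularMod_span_image_of_isRegular h hi _ (by rwa [map_mul] at hy)

variable {K : Ideal S} {z : ι → S}

theorem IsPermRegularMod.pow (h : IsPermRegularMod K z) (c : ι → ℕ) :
    IsPermRegularMod K fun i => z i ^ c i := by
  classical
  have key : ∀ (t s : Finset ι) (i : ι), Disjoint s t → i ∉ s → i ∉ t →
      IsRegularMod (K ⊔ Ideal.span (z '' s) ⊔ Ideal.span ((fun i => z i ^ c i) '' t)) (z i) := by
    intro t
    induction t using Finset.induction with
    | empty =>
      intro s i _ hi _
      simpa using h s i hi
    | insert j t hj ih =>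
      intro s i hst his hit
      rw [Finset.disjoint_insert_right] at hst
      rw [Finset.mem_insert, not_or] at hit
      rw [Finset.coe_insert, Set.image_insert_eq, Ideal.span_insert,
        sup_comm (Ideal.span {_}), ← sup_assoc]
      refine IsRegularMod.sup_span_pow (ih s j hst.2 hst.1 hj) ?_ _
      have h1 := ih (insert j s) i (Finset.disjoint_insert_left.2 ⟨hj, hst.2⟩)
        (by simpa using ⟨hit.1, his⟩) hit.2
      rwa [Finset.coe_insert, Set.image_insert_eq, Ideal.span_insert,
        sup_comm (Ideal.span {_}), ← sup_assoc, sup_right_comm] at h1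
  intro s i hi
  have := (key s ∅ i (Finset.disjoint_empty_left _) (Finset.notMem_empty i) hi).pow (c i)
  simpa using this

section Colon

/-- The ideal `K + (z i ^ c i : i)`. -/
def supPowers (K : Ideal S) (z : ι → S) (c : ι → ℕ) : Ideal S :=
  K ⊔ Ideal.span (Set.range fun i => z i ^ c i)

theorem le_supPowers (K : Ideal S) (z : ι → S) (c : ι → ℕ) : K ≤ supPowers K z c :=
  le_sup_left

theorem pow_mem_supPowers (K : Ideal S) (z : ι → S) (c : ι → ℕ) (i : ι) :
    z i ^ c i ∈ supPowers K z c :=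
  Ideal.mem_sup_right (Ideal.subset_span ⟨i, rfl⟩)

variable [Fintype ι]

theorem mul_mem_of_mem_supPowers {c : ι → ℕ} {I : Ideal S} {P g : S} (hK : K ≤ I)
    (hI : ∀ i, z i ^ c i * P ∈ I) (hg : g ∈ supPowers K z c) : g * P ∈ I := by
  obtain ⟨k, hk, b, hb, rfl⟩ := Submodule.mem_sup.1 hg
  obtain ⟨f, rfl⟩ := Ideal.mem_span_range_iff_exists_fun.1 hb
  rw [add_mul, Finset.sum_mul]
  refine add_mem (Ideal.mul_mem_right _ _ (hK hk)) (Ideal.sum_mem _ fun i _ => ?_)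
  rw [mul_assoc]
  exact Ideal.mul_mem_left _ _ (hI i)

variable [DecidableEq ι]

theorem supPowers_eq_erase (K : Ideal S) (z : ι → S) (c : ι → ℕ) (j : ι) :
    supPowers K z c =
      K ⊔ Ideal.span ((fun i => z i ^ c i) '' (Finset.univ.erase j : Finset ι)) ⊔
        Ideal.span {z j ^ c j} := by
  rw [sup_assoc, ← Ideal.span_union, ← Set.image_singleton (f := fun i => z i ^ c i),
    ← Set.image_union, supPowers, ← Set.image_univ]
  congr 3
  ext i
  simp

theorem IsPermRegularMod.mem_supPowers_of_mul_pow_mem (h : IsPermRegularMod K z) {c c' : ι → ℕ}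
    {j : ι} {a : ℕ} (hj : c' j = c j + a) (hc : ∀ i, i ≠ j → c' i = c i) {x : S}
    (hx : x * z j ^ a ∈ supPowers K z c') : x ∈ supPowers K z c := by
  have himg : (fun i => z i ^ c' i) '' (Finset.univ.erase j : Finset ι) =
      (fun i => z i ^ c i) '' (Finset.univ.erase j : Finset ι) :=
    Set.image_congr fun i hi => by rw [hc i (by simpa using hi)]
  rw [supPowers_eq_erase _ _ _ j] at hx ⊢
  rw [himg] at hx
  have hreg : IsRegularMod
      (K ⊔ Ideal.span ((fun i => z i ^ c i) '' (Finset.univ.erase j : Finset ι))) (z j ^ a) := by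
    have h1 := h.pow (fun i => if i = j then a else c i) (Finset.univ.erase j) j (by simp)
    have himg' : (fun i => z i ^ (if i = j then a else c i)) ''
        (Finset.univ.erase j : Finset ι) =
        (fun i => z i ^ c i) '' (Finset.univ.erase j : Finset ι) :=
      Set.image_congr fun i hi => by rw [if_neg (by simpa using hi)]
    rw [himg'] at h1
    simpa using h1
  obtain ⟨k, hk, b, hb, hkb⟩ := Submodule.mem_sup.1 hx
  obtain ⟨r, rfl⟩ := Ideal.mem_span_singleton'.1 hb
  rw [← sub_add_cancel x (r * z j ^ c j)]
  refine Submodule.add_mem_sup (hreg _ ?_)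
    (Ideal.mul_mem_left _ _ (Ideal.mem_span_singleton_self _))
  have : (x - r * z j ^ c j) * z j ^ a = k := by
    rw [hj, pow_add] at hkb
    linear_combination -hkb
  rwa [this]

theorem IsPermRegularMod.mem_supPowers_of_mul_prod_mem (h : IsPermRegularMod K z) {a : ℕ}
    (t : Finset ι) : ∀ {c c' : ι → ℕ} (_ : ∀ i ∈ t, c' i = c i + a) (_ : ∀ i ∉ t, c' i = c i)
    {x : S} (_ : x * ∏ i ∈ t, z i ^ a ∈ supPowers K z c'), x ∈ supPowers K z c := by
  induction t using Finset.induction with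
  | empty =>
    intro c c' _ hc' x hx
    rw [← funext fun i => hc' i (Finset.notMem_empty i)]
    simpa using hx
  | insert j t hj ih =>
    intro c c' hc hc' x hx
    rw [Finset.prod_insert hj, ← mul_assoc] at hx
    refine h.mem_supPowers_of_mul_pow_mem (j := j) (c' := Function.update c j (c j + a))
      (Function.update_self ..) (fun i hi => Function.update_of_ne hi ..)
      (ih (fun i hi => ?_) (fun i hi => ?_) hx)
    · have hij : i ≠ j := fun hij => hj (hij ▸ hi)
      rw [Function.update_of_ne hij]
      exact hc i (Finset.mem_insert_of_mem hi)
    · by_cases hij : i = j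
      · subst hij
        rw [Function.update_self]
        exact hc i (Finset.mem_insert_self _ _)
      · rw [Function.update_of_ne hij]
        exact hc' i (by simp [hij, hi])

/-- The colon of `K + (z ^ (a + b))` by `(∏ z) ^ a`. -/
theorem IsPermRegularMod.mem_of_mul_prod_pow_mem (h : IsPermRegularMod K z) {a b : ℕ} {x : S}
    (hx : x * (∏ i, z i) ^ a ∈ supPowers K z fun _ => b + a) :
    x ∈ supPowers K z fun _ => b := by
  rw [← Finset.prod_pow] at hx
  exact h.mem_supPowers_of_mul_prod_mem Finset.univ (fun _ _ => rfl)
    (fun i hi => absurd (Finset.mem_univ i) hi) hx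

/-- The colon of `K + (z ^ (a + 1))` by `(z)`. -/
theorem IsPermRegularMod.mem_span_prod_pow_sup (h : IsPermRegularMod K z) {a : ℕ} {y : S}
    (hy : ∀ i, y * z i ∈ supPowers K z fun _ => a + 1) :
    y ∈ Ideal.span {(∏ i, z i) ^ a} ⊔ supPowers K z fun _ => a + 1 := by
  rw [← Finset.prod_pow]
  generalize (Finset.univ : Finset ι) = t
  induction t using Finset.induction with
  | empty => simp
  | insert j t hj ih =>
    obtain ⟨b, hb, k, hk, rfl⟩ := Submodule.mem_sup.1 ih
    obtain ⟨r, rfl⟩ := Ideal.mem_span_singleton'.1 hb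
    refine add_mem ?_ (Ideal.mem_sup_right hk)
    have h1 : r * (∏ i ∈ t, z i ^ a) * z j ^ 1 ∈ supPowers K z fun _ => a + 1 := by
      have := sub_mem (hy j) (Ideal.mul_mem_right (z j) _ hk)
      rwa [add_mul, add_sub_cancel_right, ← pow_one (z j)] at this
    have h2 : r * ∏ i ∈ t, z i ^ a ∈ supPowers K z fun i => if i = j then a else a + 1 :=
      h.mem_supPowers_of_mul_pow_mem (by simp) (fun i hi => by simp [hi]) h1
    have h3 : r ∈ supPowers K z fun i => if i = j then a else if i ∈ t then 1 else a + 1 := by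
      refine h.mem_supPowers_of_mul_prod_mem t (fun i hi => ?_) (fun i hi => ?_) h2
      · have hij : i ≠ j := fun hij => hj (hij ▸ hi)
        simp [hij, hi, add_comm]
      · simp [hi]
    refine mul_mem_of_mem_supPowers ((le_supPowers K z _).trans le_sup_right) (fun i => ?_) h3
    by_cases hij : i = j
    · subst hij
      rw [if_pos rfl, ← Finset.prod_insert (f := fun i => z i ^ a) hj]
      exact Ideal.mem_sup_left (Ideal.mem_span_singleton_self _)
    · refine Ideal.mem_sup_right ?_
      have hmem := pow_mem_supPowers K z (fun _ => a + 1) i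
      rw [if_neg hij]
      split_ifs with hit
      · rw [← Finset.mul_prod_erase t _ hit, ← mul_assoc, pow_one, ← pow_succ']
        exact Ideal.mul_mem_right _ _ hmem
      · exact Ideal.mul_mem_right _ _ hmem

theorem mul_prod_pow_mem_supPowers {a b : ℕ} {g : S} (hg : g ∈ supPowers K z fun _ => b) :
    g * (∏ i, z i) ^ a ∈ supPowers K z fun _ => b + a := by
  refine mul_mem_of_mem_supPowers (le_supPowers K z _) (fun i => ?_) hg
  rw [← Finset.mul_prod_erase Finset.univ z (Finset.mem_univ i), mul_pow, ← mul_assoc, ← pow_add]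
  exact Ideal.mul_mem_right _ _ (pow_mem_supPowers K z (fun _ => b + a) i)

/-- If `w` generates the socle modulo `K + (z)`, then `w * (∏ z) ^ a` generates the socle modulo
`K + (z ^ (a + 1))`. -/
theorem IsPermRegularMod.mem_span_mul_prod_pow_sup (h : IsPermRegularMod K z) {n : Ideal S}
    (hz : ∀ i, z i ∈ n) {a : ℕ} {w : S}
    (hw : ∀ b, (∀ s ∈ n, s * b ∈ supPowers K z fun _ => 1) →
      b ∈ Ideal.span {w} ⊔ supPowers K z fun _ => 1) {b : S}
    (hb : ∀ s ∈ n, s * b ∈ supPowers K z fun _ => a + 1) :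
    b ∈ Ideal.span {w * (∏ i, z i) ^ a} ⊔ supPowers K z fun _ => a + 1 := by
  obtain ⟨c, hc, k, hk, rfl⟩ := Submodule.mem_sup.1
    (h.mem_span_prod_pow_sup fun i => mul_comm b (z i) ▸ hb _ (hz i))
  obtain ⟨r, rfl⟩ := Ideal.mem_span_singleton'.1 hc
  refine add_mem ?_ (Ideal.mem_sup_right hk)
  have hr : r ∈ Ideal.span {w} ⊔ supPowers K z fun _ => 1 := hw r fun s hs => by
    refine h.mem_of_mul_prod_pow_mem (a := a) ?_
    have := sub_mem (hb s hs) (Ideal.mul_mem_left _ s hk)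
    rwa [mul_add, add_sub_cancel_right, ← mul_assoc, add_comm a 1] at this
  obtain ⟨u, hu, v, hv, rfl⟩ := Submodule.mem_sup.1 hr
  obtain ⟨t, rfl⟩ := Ideal.mem_span_singleton'.1 hu
  rw [add_mul, mul_assoc, add_comm a 1]
  exact Submodule.add_mem_sup (Ideal.mul_mem_left _ _ (Ideal.mem_span_singleton_self _))
    (mul_prod_pow_mem_supPowers hv)

end Colon

section Flat

variable {R : Type*} [CommRing R] [Algebra R S] [IsLocalRing R] [IsNoetherianRing R]
  [IsLocalRing S] [IsNoetherianRing S] [IsLocalHom (algebraMap R S)] [Module.Flat R S]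

theorem IsPermRegularMod.flat_quotient_span
    (h : IsPermRegularMod ((maximalIdeal R).map (algebraMap R S)) z) (s : Finset ι) :
    Module.Flat R (S ⧸ Ideal.span (z '' s)) := by
  classical
  induction s using Finset.induction with
  | empty =>
    have h0 : Ideal.span (z '' (∅ : Finset ι)) = ⊥ := by simp
    exact Module.Flat.of_linearEquiv
      ((Submodule.quotEquivOfEqBot (Ideal.span (z '' (∅ : Finset ι))) h0).restrictScalars R)
  | insert i s hi ih =>
    rw [Finset.coe_insert, Set.image_insert_eq, Ideal.span_insert, sup_comm]
    exact flat_quotient_sup_span (isRegularMod_map_sup (h s i hi))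

theorem IsPermRegularMod.flat_quotient_span_range_pow [Fintype ι]
    (h : IsPermRegularMod ((maximalIdeal R).map (algebraMap R S)) z) (n : ℕ) :
    Module.Flat R (S ⧸ Ideal.span (Set.range fun i => z i ^ n)) := by
  rw [← Set.image_univ, ← Finset.coe_univ]
  exact (h.pow fun _ => n).flat_quotient_span Finset.univ

theorem IsPermRegularMod.map_ideal
    (h : IsPermRegularMod ((maximalIdeal R).map (algebraMap R S)) z) (J : Ideal R) :
    IsPermRegularMod (J.map (algebraMap R S)) z := fun s i hi => by
  have := h.flat_quotient_span s
  exact isRegularMod_map_sup (h s i hi) J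

end Flat

/-- The socle modulo an irreducible ideal lies in every strictly larger ideal. -/
theorem Ideal.IsIrreducible.mem_span_sup [IsLocalRing S] {I : Ideal S} (hI : I.IsIrreducible)
    {a b : S} (ha : a ∉ I) (hbm : ∀ s ∈ maximalIdeal S, s * b ∈ I) :
    b ∈ Ideal.span {a} ⊔ I := by
  by_contra hb
  have hinf : I = (Ideal.span {a} ⊔ I) ⊓ (Ideal.span {b} ⊔ I) := by
    refine le_antisymm (le_inf le_sup_right le_sup_right) fun y hy => ?_
    obtain ⟨u, hu, k, hk, rfl⟩ := Submodule.mem_sup.1 hy.1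
    obtain ⟨v, hv, k', hk', hvk⟩ := Submodule.mem_sup.1 hy.2
    obtain ⟨r, rfl⟩ := Ideal.mem_span_singleton'.1 hu
    obtain ⟨t, rfl⟩ := Ideal.mem_span_singleton'.1 hv
    by_cases ht : t ∈ maximalIdeal S
    · rw [← hvk]
      exact add_mem (hbm t ht) hk'
    · have hu : IsUnit t := by simpa using ht
      refine absurd ((Ideal.unit_mul_mem_iff_mem _ hu).1 ?_) hb
      have : t * b = r * a + (k - k') := by linear_combination hvk
      rw [this]
      exact Submodule.add_mem_sup (Ideal.mul_mem_left _ _ (Ideal.mem_span_singleton_self _))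
        (sub_mem hk hk')
  rcases hI.2 _ _ hinf with h | h
  · exact ha (h ▸ Ideal.mem_sup_left (Ideal.mem_span_singleton_self a))
  · exact hb (Ideal.mem_sup_right (h ▸ Ideal.mem_sup_left (Ideal.mem_span_singleton_self b)))

end PermRegular

section FRational

variable {F : Type*} [CommRing F]

theorem exists_isSystemOfParameters (F : Type*) [CommRing F] [IsLocalRing F] [IsNoetherianRing F] :
    ∃ (n : ℕ) (x : Fin n → F), IsSystemOfParameters F x := by
  obtain ⟨s, hs, hcard⟩ := (maximalIdeal F).exists_finset_card_eq_height_of_isNoetherianRing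
  have hrange : Set.range (fun i => (s.equivFin.symm i : F)) = s := by
    ext y
    constructor
    · rintro ⟨i, rfl⟩
      exact (s.equivFin.symm i).2
    · exact fun hy => ⟨s.equivFin ⟨y, hy⟩, by simp⟩
  refine ⟨s.card, fun i => s.equivFin.symm i, ?_, fun i => ?_, ?_⟩
  · rw [← maximalIdeal_height_eq_ringKrullDim, ← hcard]
    rfl
  · exact hs.1.2 (Ideal.subset_span (s.equivFin.symm i).2)
  · rw [hrange, ← Ideal.sInf_minimalPrimes]
    exact le_sInf fun P hP => hs.2 hP.1 (le_maximalIdeal hP.1.1.ne_top)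

variable [IsLocalRing F] [IsNoetherianRing F]

theorem isParameterIdeal_bot : (⊥ : Ideal F).IsParameterIdeal := by
  obtain ⟨n, x, hx⟩ := exists_isSystemOfParameters F
  refine ⟨n, 0, Nat.zero_le n, x, hx, ?_⟩
  rw [Set.range_eq_empty, Ideal.span_empty]

theorem isParameterIdeal_span_singleton {y : F} (hy : y ∈ maximalIdeal F)
    (hreg : y ∈ nonZeroDivisors F) : (Ideal.span {y}).IsParameterIdeal := by
  have : Nontrivial (F ⧸ Ideal.span {y}) :=
    Ideal.Quotient.nontrivial_iff.2 fun h => hy (Ideal.span_singleton_eq_top.1 h)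
  have : IsLocalRing (F ⧸ Ideal.span {y}) :=
    IsLocalRing.of_surjective' (Ideal.Quotient.mk _) Ideal.Quotient.mk_surjective
  obtain ⟨n, x, hdim, hxm, hrad⟩ := exists_isSystemOfParameters (F ⧸ Ideal.span {y})
  choose x' hx' using fun i => Ideal.Quotient.mk_surjective (x i)
  have hmax := IsLocalRing.map_maximalIdeal_of_surjective
    (Ideal.Quotient.mk (Ideal.span {y})) Ideal.Quotient.mk_surjective
  have hle : Ideal.span {y} ≤ maximalIdeal F := (Ideal.span_singleton_le_iff_mem _).2 hy
  refine ⟨n + 1, 1, Nat.le_add_left 1 n, Fin.cons y x', ⟨?_, fun i => ?_, fun a ha => ?_⟩, ?_⟩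
  · rw [← ringKrullDim_quotient_span_singleton_succ_eq_ringKrullDim_of_mem_nonZeroDivisors hreg hy,
      hdim]
    rfl
  · refine Fin.cases hy (fun i => ?_) i
    rw [Fin.cons_succ, ← Ideal.mem_quotient_iff_mem hle, hmax, hx']
    exact hxm i
  · obtain ⟨k, hk⟩ := hrad (hmax ▸ Ideal.mem_map_of_mem _ ha)
    refine ⟨k, ?_⟩
    have hr : Set.range x = Ideal.Quotient.mk (Ideal.span {y}) '' Set.range x' := by
      rw [← Set.range_comp]
      exact congrArg Set.range (funext fun i => (hx' i).symm)
    rwa [← map_pow, hr, mk_mem_span_image_iff, ← Ideal.span_union, Set.singleton_union,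
      ← Fin.range_cons] at hk
  · rw [Set.range_unique]
    rfl

/-- An F-rational local ring is a domain. -/
theorem IsFRational.isDomain {p : ℕ} [Fact p.Prime] [CharP F p] (h : IsFRational F p) :
    IsDomain F := by
  have hp := (Fact.out : p.Prime)
  have hred : IsReduced F := ⟨fun x hx => by
    obtain ⟨k, hk⟩ := hx
    refine (Submodule.mem_bot F).1 (h ⊥ isParameterIdeal_bot x ⟨1, fun P hP hmem => ?_, k,
      fun e he => ?_⟩)
    · exact hP.1.1.ne_top ((Ideal.eq_top_iff_one P).2 hmem)
    · rw [pow_eq_zero_of_le (he.trans (Nat.lt_pow_self hp.one_lt).le) hk, mul_zero]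
      exact zero_mem _⟩
  by_contra hdom
  obtain ⟨b, b', hb, hb', hbb, hcirc⟩ := exists_mul_eq_zero_of_not_isDomain hdom
  have hbm : b ∈ maximalIdeal F := (mem_maximalIdeal b).2 fun hu => hb' (by
    simpa [hu.mul_right_eq_zero] using hbb)
  have hbm' : b' ∈ maximalIdeal F := (mem_maximalIdeal b').2 fun hu => hb (by
    simpa [hu.mul_left_eq_zero] using hbb)
  have hreg : b + b' ∈ nonZeroDivisors F := mem_nonZeroDivisors_iff_right.2 fun x hx =>
    mul_eq_zero_of_mem_circComplement hcirc (by rwa [mul_comm])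
  have hmem := h _ (isParameterIdeal_span_singleton (add_mem hbm hbm') hreg) b
    ⟨b + b', hcirc, 0, fun e _ => by
      have h1 : (b + b') * b ^ p ^ e = b * (b + b') ^ p ^ e := by
        have hz : b * b' ^ p ^ e = 0 := by
          rw [← Nat.sub_add_cancel (Nat.one_le_pow e p hp.pos), pow_succ', ← mul_assoc, hbb,
            zero_mul]
        have hz' : b' * b ^ p ^ e = 0 := by
          rw [← Nat.sub_add_cancel (Nat.one_le_pow e p hp.pos), pow_succ', ← mul_assoc,
            mul_comm b' b, hbb, zero_mul]
        rw [add_pow_char_pow, add_mul, mul_add, hz, hz']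
      rw [h1]
      exact Ideal.mul_mem_left _ _
        (Ideal.subset_span ⟨b + b', Ideal.mem_span_singleton_self _, rfl⟩)⟩
  obtain ⟨r, hr⟩ := Ideal.mem_span_singleton'.1 hmem
  have h2 : r * b' = 0 := by
    refine IsReduced.eq_zero _ ⟨2, ?_⟩
    linear_combination (r * b') * hr - r * (r - 1) * hbb
  have h3 : (1 - r) * b = 0 := by linear_combination h2 - hr
  rcases IsLocalRing.isUnit_or_isUnit_one_sub_self r with hu | hu
  · exact hb' (hu.mul_right_eq_zero.1 h2)
  · exact hb (hu.mul_right_eq_zero.1 h3)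

end FRational

section Assembly

variable {R S : Type*} [CommRing R] [CommRing S] [IsLocalRing S] [Algebra R S]

theorem mk_mem_maximalIdeal_iff {I : Ideal S} [IsLocalRing (S ⧸ I)] {s : S} :
    Ideal.Quotient.mk I s ∈ maximalIdeal (S ⧸ I) ↔ s ∈ maximalIdeal S := by
  have hI : I ≤ maximalIdeal S := le_maximalIdeal (Ideal.Quotient.nontrivial_iff.1 inferInstance)
  rw [← IsLocalRing.map_maximalIdeal_of_surjective (Ideal.Quotient.mk I)
    Ideal.Quotient.mk_surjective, Ideal.mem_quotient_iff_mem hI]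

theorem isLocalHom_algebraMap_quotient [IsLocalHom (algebraMap R S)] (I : Ideal S)
    [IsLocalRing (S ⧸ I)] : IsLocalHom (algebraMap R (S ⧸ I)) := by
  refine ⟨fun r hr => ?_⟩
  refine isUnit_of_map_unit (algebraMap R S) r ?_
  by_contra hn
  exact (mk_mem_maximalIdeal_iff (I := I)).2 ((mem_maximalIdeal _).2 hn) hr

theorem map_maximalIdeal_le [IsLocalRing R] [IsLocalHom (algebraMap R S)] :
    (maximalIdeal R).map (algebraMap R S) ≤ maximalIdeal S :=
  Ideal.map_le_iff_le_comap.2 fun r hr => Ideal.mem_comap.2 (map_nonunit (algebraMap R S) r hr)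

variable {d : ℕ} {z : Fin d → S}

theorem supPowers_le_pow [IsLocalRing R] [IsLocalHom (algebraMap R S)]
    (hz : ∀ i, z i ∈ maximalIdeal S) (N : ℕ) :
    supPowers ((maximalIdeal R ^ N).map (algebraMap R S)) z (fun _ => N) ≤
      maximalIdeal S ^ N := by
  refine sup_le ?_ (Ideal.span_le.2 ?_)
  · rw [Ideal.map_pow]
    exact Ideal.pow_right_mono map_maximalIdeal_le N
  · rintro _ ⟨i, rfl⟩
    exact Ideal.pow_mem_pow (hz i) N

theorem maximalIdeal_le_radical_supPowers [IsLocalRing R]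
    (hrad : maximalIdeal S ≤
      (supPowers ((maximalIdeal R).map (algebraMap R S)) z fun _ => 1).radical) (N : ℕ) :
    maximalIdeal S ≤
      (supPowers ((maximalIdeal R ^ N).map (algebraMap R S)) z fun _ => N).radical := by
  refine hrad.trans (Ideal.radical_le_radical_iff.2 (sup_le ?_ (Ideal.span_le.2 ?_)))
  · rw [Ideal.map_le_iff_le_comap]
    intro r hr
    refine ⟨N, le_supPowers _ _ _ ?_⟩
    rw [← map_pow]
    exact Ideal.mem_map_of_mem _ (Ideal.pow_mem_pow hr N)
  · rintro _ ⟨i, rfl⟩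
    exact ⟨N, by simpa using pow_mem_supPowers _ z (fun _ => N) i⟩

theorem frobSplits_or_mul_pow_mem_supPowers (p e : ℕ) [Fact p.Prime] [CharP R p] [CharP S p]
    [IsLocalRing R] [IsNoetherianRing R] [IsNoetherianRing S] [Module.Flat R S]
    [IsLocalHom (algebraMap R S)] (hS : IsFFinite S p)
    (hreg : IsPermRegularMod ((maximalIdeal R).map (algebraMap R S)) z)
    (hz : ∀ i, z i ∈ maximalIdeal S)
    (hrad : maximalIdeal S ≤
      (supPowers ((maximalIdeal R).map (algebraMap R S)) z fun _ => 1).radical) {w : S}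
    (hw : w ∉ supPowers ((maximalIdeal R).map (algebraMap R S)) z fun _ => 1)
    (hw1 : ∀ s ∈ maximalIdeal S, s * w ∈
      supPowers ((maximalIdeal R).map (algebraMap R S)) z fun _ => 1)
    (hw2 : ∀ b, (∀ s ∈ maximalIdeal S, s * b ∈
      supPowers ((maximalIdeal R).map (algebraMap R S)) z fun _ => 1) →
      b ∈ Ideal.span {w} ⊔ supPowers ((maximalIdeal R).map (algebraMap R S)) z fun _ => 1)
    (c : S) : FrobSplits p c e ∨ c * w ^ p ^ e ∈
      supPowers ((nonSplitIdeal R p e).map (algebraMap R S)) z fun _ => p ^ e := by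
  refine or_iff_not_imp_right.2 fun hc => frobSplits_of_forall_pow hS fun N => ?_
  have hflat : ∀ n : ℕ, Module.Flat R (S ⧸ Ideal.span (Set.range fun i => z i ^ n)) := hreg.flat_quotient_span_range_pow
  let Z : Ideal S := Ideal.span (Set.range fun i => z i ^ (N + 1))
  let Z₂ : Ideal S := Ideal.span (Set.range fun i => z i ^ (p ^ e + N * p ^ e))
  have _ : Module.Flat R (S ⧸ Z) := hflat _
  have _ : Module.Flat R (S ⧸ Z₂) := hflat _
  have hZle : Z ≤ maximalIdeal S := Ideal.span_le.2 <| by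
    rintro _ ⟨i, rfl⟩
    exact Ideal.pow_mem_of_mem _ (hz i) _ N.succ_pos
  have _ : Nontrivial (S ⧸ Z) := Ideal.Quotient.nontrivial_iff.2 fun h =>
    (maximalIdeal.isMaximal S).ne_top (top_le_iff.1 (h ▸ hZle))
  have _ : IsLocalRing (S ⧸ Z) :=
    IsLocalRing.of_surjective' (Ideal.Quotient.mk Z) Ideal.Quotient.mk_surjective
  have _ : IsLocalHom (algebraMap R (S ⧸ Z)) := isLocalHom_algebraMap_quotient Z
  have hFle : Z ≤ Z₂.comap (iterateFrobenius S p e) := Ideal.span_le.2 <| by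
    rintro _ ⟨i, rfl⟩
    change iterateFrobenius S p e (z i ^ (N + 1)) ∈ Z₂
    rw [iterateFrobenius_def, ← pow_mul, add_mul, one_mul, add_comm]
    exact Ideal.subset_span ⟨i, rfl⟩
  obtain ⟨l, hl⟩ := Ideal.exists_pow_le_of_le_radical_of_fg
    (maximalIdeal_le_radical_supPowers hrad (N + 1)) (IsNoetherian.noetherian _)
  have hmem : ∀ {J : Ideal R} {s : S}, Ideal.Quotient.mk Z s ∈ J.map (algebraMap R (S ⧸ Z)) ↔
      s ∈ supPowers (J.map (algebraMap R S)) z fun _ => N + 1 := mk_mem_map_iff _ Z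
  rcases exists_addMonoidHom_eq_one_or_mem (R := R) (T := S ⧸ Z) (T₂ := S ⧸ Z₂) p e
    (Ideal.quotientMap Z₂ (iterateFrobenius S p e) hFle)
    (fun r => by
      change Ideal.Quotient.mk Z₂ (iterateFrobenius S p e (algebraMap R S r)) =
        Ideal.Quotient.mk Z₂ (algebraMap R S (r ^ p ^ e))
      rw [iterateFrobenius_def, map_pow (algebraMap R S)])
    (J := maximalIdeal R ^ (N + 1)) (Ideal.pow_le_self N.succ_ne_zero) (k := N + 1) le_rfl (l := l)
    (by
      rw [← IsLocalRing.map_maximalIdeal_of_surjective (Ideal.Quotient.mk Z)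
        Ideal.Quotient.mk_surjective, ← Ideal.map_pow, Ideal.map_le_iff_le_comap]
      exact fun s hs => hmem.2 (hl hs))
    (w := Ideal.Quotient.mk Z (w * (∏ i, z i) ^ N))
    (fun h => hw (hreg.mem_of_mul_prod_pow_mem (a := N) (by
      rw [add_comm 1 N]
      exact hmem.1 h)))
    (fun s hs => by
      obtain ⟨s, rfl⟩ := Ideal.Quotient.mk_surjective s
      rw [← map_mul, hmem, ← mul_assoc, add_comm N 1]
      exact mul_prod_pow_mem_supPowers (hw1 s (mk_mem_maximalIdeal_iff.1 hs)))
    (fun b hb => by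
      obtain ⟨b, rfl⟩ := Ideal.Quotient.mk_surjective b
      obtain ⟨u, hu, v, hv, rfl⟩ := Submodule.mem_sup.1 <|
        hreg.mem_span_mul_prod_pow_sup hz hw2 (a := N) (b := b) fun s hs => by
          rw [← hmem, map_mul]
          exact hb _ (mk_mem_maximalIdeal_iff.2 hs)
      obtain ⟨r, rfl⟩ := Ideal.mem_span_singleton'.1 hu
      rw [map_add, map_mul (Ideal.Quotient.mk Z) r]
      exact Submodule.add_mem_sup (Ideal.mul_mem_left _ _ (Ideal.mem_span_singleton_self _))
        (hmem.2 hv))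
    (Ideal.Quotient.mk Z₂ c) with ⟨θ, hθ, hθ1⟩ | h
  · let I : Ideal S := supPowers ((maximalIdeal R ^ (N + 1)).map (algebraMap R S)) z fun _ => N + 1
    have hker : ∀ t ∈ (maximalIdeal R ^ (N + 1)).map (algebraMap R (S ⧸ Z)),
        Ideal.Quotient.factor (le_sup_right : Z ≤ I) t = 0 := fun t ht => by
      obtain ⟨t, rfl⟩ := Ideal.Quotient.mk_surjective t
      rw [Ideal.Quotient.factor_mk, Ideal.Quotient.eq_zero_iff_mem]
      exact hmem.1 ht
    let φ : (S ⧸ Z) ⧸ (maximalIdeal R ^ (N + 1)).map (algebraMap R (S ⧸ Z)) →+* S ⧸ I :=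
      Ideal.Quotient.lift _ _ hker
    refine ⟨I, (supPowers_le_pow hz (N + 1)).trans (Ideal.pow_le_pow_right N.le_succ),
      (φ.toAddMonoidHom.comp θ).comp (Ideal.Quotient.mk Z₂).toAddMonoidHom, fun a x => ?_, ?_⟩
    · change φ (θ (Ideal.Quotient.mk Z₂ (a ^ p ^ e * x))) =
        Ideal.Quotient.mk I a * φ (θ (Ideal.Quotient.mk Z₂ x))
      have h1 := hθ (Ideal.Quotient.mk Z a) (Ideal.Quotient.mk Z₂ x)
      rw [Ideal.quotientMap_mk, iterateFrobenius_def, ← map_mul] at h1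
      rw [h1, map_mul]
      rfl
    · change φ (θ (Ideal.Quotient.mk Z₂ c)) = 1
      rw [hθ1, map_one]
  · refine absurd ((hreg.map_ideal _).mem_of_mul_prod_pow_mem (a := N * p ^ e) ?_) hc
    rw [Ideal.quotientMap_mk, ← map_mul, mk_mem_map_iff, iterateFrobenius_def, mul_pow, ← pow_mul,
      ← mul_assoc] at h
    exact h

theorem exists_forall_mul_pow_mem_supPowers (p : ℕ) [Fact p.Prime] [CharP R p]
    [IsLocalRing R] [IsNoetherianRing R] [IsReduced R] [IsNoetherianRing S] [Module.Flat R S]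
    [IsLocalHom (algebraMap R S)] (hR : IsStronglyFRegular R p) (hf : IsFFinite R p)
    (hreg : IsPermRegularMod ((maximalIdeal R).map (algebraMap R S)) z) {c w : S} (hc0 : c ≠ 0)
    (hc : ∀ e, c * w ^ p ^ e ∈
      supPowers ((nonSplitIdeal R p e).map (algebraMap R S)) z fun _ => p ^ e) :
    ∃ t ∉ (maximalIdeal R).map (algebraMap R S), ∃ e₀, ∀ e ≥ e₀, t * w ^ p ^ e ∈
      supPowers ((maximalIdeal R).map (algebraMap R S)) z fun _ => p ^ e := by
  obtain ⟨N, hN⟩ : ∃ N, c ∉ (maximalIdeal R ^ N).map (algebraMap R S) := by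
    by_contra! h
    refine hc0 ((Submodule.mem_bot S).1 (mem_of_forall_mem_sup_pow fun k => ?_))
    refine Ideal.mem_sup_right ?_
    have hle : (maximalIdeal R ^ k).map (algebraMap R S) ≤ maximalIdeal S ^ k := by
      rw [Ideal.map_pow]
      exact Ideal.pow_right_mono map_maximalIdeal_le k
    exact hle (h k)
  obtain ⟨e₀, he₀⟩ := exists_nonSplitIdeal_le_pow hR hf N
  obtain ⟨A, ⟨hNA, hcA⟩, hmax⟩ := (wellFounded_gt (α := Ideal R)).has_min
    {A | maximalIdeal R ^ N ≤ A ∧ c ∉ A.map (algebraMap R S)} ⟨_, le_rfl, hN⟩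
  have hA : A ≠ ⊤ := fun h => hcA (by rw [h, Ideal.map_top]; exact Submodule.mem_top)
  obtain ⟨a, haA, ha⟩ := exists_socle_of_maximalIdeal_pow_le hA hNA
  have hlt : A < A ⊔ Ideal.span {a} := lt_of_le_of_ne le_sup_left fun h => haA <| by
    rw [h]; exact Ideal.mem_sup_right (Ideal.mem_span_singleton_self a)
  have hcmem : c ∈ (A ⊔ Ideal.span {a}).map (algebraMap R S) := by
    by_contra h
    exact hmax _ ⟨hNA.trans le_sup_left, h⟩ hlt
  rw [Ideal.map_sup, Ideal.map_span, Set.image_singleton] at hcmem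
  obtain ⟨j, hj, b, hb, rfl⟩ := Submodule.mem_sup.1 hcmem
  obtain ⟨t, rfl⟩ := Ideal.mem_span_singleton'.1 hb
  refine ⟨t, fun ht => hcA (add_mem hj (mul_algebraMap_mem_map ha ht)), e₀, fun e he => ?_⟩
  have _ : Module.Flat R (S ⧸ Ideal.span (Set.range fun i => z i ^ p ^ e)) :=
    hreg.flat_quotient_span_range_pow _
  refine mem_map_sup_of_smul_mem (J := A) (fun r => mem_maximalIdeal_of_mul_mem haA) ?_
  have hle : supPowers ((nonSplitIdeal R p e).map (algebraMap R S)) z (fun _ => p ^ e) ≤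
      supPowers (A.map (algebraMap R S)) z fun _ => p ^ e :=
    sup_le_sup_right (Ideal.map_mono ((he₀ e he).trans hNA)) _
  have h1 := sub_mem (hle (hc e))
    (Ideal.mul_mem_right (w ^ p ^ e) _ (le_supPowers _ z (fun _ => p ^ e) hj))
  have h2 : algebraMap R S a * (t * w ^ p ^ e) =
      (j + t * algebraMap R S a) * w ^ p ^ e - j * w ^ p ^ e := by ring
  rw [h2]
  exact h1

end Assembly

/-- **Theorem 3.6** (Aberbach). Let `(R,m,K) → (S,n,L)` be a flat local homomorphism of
F-finite reduced Noetherian local rings of prime characteristic `p` with Gorenstein closed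
fiber. If `R` is strongly F-regular and `S/mS` is F-rational, then `S` is strongly
F-regular. -/
theorem stronglyFRegular_of_flat_of_gorenstein_fiber_of_fRational_fiber
    (p : ℕ) [Fact p.Prime]
    (R S : Type*) [CommRing R] [CommRing S]
    [IsNoetherianRing R] [IsNoetherianRing S]
    [IsLocalRing R] [IsLocalRing S] [CharP R p] [CharP S p]
    [IsReduced R] [IsReduced S] (hffR : IsFFinite R p) (hffS : IsFFinite S p)
    [Algebra R S] [Module.Flat R S] [IsLocalHom (algebraMap R S)]
    [IsLocalRing (S ⧸ Ideal.map (algebraMap R S) (IsLocalRing.maximalIdeal R))]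
    (hGor : IsGorensteinLocalRing (S ⧸ Ideal.map (algebraMap R S) (IsLocalRing.maximalIdeal R)))
    (hSFR : IsStronglyFRegular R p)
    (hFrat : IsFRational (S ⧸ Ideal.map (algebraMap R S) (IsLocalRing.maximalIdeal R)) p) :
    IsStronglyFRegular S p := by
  intro c hc
  have hc0 : c ≠ 0 := by
    rintro rfl
    obtain ⟨P, hP⟩ := Ideal.nonempty_minimalPrimes (bot_ne_top : (⊥ : Ideal S) ≠ ⊤)
    exact hc P hP (zero_mem P)
  by_contra! hns
  let M : Ideal S := (maximalIdeal R).map (algebraMap R S)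
  have _ : CharP (S ⧸ M) p := by
    refine (CharP.charP_iff_prime_eq_zero Fact.out).2 ?_
    rw [← map_natCast (Ideal.Quotient.mk M), CharP.cast_eq_zero, map_zero]
  have _ : IsDomain (S ⧸ M) := hFrat.isDomain
  obtain ⟨d, x, hsop, hreg, hirr⟩ := hGor
  choose z hzx using fun i => Ideal.Quotient.mk_surjective (x i)
  obtain rfl : (fun i => Ideal.Quotient.mk M (z i)) = x := funext hzx
  have hperm : IsPermRegularMod M z := isPermRegularMod_of_isRegular hreg
  have hz : ∀ i, z i ∈ maximalIdeal S := fun i => mk_mem_maximalIdeal_iff.1 (hsop.2.1 i)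
  have hmem : ∀ {n : ℕ} {g : S}, g ∈ supPowers M z (fun _ => n) ↔ Ideal.Quotient.mk M g ∈
      Ideal.span (Set.range fun i => Ideal.Quotient.mk M (z i) ^ n) := fun {n g} => by
    rw [supPowers, ← mk_mem_span_image_iff, ← Set.range_comp]
    simp only [Function.comp_def, map_pow]
  have hmem1 : ∀ {g : S}, g ∈ supPowers M z (fun _ => 1) ↔ Ideal.Quotient.mk M g ∈
      Ideal.span (Set.range fun i => Ideal.Quotient.mk M (z i)) := by
    simpa only [pow_one] using fun {g : S} => hmem (n := 1) (g := g)
  obtain ⟨k, hk⟩ := Ideal.exists_pow_le_of_le_radical_of_fg hsop.2.2 (IsNoetherian.noetherian _)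
  obtain ⟨w, hw, hwm⟩ := exists_socle_of_maximalIdeal_pow_le hirr.1 hk
  obtain ⟨w, rfl⟩ := Ideal.Quotient.mk_surjective w
  have hmul : ∀ e, c * w ^ p ^ e ∈
      supPowers ((nonSplitIdeal R p e).map (algebraMap R S)) z fun _ => p ^ e := fun e =>
    (frobSplits_or_mul_pow_mem_supPowers p e hffS hperm hz
      (fun s hs => by
        obtain ⟨n, hn⟩ := hsop.2.2 (mk_mem_maximalIdeal_iff.2 hs)
        exact ⟨n, hmem1.2 (by rwa [map_pow])⟩)
      (fun h => hw (hmem1.1 h))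
      (fun s hs => hmem1.2 (by
        rw [map_mul]
        exact hwm _ (mk_mem_maximalIdeal_iff.2 hs)))
      (fun b hb => by
        have h1 := hirr.mem_span_sup (b := Ideal.Quotient.mk M b) hw fun s hs => by
          obtain ⟨s, rfl⟩ := Ideal.Quotient.mk_surjective s
          rw [← map_mul]
          exact hmem1.1 (hb s (mk_mem_maximalIdeal_iff.1 hs))
        obtain ⟨u, hu, v, hv, huv⟩ := Submodule.mem_sup.1 h1
        obtain ⟨r, rfl⟩ := Ideal.mem_span_singleton'.1 hu
        obtain ⟨r, rfl⟩ := Ideal.Quotient.mk_surjective r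
        rw [← sub_add_cancel b (r * w), add_comm]
        refine Submodule.add_mem_sup
          (Ideal.mul_mem_left _ _ (Ideal.mem_span_singleton_self _)) (hmem1.2 ?_)
        rwa [map_sub, map_mul, ← huv, add_sub_cancel_left]) c).resolve_left (hns e)
  obtain ⟨t, ht, e₀, hte⟩ :=
    exists_forall_mul_pow_mem_supPowers p hSFR hffR hperm hc0 hmul
  refine hw (hFrat _ ⟨d, d, le_rfl, _, hsop, rfl⟩ _ ⟨Ideal.Quotient.mk M t, fun P hP htP => ?_,
    e₀, fun e he => ?_⟩)
  · rw [IsDomain.minimalPrimes_eq_singleton_bot, Set.mem_singleton_iff] at hP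
    rw [hP, Submodule.mem_bot, Ideal.Quotient.eq_zero_iff_mem] at htP
    exact ht htP
  · have h1 := hmem.1 (hte e he)
    rw [map_mul, map_pow] at h1
    refine (Ideal.span_mono ?_) h1
    rintro _ ⟨i, rfl⟩
    exact ⟨_, Ideal.subset_span ⟨i, rfl⟩, rfl⟩
end

section
/- Let φ:(R,m,K)→(S,n,L) be a flat local homomorphism of Noetherian local rings of prime characteristic p with S/mS Gorenstein. Let z_1,…,z_d ∈ S be elements whose images form a system of parameters in S/mS, and write (z)^[t] = (z_1^t,…,z_d^t)S. Let I ⊆ R be an ideal with ℓ(R/I) < ∞ and dim_K((I :_R m)/I) = 1. Assume that R and S have a common test element c ∈ R° (with image in S°) and that S/mS is F-injective. Then the following are equivalent: (i) I is tightly closed in R; (ii) IS + (z)^[t] is tightly closed in S for every t > 0; (iii) IS + (z)^[t] is tightly closed in S for some t > 0. -/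
open IsLocalRing

/-- The socle `(I :_R m)/I` of `R ⧸ I` is one-dimensional over the residue field,
with (the image of) `u` as a generator. -/
def GeneratesSocle {R : Type*} [CommRing R] [IsLocalRing R] (I : Ideal R) (u : R) : Prop :=
  u ∈ Submodule.colon I (maximalIdeal R) ∧ u ∉ I ∧
    ∀ v ∈ Submodule.colon I (maximalIdeal R), ∃ r : R, v - r * u ∈ I

/-- `dim_K ((I :_R m)/I) = 1`: the socle of `R ⧸ I` is one-dimensional over the
residue field. -/
def SocleDimOne {R : Type*} [CommRing R] [IsLocalRing R] (I : Ideal R) : Prop :=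
  ∃ u : R, GeneratesSocle I u

section Exchange

variable {A : Type*} [CommRing A] [IsLocalRing A]

theorem generatesSocle_iff {K : Ideal A} {u : A} : GeneratesSocle K u ↔
    (∀ a ∈ maximalIdeal A, a * u ∈ K) ∧ u ∉ K ∧
      ∀ v, (∀ a ∈ maximalIdeal A, a * v ∈ K) → v ∈ Ideal.span {u} ⊔ K := by
  have hcolon : ∀ v, v ∈ Submodule.colon K (maximalIdeal A : Set A) ↔
      ∀ a ∈ maximalIdeal A, a * v ∈ K := fun v => by
    rw [Submodule.mem_colon]
    exact forall₂_congr fun a _ => by rw [smul_eq_mul, mul_comm]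
  simp only [GeneratesSocle, hcolon]
  refine and_congr_right fun _ => and_congr_right fun _ => forall₂_congr fun v _ => ?_
  rw [Ideal.mem_span_singleton_sup]
  refine exists_congr fun r => ⟨fun h => ⟨_, h, by ring⟩, ?_⟩
  rintro ⟨b, hb, rfl⟩
  simpa using hb

/-- The sequence `l` is regular modulo `K`, and the socle modulo `K` and `l` is one-dimensional. -/
def IsGorensteinSequence : Ideal A → List A → Prop
  | K, [] => SocleDimOne K
  | K, x :: l => (∀ b, x * b ∈ K → b ∈ K) ∧ IsGorensteinSequence (Ideal.span {x} ⊔ K) l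

theorem IsGorensteinSequence.socleDimOne {K : Ideal A} {l : List A}
    (h : IsGorensteinSequence K l) : SocleDimOne (Ideal.ofList l ⊔ K) := by
  induction l generalizing K with
  | nil =>
    have h : SocleDimOne K := h
    simpa using h
  | cons x l ih => simpa only [Ideal.ofList_cons, sup_comm, sup_left_comm] using! ih h.2

theorem isGorensteinSequence_of_take {K : Ideal A} {l : List A}
    (hreg : ∀ (i : ℕ) (hi : i < l.length) (b : A),
      l[i] * b ∈ Ideal.ofList (l.take i) ⊔ K → b ∈ Ideal.ofList (l.take i) ⊔ K)
    (hsoc : SocleDimOne (Ideal.ofList l ⊔ K)) : IsGorensteinSequence K l := by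
  induction l generalizing K with
  | nil => simpa using! hsoc
  | cons x l ih =>
    refine ⟨fun b hb => by simpa using hreg 0 (by simp) b (by simpa using hb), ih ?_ ?_⟩
    · intro i hi b hb
      have := hreg (i + 1) (by simpa using hi) b
      simp only [List.getElem_cons_succ, List.take_succ_cons, Ideal.ofList_cons] at this
      rw [sup_left_comm, ← sup_assoc] at hb ⊢
      exact this hb
    · rw [Ideal.ofList_cons] at hsoc
      rwa [sup_left_comm, ← sup_assoc]

theorem IsGorensteinSequence.swap [IsNoetherianRing A] {K : Ideal A} {x y : A} {l : List A}
    (hx : x ∈ maximalIdeal A) (h : IsGorensteinSequence K (x :: y :: l)) :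
    IsGorensteinSequence K (y :: x :: l) := by
  obtain ⟨h₁, h₂, h₃⟩ := h
  have hy : ∀ b, y * b ∈ K → b ∈ K := by
    let N : Ideal A := K.colon {y}
    have hN : N ≤ K ⊔ Ideal.span {x} • N := by
      intro b hb
      have hb' : y * b ∈ K := by simpa [N, mul_comm] using hb
      obtain ⟨c, k, hk, rfl⟩ := Ideal.mem_span_singleton_sup.1 (h₂ b (Ideal.mem_sup_right hb'))
      have hc : y * c ∈ K := h₁ _ (by
        rw [show x * (y * c) = y * (c * x + k) - y * k by ring]
        exact K.sub_mem hb' (K.mul_mem_left _ hk))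
      rw [add_comm, mul_comm]
      exact Submodule.add_mem_sup hk (Submodule.smul_mem_smul (Ideal.mem_span_singleton_self x)
        (by simpa [N, mul_comm] using hc))
    have := Submodule.le_of_le_smul_of_le_jacobson_bot (IsNoetherian.noetherian N)
      (I := Ideal.span {x}) (N := K) (by
        rw [IsLocalRing.jacobson_eq_maximalIdeal ⊥ bot_ne_top, Ideal.span_singleton_le_iff_mem]
        exact hx) hN
    exact fun b hb => this (by simpa [N, mul_comm] using hb)
  refine ⟨hy, fun b hb => ?_, ?_⟩
  · obtain ⟨c, k, hk, e⟩ := Ideal.mem_span_singleton_sup.1 hb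
    obtain ⟨c', k', hk', rfl⟩ := Ideal.mem_span_singleton_sup.1 (h₂ c
      (Ideal.mem_span_singleton_sup.2 ⟨b, -k, K.neg_mem hk, by linear_combination -e⟩))
    refine Ideal.mem_span_singleton_sup.2 ⟨c', b - c' * y, h₁ _ ?_, by ring⟩
    rw [show x * (b - c' * y) = k' * y + k by linear_combination -e]
    exact K.add_mem (K.mul_mem_right _ hk') hk
  · rwa [sup_left_comm]

theorem IsGorensteinSequence.perm [IsNoetherianRing A] {K : Ideal A} {l l' : List A}
    (hl : ∀ x ∈ l, x ∈ maximalIdeal A) (hp : l.Perm l') (h : IsGorensteinSequence K l) :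
    IsGorensteinSequence K l' := by
  induction hp generalizing K with
  | nil => exact h
  | cons x _ ih => exact ⟨h.1, ih (fun y hy => hl y (List.mem_cons_of_mem _ hy)) h.2⟩
  | swap x y l => exact h.swap (hl _ (by simp))
  | trans h₁ _ ih₁ ih₂ => exact ih₂ (fun x hx => hl x (h₁.mem_iff.2 hx)) (ih₁ hl h)

theorem IsGorensteinSequence.exchange_singleton {K : Ideal A} {x y : A}
    (hx : x ∈ maximalIdeal A) (hy : y ∈ maximalIdeal A)
    (hr : maximalIdeal A ≤ (Ideal.span {y} ⊔ K).radical) (h : IsGorensteinSequence K [x]) :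
    IsGorensteinSequence K [y] := by
  obtain ⟨hxr, u, hu⟩ := h
  obtain ⟨hu₁, hu₂, hu₃⟩ := generatesSocle_iff.1 hu
  have hyr : ∀ b, y * b ∈ K → b ∈ K := by
    intro b hb
    obtain ⟨n, hn⟩ := hr hx
    obtain ⟨c, k, hk, e⟩ := Ideal.mem_span_singleton_sup.1 hn
    have hpow : ∀ m, x ^ m * b ∈ K → b ∈ K := by
      intro m
      induction m with
      | zero => simp
      | succ m ih => exact fun h => ih (hxr _ (by rwa [← mul_assoc, ← pow_succ']))
    refine hpow n ?_
    rw [← e, show (c * y + k) * b = c * (y * b) + k * b by ring]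
    exact K.add_mem (K.mul_mem_left _ hb) (K.mul_mem_right _ hk)
  obtain ⟨u', k, hk, e⟩ := Ideal.mem_span_singleton_sup.1 (hu₁ y hy)
  refine ⟨hyr, u', generatesSocle_iff.2 ⟨fun a ha => ?_, fun hu' => hu₂ ?_, fun v hv => ?_⟩⟩
  · obtain ⟨b, k', hk', e'⟩ := Ideal.mem_span_singleton_sup.1 (hu₁ a ha)
    refine Ideal.mem_span_singleton_sup.2 ⟨b, a * u' - b * y, hxr _ ?_, by ring⟩
    rw [show x * (a * u' - b * y) = y * k' - a * k by linear_combination a * e - y * e']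
    exact K.sub_mem (K.mul_mem_left _ hk') (K.mul_mem_left _ hk)
  · obtain ⟨c, k', hk', rfl⟩ := Ideal.mem_span_singleton_sup.1 hu'
    refine Ideal.mem_span_singleton_sup.2 ⟨c, u - c * x, hyr _ ?_, by ring⟩
    rw [show y * (u - c * x) = k' * x + k by linear_combination -e]
    exact K.add_mem (K.mul_mem_right _ hk') hk
  · obtain ⟨v', l, hl, e₁⟩ := Ideal.mem_span_singleton_sup.1 (hv x hx)
    have hv' : v' ∈ Ideal.span {u} ⊔ (Ideal.span {x} ⊔ K) := by
      refine hu₃ v' fun a ha => ?_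
      obtain ⟨b, k', hk', e'⟩ := Ideal.mem_span_singleton_sup.1 (hv a ha)
      refine Ideal.mem_span_singleton_sup.2 ⟨b, a * v' - b * x, hyr _ ?_, by ring⟩
      rw [show y * (a * v' - b * x) = x * k' - a * l by linear_combination a * e₁ - x * e']
      exact K.sub_mem (K.mul_mem_left _ hk') (K.mul_mem_left _ hl)
    obtain ⟨r, _, hw, rfl⟩ := Ideal.mem_span_singleton_sup.1 hv'
    obtain ⟨s, k', hk', rfl⟩ := Ideal.mem_span_singleton_sup.1 hw
    refine Ideal.mem_span_singleton_sup.2 ⟨r, v - r * u', ?_, by ring⟩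
    refine Ideal.mem_span_singleton_sup.2 ⟨s, v - r * u' - s * y, hxr _ ?_, by ring⟩
    rw [show x * (v - r * u' - s * y) = r * k + k' * y + l by linear_combination -e₁ - r * e]
    exact K.add_mem (K.add_mem (K.mul_mem_left _ hk) (K.mul_mem_right _ hk')) hl

theorem IsGorensteinSequence.exchange_last {K : Ideal A} {x y : A} {l : List A}
    (hx : x ∈ maximalIdeal A) (hy : y ∈ maximalIdeal A)
    (hr : maximalIdeal A ≤ (Ideal.ofList (y :: l) ⊔ K).radical)
    (h : IsGorensteinSequence K (l ++ [x])) : IsGorensteinSequence K (l ++ [y]) := by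
  induction l generalizing K with
  | nil => exact exchange_singleton hx hy (by simpa using hr) h
  | cons a l ih =>
    refine ⟨h.1, ih ?_ h.2⟩
    convert hr using 2
    simp only [Ideal.ofList_cons]
    ac_rfl

theorem exists_mem_maximalIdeal_le_radical [IsNoetherianRing A] {I J : Ideal A} {x z : A}
    (hxm : x ∈ maximalIdeal A) (hzm : z ∈ maximalIdeal A)
    (hx : maximalIdeal A ≤ (Ideal.span {x} ⊔ I).radical)
    (hz : maximalIdeal A ≤ (Ideal.span {z} ⊔ J).radical) :
    ∃ y ∈ maximalIdeal A, maximalIdeal A ≤ (Ideal.span {y} ⊔ I).radical ∧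
      maximalIdeal A ≤ (Ideal.span {y} ⊔ J).radical := by
  let T : Set (Ideal A) := (I.minimalPrimes ∪ J.minimalPrimes) \ {maximalIdeal A}
  have hT : T.Finite := ((I.finite_minimalPrimes_of_isNoetherianRing A).union
    (J.finite_minimalPrimes_of_isNoetherianRing A)).sdiff
  have hprime : ∀ P ∈ T, P.IsPrime := fun P hP => hP.1.elim (fun h => h.1.1) fun h => h.1.1
  obtain ⟨y, hy, hyT⟩ : ∃ y ∈ maximalIdeal A, ∀ P ∈ T, y ∉ P := by
    by_contra! hcon
    have hsub : (maximalIdeal A : Set A) ⊆ ⋃ P ∈ (hT.toFinset : Set (Ideal A)), (P : Set A) := by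
      intro y hy
      obtain ⟨P, hP, hyP⟩ := hcon y hy
      simpa using ⟨P, hP, hyP⟩
    obtain ⟨P, hP, hle⟩ := (Ideal.subset_union_prime (f := fun P : Ideal A => P) ⊤ ⊤
      (fun P hP _ _ => hprime P (by simpa using hP))).1 hsub
    have hP : P ∈ T := by simpa using hP
    have := hprime P hP
    exact hP.2 ((maximalIdeal.isMaximal A).eq_of_le this.ne_top hle).symm
  have key : ∀ (L : Ideal A) (w : A), w ∈ maximalIdeal A → maximalIdeal A ≤ (Ideal.span {w} ⊔ L).radical →
      L.minimalPrimes \ {maximalIdeal A} ⊆ T →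
      maximalIdeal A ≤ (Ideal.span {y} ⊔ L).radical := by
    intro L w hwm hw hL
    rw [Ideal.radical_eq_sInf]
    refine le_sInf fun Q ⟨hQ, hQp⟩ => ?_
    by_contra hne
    have hlt : Q < maximalIdeal A := lt_of_le_of_ne (le_maximalIdeal hQp.ne_top)
      fun h => hne h.ge
    have hLQ : L ≤ Q := le_sup_right.trans hQ
    have hspan : Ideal.span (insert w (L : Set A)) = Ideal.span {w} ⊔ L := by
      rw [Ideal.span_insert, Ideal.span_eq]
    have hmin : Q ∈ (Ideal.span (L : Set A)).minimalPrimes := by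
      refine Ideal.mem_minimalPrimes_span_of_mem_minimalPrimes_span_insert hlt w L ?_ L hLQ ?_
      · rw [hspan]
        refine ⟨⟨inferInstance, sup_le ((Ideal.span_singleton_le_iff_mem _).2 hwm)
          (hLQ.trans hlt.le)⟩, fun P ⟨hP, hP'⟩ _ => ?_⟩
        exact hw.trans (hP.radical_le_iff.2 hP')
      · exact fun a ha => Ideal.le_radical (Ideal.subset_span (Set.mem_insert_of_mem _ ha))
    rw [Ideal.span_eq] at hmin
    exact hyT Q (hL ⟨hmin, hlt.ne⟩) (hQ (Ideal.mem_sup_left (Ideal.mem_span_singleton_self y)))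
  exact ⟨y, hy, key I x hxm hx (Set.sdiff_subset_sdiff_left Set.subset_union_left),
    key J z hzm hz (Set.sdiff_subset_sdiff_left Set.subset_union_right)⟩

theorem IsGorensteinSequence.of_le_radical [IsNoetherianRing A] {K : Ideal A} {l l' : List A}
    (hl : ∀ x ∈ l, x ∈ maximalIdeal A) (hl' : ∀ x ∈ l', x ∈ maximalIdeal A)
    (hlen : l.length = l'.length)
    (hr : maximalIdeal A ≤ (Ideal.ofList l ⊔ K).radical)
    (hr' : maximalIdeal A ≤ (Ideal.ofList l' ⊔ K).radical)
    (h : IsGorensteinSequence K l) : IsGorensteinSequence K l' := by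
  induction l generalizing K l' with
  | nil =>
    obtain rfl := List.length_eq_zero_iff.1 hlen.symm
    exact h
  | cons x l ih =>
    obtain _ | ⟨z, l'⟩ := l'
    · simp at hlen
    rw [List.forall_mem_cons] at hl hl'
    obtain ⟨y, hy, h₁, h₂⟩ := exists_mem_maximalIdeal_le_radical (A := A)
      (I := Ideal.ofList l ⊔ K) (J := Ideal.ofList l' ⊔ K) hl.1 hl'.1
      (by simpa [sup_assoc] using hr) (by simpa [sup_assoc] using hr')
    have step : ∀ {a b : A} {m : List A}, a ∈ maximalIdeal A → b ∈ maximalIdeal A →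
        (∀ c ∈ m, c ∈ maximalIdeal A) →
        maximalIdeal A ≤ (Ideal.span {b} ⊔ (Ideal.ofList m ⊔ K)).radical →
        IsGorensteinSequence K (a :: m) → IsGorensteinSequence K (b :: m) := by
      intro a b m ha hb hm hrad hseq
      refine (exchange_last ha hb (by simpa [sup_assoc] using hrad)
        (hseq.perm (by simpa using ⟨ha, hm⟩) (List.perm_append_singleton a m).symm)).perm ?_
        (List.perm_append_singleton b m)
      simpa [or_imp, forall_and] using ⟨hm, hb⟩
    have hy' := step hl.1 hy hl.2 h₁ h
    refine step hy hl'.1 hl'.2 (by simpa [sup_assoc] using hr') ⟨hy'.1, ?_⟩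
    exact ih hl.2 hl'.2 (by simpa using hlen) (by rwa [sup_left_comm]) (by rwa [sup_left_comm])
      hy'.2

end Exchange

section Socle

variable {A : Type*} [CommRing A]

theorem Ideal.ofList_ofFn {n : ℕ} (x : Fin n → A) :
    Ideal.ofList (List.ofFn x) = Ideal.span (Set.range x) := by
  simp only [Ideal.ofList, List.mem_ofFn', Set.ofPred_mem_eq]

theorem exists_notMem_forall_mul_mem {P J : Ideal A} (hP : P ≠ ⊤) (hJ : J.FG)
    (h : J ≤ P.radical) : ∃ a ∉ P, ∀ b ∈ J, b * a ∈ P := by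
  classical
  have hex : ∃ n, J ^ n ≤ P := Ideal.exists_pow_le_of_le_radical_of_fg h hJ
  obtain ⟨k, hk⟩ : ∃ k, Nat.find hex = k + 1 :=
    Nat.exists_eq_succ_of_ne_zero fun h0 => hP (by simpa [h0] using Nat.find_spec hex)
  obtain ⟨a, ha, haP⟩ := SetLike.not_le_iff_exists.1 (Nat.find_min hex (m := k) (by omega))
  refine ⟨a, haP, fun b hb => Nat.find_spec hex ?_⟩
  rw [hk, pow_succ']
  exact Ideal.mul_mem_mul hb ha

variable [IsLocalRing A] [IsNoetherianRing A]

theorem Ideal.IsIrreducible.socleDimOne {Q : Ideal A} (hQ : Q.IsIrreducible)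
    (hr : maximalIdeal A ≤ Q.radical) : SocleDimOne Q := by
  obtain ⟨u, hu, hmu⟩ := exists_notMem_forall_mul_mem hQ.1 (IsNoetherian.noetherian _) hr
  refine ⟨u, generatesSocle_iff.2 ⟨hmu, hu, fun v hv => ?_⟩⟩
  by_contra hvu
  have hinf : Q = (Ideal.span {u} ⊔ Q) ⊓ (Ideal.span {v} ⊔ Q) := by
    refine le_antisymm (le_inf le_sup_right le_sup_right) fun y ⟨h₁, h₂⟩ => ?_
    obtain ⟨s, k, hk, rfl⟩ := Ideal.mem_span_singleton_sup.1 h₂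
    by_cases hs : s ∈ maximalIdeal A
    · exact Q.add_mem (hv s hs) hk
    · have hs : IsUnit s := by simpa using hs
      refine absurd ?_ hvu
      refine (Ideal.unit_mul_mem_iff_mem _ hs).1 ?_
      simpa using Ideal.sub_mem _ h₁ (Ideal.mem_sup_right hk)
  have hself : ∀ y, y ∈ Ideal.span {y} ⊔ Q := fun y =>
    Ideal.mem_sup_left (Ideal.mem_span_singleton_self y)
  rcases hQ.2 _ _ hinf with h | h
  · exact hu (h ▸ hself u)
  · exact hvu (Ideal.mem_sup_right (h ▸ hself v))

theorem GeneratesSocle.exists_mul_sub_mem {Q : Ideal A} {w y : A} (hw : GeneratesSocle Q w)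
    (hr : maximalIdeal A ≤ Q.radical) (hy : y ∉ Q) : ∃ s, s * y - w ∈ Q := by
  obtain ⟨hw₁, -, hw₃⟩ := generatesSocle_iff.1 hw
  obtain ⟨a, ha, hma⟩ := exists_notMem_forall_mul_mem (P := Submodule.colon Q {y})
    (J := maximalIdeal A) (fun h => hy <| by
      simpa using (Ideal.eq_top_iff_one _).1 h) (IsNoetherian.noetherian _)
    (hr.trans (Ideal.radical_mono fun b hb => by simpa using Q.mul_mem_right y hb))
  simp only [Submodule.mem_colon_singleton, smul_eq_mul, mul_assoc] at ha hma
  obtain ⟨r, k, hk, e⟩ := Ideal.mem_span_singleton_sup.1 (hw₃ _ hma)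
  have hr : IsUnit r := by
    by_contra hr
    exact ha (e ▸ Q.add_mem (hw₁ r (by simpa using hr)) hk)
  obtain ⟨r', hr'⟩ := hr.exists_left_inv
  refine ⟨r' * a, ?_⟩
  rw [show r' * a * y - w = r' * k by linear_combination -r' * e + w * hr']
  exact Q.mul_mem_left _ hk

theorem IsGorensteinSequence.comap {A B : Type*} [CommRing A] [CommRing B] [IsLocalRing A]
    [IsLocalRing B] {f : A →+* B} (hf : Function.Surjective f) {K : Ideal B} {l : List A}
    (h : IsGorensteinSequence K (l.map f)) : IsGorensteinSequence (K.comap f) l := by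
  have hloc : IsLocalHom f := IsLocalHom.of_surjective f hf
  induction l generalizing K with
  | nil =>
    obtain ⟨u, hu⟩ : SocleDimOne K := h
    obtain ⟨u, rfl⟩ := hf u
    obtain ⟨h₁, h₂, h₃⟩ := generatesSocle_iff.1 hu
    refine ⟨u, generatesSocle_iff.2 ⟨fun a ha => ?_, h₂, fun v hv => ?_⟩⟩
    · simpa using h₁ (f a) ((map_mem_nonunits_iff f a).2 ha)
    · have hfv : f v ∈ Ideal.span {f u} ⊔ K := by
        refine h₃ _ fun b hb => ?_
        obtain ⟨a, rfl⟩ := hf b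
        simpa using hv a ((map_mem_nonunits_iff f a).1 hb)
      obtain ⟨r, k, hk, e⟩ := Ideal.mem_span_singleton_sup.1 hfv
      obtain ⟨r, rfl⟩ := hf r
      refine Ideal.mem_span_singleton_sup.2 ⟨r, v - r * u, ?_, by ring⟩
      simpa [← e] using hk
  | cons x l ih =>
    refine ⟨fun b hb => h.1 (f b) (by simpa using hb), ?_⟩
    convert ih h.2 using 1
    ext v
    rw [Ideal.mem_comap, Ideal.mem_span_singleton_sup, Ideal.mem_span_singleton_sup]
    constructor
    · rintro ⟨r, k, hk, rfl⟩
      exact ⟨f r, f k, hk, by simp⟩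
    · rintro ⟨r, k, hk, e⟩
      obtain ⟨r, rfl⟩ := hf r
      exact ⟨r, v - r * x, by simpa [← e] using hk, by ring⟩

theorem isGorensteinSequence_of_isRegular {n : ℕ} {x : Fin n → A}
    (hreg : RingTheory.Sequence.IsRegular A (List.ofFn x))
    (hirr : (Ideal.span (Set.range x)).IsIrreducible)
    (hrad : maximalIdeal A ≤ (Ideal.span (Set.range x)).radical) :
    IsGorensteinSequence ⊥ (List.ofFn x) := by
  refine isGorensteinSequence_of_take (fun i hi b hb => ?_) ?_
  · have := (hreg.toIsWeaklyRegular.regular_mod_prev i hi)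
    rw [sup_bot_eq] at hb ⊢
    have h0 := @this (Submodule.Quotient.mk b) 0
    simp only [smul_zero, ← Submodule.Quotient.mk_smul, Submodule.Quotient.mk_eq_zero] at h0
    simpa using h0 (by simpa using hb)
  · rw [sup_bot_eq, Ideal.ofList_ofFn]
    exact hirr.socleDimOne hrad

end Socle

section SystemOfParameters

variable {A : Type*} [CommRing A] [IsLocalRing A]

theorem IsSystemOfParameters.pow {n : ℕ} {x : Fin n → A} (hx : IsSystemOfParameters A x) {t : ℕ}
    (ht : 0 < t) : IsSystemOfParameters A fun i => x i ^ t := by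
  refine ⟨hx.1, fun i => Ideal.pow_mem_of_mem _ (hx.2.1 i) t ht, hx.2.2.trans ?_⟩
  rw [← Ideal.radical_idem (Ideal.span (Set.range fun i => x i ^ t))]
  refine Ideal.radical_mono (Ideal.span_le.2 ?_)
  rintro _ ⟨i, rfl⟩
  exact ⟨t, Ideal.subset_span ⟨i, rfl⟩⟩

theorem IsGorensteinLocalRing.isGorensteinSequence [IsNoetherianRing A]
    (h : IsGorensteinLocalRing A) {n : ℕ} {z : Fin n → A} (hz : IsSystemOfParameters A z) :
    IsGorensteinSequence ⊥ (List.ofFn z) := by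
  obtain ⟨k, x, hx, hreg, hirr⟩ := h
  obtain rfl : k = n := by exact_mod_cast hx.1.symm.trans hz.1
  refine (isGorensteinSequence_of_isRegular hreg hirr hx.2.2).of_le_radical ?_ ?_ (by simp) ?_ ?_
  · simpa [List.mem_ofFn'] using hx.2.1
  · simpa [List.mem_ofFn'] using hz.2.1
  · simpa [Ideal.ofList_ofFn] using hx.2.2
  · simpa [Ideal.ofList_ofFn] using hz.2.2

end SystemOfParameters

section Flat

variable {R S : Type*} [CommRing R] [CommRing S] [Algebra R S]

/-- The quotient `S ⧸ K` behaves like a flat `R`-module with respect to ideals of `R` primary to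
the maximal ideal: extension to `S ⧸ K` commutes with colons by elements and with intersections. -/
structure IsFlatModulo (R : Type*) {S : Type*} [CommRing R] [CommRing S] [IsLocalRing R]
    [Algebra R S] (K : Ideal S) : Prop where
  colon : ∀ J : Ideal R, maximalIdeal R ≤ J.radical → ∀ (a : R) (x : S),
    algebraMap R S a * x ∈ J.map (algebraMap R S) ⊔ K →
      x ∈ Ideal.map (algebraMap R S) (Submodule.colon J {a}) ⊔ K
  inf : ∀ J J' : Ideal R, maximalIdeal R ≤ J.radical → maximalIdeal R ≤ J'.radical → ∀ x : S,
    x ∈ J.map (algebraMap R S) ⊔ K → x ∈ J'.map (algebraMap R S) ⊔ K →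
      x ∈ (J ⊓ J').map (algebraMap R S) ⊔ K

theorem Ideal.exists_sum_smul_eq_of_mem_map {J : Ideal R} {x : S}
    (hx : x ∈ J.map (algebraMap R S)) :
    ∃ (t : Finset R) (c : t → S), (∀ i ∈ t, i ∈ J) ∧ ∑ i : t, (i : R) • c i = x := by
  obtain ⟨t, ht, c, h⟩ := (Submodule.mem_span_image_iff_exists_fun S).1 hx
  exact ⟨t, c, ht, by simpa [Algebra.smul_def, mul_comm] using h⟩

variable [IsLocalRing R]

theorem isFlatModulo_bot [Module.Flat R S] : IsFlatModulo R (⊥ : Ideal S) := by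
  refine ⟨fun J _ a x hx => ?_, fun J J' _ _ x hx hx' => ?_⟩
  · rw [sup_bot_eq] at hx ⊢
    obtain ⟨t, c, ht, e⟩ := Ideal.exists_sum_smul_eq_of_mem_map hx
    obtain ⟨k, b, y, h₁, h₂⟩ := Module.Flat.isTrivialRelation_of_sum_smul_eq_zero
      (f := fun o : Option t => o.elim a fun i => -(i : R))
      (x := fun o : Option t => o.elim x c)
      (by simp [Fintype.sum_option, -Finset.univ_eq_attach, e, Algebra.smul_def a])
    rw [show x = ∑ j, b none j • y j from h₁ none]
    refine Ideal.sum_mem _ fun j _ => ?_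
    rw [Algebra.smul_def]
    refine Ideal.mul_mem_right _ _ (Ideal.mem_map_of_mem _ ?_)
    have := h₂ j
    simp only [Fintype.sum_option, Option.elim_none, Option.elim_some, neg_mul,
      Finset.sum_neg_distrib, add_neg_eq_zero] at this
    rw [Submodule.mem_colon_singleton, smul_eq_mul, mul_comm, this]
    exact J.sum_mem fun i _ => J.mul_mem_right _ (ht i i.2)
  · rw [sup_bot_eq] at hx hx' ⊢
    obtain ⟨t, c, ht, e⟩ := Ideal.exists_sum_smul_eq_of_mem_map hx
    obtain ⟨t', c', ht', e'⟩ := Ideal.exists_sum_smul_eq_of_mem_map hx'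
    obtain ⟨k, b, y, h₁, h₂⟩ := Module.Flat.isTrivialRelation_of_sum_smul_eq_zero
      (f := Sum.elim (fun i : t => (i : R)) fun i : t' => -(i : R)) (x := Sum.elim c c')
      (by simp [Fintype.sum_sum_type, -Finset.univ_eq_attach, e, e'])
    have hc : ∀ i, c i = ∑ j, b (Sum.inl i) j • y j := fun i => h₁ (Sum.inl i)
    have hx : x = ∑ j, (∑ i : t, (i : R) * b (Sum.inl i) j) • y j := by
      simp only [← e, hc, Finset.smul_sum, Finset.sum_smul, smul_smul]
      exact Finset.sum_comm
    rw [hx]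
    refine Ideal.sum_mem _ fun j _ => ?_
    rw [Algebra.smul_def]
    refine Ideal.mul_mem_right _ _ (Ideal.mem_map_of_mem _ ⟨?_, ?_⟩)
    · exact J.sum_mem fun i _ => J.mul_mem_right _ (ht i i.2)
    · have := h₂ j
      simp only [Fintype.sum_sum_type, Sum.elim_inl, Sum.elim_inr, neg_mul,
        Finset.sum_neg_distrib, add_neg_eq_zero] at this
      rw [this]
      exact J'.sum_mem fun i _ => J'.mul_mem_right _ (ht' i i.2)

theorem colon_singleton_le_maximalIdeal {J : Ideal R} {a : R} (ha : a ∉ J) :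
    Submodule.colon J {a} ≤ maximalIdeal R :=
  le_maximalIdeal fun h => ha (by simpa using (Ideal.eq_top_iff_one _).1 h)

theorem IsFlatModulo.mem_of_mul_mem [IsNoetherianRing R] {K : Ideal S} (hK : IsFlatModulo R K)
    {f : S} (hf : ∀ b, f * b ∈ (maximalIdeal R).map (algebraMap R S) ⊔ K →
      b ∈ (maximalIdeal R).map (algebraMap R S) ⊔ K)
    (J : Ideal R) (hJ : maximalIdeal R ≤ J.radical) (b : S)
    (hb : f * b ∈ J.map (algebraMap R S) ⊔ K) : b ∈ J.map (algebraMap R S) ⊔ K := by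
  induction J using IsNoetherian.induction generalizing b with
  | hgt J ih =>
    by_cases hJt : J = ⊤
    · simp [hJt, Ideal.map_top]
    obtain ⟨a, ha, hma⟩ := exists_notMem_forall_mul_mem hJt (IsNoetherian.noetherian _) hJ
    have hlt : J < Ideal.span {a} ⊔ J :=
      lt_of_le_of_ne le_sup_right fun h =>
        ha (h ▸ Ideal.mem_sup_left (Ideal.mem_span_singleton_self a))
    have hb' := ih _ hlt (hJ.trans (Ideal.radical_mono hlt.le)) b
      (sup_le_sup_right (Ideal.map_mono hlt.le) K hb)
    rw [Ideal.map_sup, Ideal.map_span, Set.image_singleton, sup_assoc,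
      Ideal.mem_span_singleton_sup] at hb'
    obtain ⟨y, k, hk, rfl⟩ := hb'
    have hfy : f * y ∈ (maximalIdeal R).map (algebraMap R S) ⊔ K := by
      refine sup_le_sup_right (Ideal.map_mono (colon_singleton_le_maximalIdeal ha)) K
        (hK.colon J hJ a _ ?_)
      rw [show algebraMap R S a * (f * y) = f * (y * algebraMap R S a + k) - f * k by ring]
      exact Ideal.sub_mem _ hb (Ideal.mul_mem_left _ _ hk)
    obtain ⟨g, hg, k', hk', e⟩ := Submodule.mem_sup.1 (hf y hfy)
    refine Ideal.add_mem _ ?_ hk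
    rw [← e, add_mul]
    refine Ideal.add_mem _ (Ideal.mem_sup_left ?_) (Ideal.mem_sup_right (K.mul_mem_right _ hk'))
    have : (maximalIdeal R).map (algebraMap R S) ≤
        Submodule.colon (Ideal.map (algebraMap R S) J) {algebraMap R S a} :=
      Ideal.map_le_iff_le_comap.2 fun r hr => by
        simpa [← map_mul] using Ideal.mem_map_of_mem (algebraMap R S) (hma r hr)
    simpa using this hg

theorem IsFlatModulo.span_singleton_sup [IsNoetherianRing R] {K : Ideal S}
    (hK : IsFlatModulo R K) {f : S}
    (hf : ∀ b, f * b ∈ (maximalIdeal R).map (algebraMap R S) ⊔ K →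
      b ∈ (maximalIdeal R).map (algebraMap R S) ⊔ K) :
    IsFlatModulo R (Ideal.span {f} ⊔ K) := by
  have hreg := hK.mem_of_mul_mem hf
  refine ⟨fun J hJ a x hx => ?_, fun J J' hJ hJ' x hx hx' => ?_⟩
  · rw [sup_left_comm, Ideal.mem_span_singleton_sup] at hx ⊢
    obtain ⟨y, k, hk, e⟩ := hx
    have hy : y ∈ (Ideal.span {a} ⊔ J).map (algebraMap R S) ⊔ K := by
      refine hreg _ (hJ.trans (Ideal.radical_mono le_sup_right)) y ?_
      rw [Ideal.map_sup, Ideal.map_span, Set.image_singleton, sup_assoc,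
        Ideal.mem_span_singleton_sup]
      exact ⟨x, -k, neg_mem hk, by linear_combination -e⟩
    rw [Ideal.map_sup, Ideal.map_span, Set.image_singleton, sup_assoc,
      Ideal.mem_span_singleton_sup] at hy
    obtain ⟨y', k', hk', rfl⟩ := hy
    refine ⟨y', x - y' * f, hK.colon J hJ a _ ?_, by ring⟩
    rw [show algebraMap R S a * (x - y' * f) = k' * f + k by linear_combination -e]
    exact Ideal.add_mem _ (Ideal.mul_mem_right _ _ hk') hk
  · rw [sup_left_comm, Ideal.mem_span_singleton_sup] at hx hx' ⊢
    obtain ⟨y, k, hk, e⟩ := hx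
    obtain ⟨y', k', hk', rfl⟩ := hx'
    have hy : y - y' ∈ (J ⊔ J').map (algebraMap R S) ⊔ K := by
      refine hreg _ (hJ.trans (Ideal.radical_mono le_sup_left)) _ ?_
      rw [show f * (y - y') = k' - k by linear_combination e]
      exact Ideal.sub_mem _ (sup_le_sup_right (Ideal.map_mono le_sup_right) K hk')
        (sup_le_sup_right (Ideal.map_mono le_sup_left) K hk)
    rw [Ideal.map_sup, sup_assoc] at hy
    obtain ⟨g, hg, g', hg', e'⟩ := Submodule.mem_sup.1 hy
    refine ⟨y - g, f * g + k, hK.inf J J' hJ hJ' _ ?_ ?_, by linear_combination e⟩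
    · exact Ideal.add_mem _ (Ideal.mem_sup_left (Ideal.mul_mem_left _ _ hg)) hk
    · rw [show f * g + k = k' - f * g' by linear_combination f * e' + e]
      exact Ideal.sub_mem _ hk' (Ideal.mul_mem_left _ _ hg')

theorem IsFlatModulo.ofList_sup [IsNoetherianRing R] [IsLocalRing S] {K : Ideal S}
    (hK : IsFlatModulo R K) {l : List S}
    (hl : IsGorensteinSequence ((maximalIdeal R).map (algebraMap R S) ⊔ K) l) :
    IsFlatModulo R (Ideal.ofList l ⊔ K) := by
  induction l generalizing K with
  | nil => simpa using hK
  | cons x l ih =>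
    have := ih (hK.span_singleton_sup hl.1) (by rw [sup_left_comm]; exact hl.2)
    rwa [sup_left_comm, ← sup_assoc, ← Ideal.ofList_cons] at this

theorem IsFlatModulo.finset_inf {K : Ideal S} (hK : IsFlatModulo R K) {ι : Type*} (s : Finset ι)
    (J : ι → Ideal R) (hJ : ∀ i ∈ s, maximalIdeal R ≤ (J i).radical) {x : S}
    (hx : ∀ i ∈ s, x ∈ (J i).map (algebraMap R S) ⊔ K) :
    x ∈ (s.inf J).map (algebraMap R S) ⊔ K := by
  classical
  have hrad : ∀ s : Finset ι, (∀ i ∈ s, maximalIdeal R ≤ (J i).radical) →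
      maximalIdeal R ≤ (s.inf J).radical := by
    intro s hs
    induction s using Finset.induction_on with
    | empty => simp [Ideal.radical_top]
    | insert j s _ ih =>
      simp only [Finset.forall_mem_insert] at hs
      rw [Finset.inf_insert, Ideal.radical_inf]
      exact le_inf hs.1 (ih hs.2)
  induction s using Finset.induction_on with
  | empty => simp [Ideal.map_top]
  | insert i s _ ih =>
    simp only [Finset.forall_mem_insert] at hJ hx
    rw [Finset.inf_insert]
    exact hK.inf _ _ hJ.1 (hrad s hJ.2) x hx.1 (ih hJ.2 hx.2)

/-- Elements killed by the maximal ideal of `R` modulo an extended ideal come from the socle. -/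
theorem IsFlatModulo.mem_map_colon_maximalIdeal [IsNoetherianRing R] {K : Ideal S}
    (hK : IsFlatModulo R K) {J : Ideal R} (hJ : maximalIdeal R ≤ J.radical) {x : S}
    (hx : ∀ a ∈ maximalIdeal R, algebraMap R S a * x ∈ J.map (algebraMap R S) ⊔ K) :
    x ∈ Ideal.map (algebraMap R S) (Submodule.colon J (maximalIdeal R : Set R)) ⊔ K := by
  obtain ⟨s, hs⟩ := IsNoetherian.noetherian (maximalIdeal R)
  have hmem : ∀ a ∈ s, a ∈ maximalIdeal R := fun a ha => hs ▸ Submodule.subset_span ha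
  have h := hK.finset_inf s (fun a => Submodule.colon J {a})
    (fun a _ => hJ.trans (Ideal.radical_mono fun r hr => by
      simpa using J.mul_mem_right a hr))
    (fun a ha => hK.colon J hJ a x (hx a (hmem a ha)))
  refine sup_le_sup_right (Ideal.map_mono fun r hr => ?_) K h
  have hle : maximalIdeal R ≤ Submodule.colon J {r} := by
    rw [← hs, Submodule.span_le]
    intro a ha
    have := (Submodule.mem_finsetInf.1 hr) a ha
    simpa [mul_comm] using this
  rw [Submodule.mem_colon]
  intro a ha
  simpa [mul_comm] using hle ha

end Flat

theorem Ideal.radical_le_radical_frobPow {R : Type*} [CommRing R] (I : Ideal R) (q : ℕ) :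
    I.radical ≤ (I.frobPow q).radical := by
  rw [← Ideal.radical_idem (I.frobPow q)]
  exact Ideal.radical_mono fun x hx => ⟨q, Ideal.subset_span ⟨x, hx, rfl⟩⟩

section Frobenius

variable {R S : Type*} [CommRing R] [CommRing S] (p : ℕ) [Fact p.Prime] [CharP R p]

theorem Ideal.frobPow_eq_map (I : Ideal R) (e : ℕ) :
    I.frobPow (p ^ e) = I.map (iterateFrobenius R p e) := rfl

theorem Ideal.frobPow_map [CharP S p] (f : R →+* S) (I : Ideal R) (e : ℕ) :
    (I.map f).frobPow (p ^ e) = (I.frobPow (p ^ e)).map f := by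
  rw [frobPow_eq_map, frobPow_eq_map, map_map, map_map]
  congr 1
  ext x
  simp [iterateFrobenius_def]

theorem Ideal.frobPow_sup_span_range (I : Ideal R) {ι : Type*} (z : ι → R) (e : ℕ) :
    (I ⊔ span (Set.range z)).frobPow (p ^ e) =
      I.frobPow (p ^ e) ⊔ span (Set.range fun i => z i ^ p ^ e) := by
  rw [frobPow_eq_map, frobPow_eq_map, map_sup, map_span, ← Set.range_comp]
  rfl

theorem MemTightClosure.map [CharP S p] {f : R →+* S} {I : Ideal R} {J : Ideal S} {x : R} {c : R}
    (hc : IsTestElement p c) (hfc : f c ∈ circComplement S) (hIJ : I.map f ≤ J)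
    (hx : MemTightClosure p I x) : MemTightClosure p J (f x) := by
  refine ⟨f c, hfc, 0, fun e _ => ?_⟩
  have h := Ideal.mem_map_of_mem f (hc.2 I x hx e)
  rw [← Ideal.frobPow_map, map_mul, map_pow] at h
  exact Ideal.map_mono (f := iterateFrobenius S p e) hIJ h

theorem MemTightClosure.of_mul_sub_mem {I : Ideal R} {x y s : R} (hx : MemTightClosure p I x)
    (h : s * x - y ∈ I) : MemTightClosure p I y := by
  obtain ⟨c, hc, N, hN⟩ := hx
  refine ⟨c, hc, N, fun e he => ?_⟩
  have hy : y ^ p ^ e = s ^ p ^ e * x ^ p ^ e - (s * x - y) ^ p ^ e := by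
    rw [sub_pow_char_pow, mul_pow, sub_sub_cancel]
  have hmem : (s * x - y) ^ p ^ e ∈ I.frobPow (p ^ e) := Ideal.subset_span ⟨_, h, rfl⟩
  rw [hy, mul_sub, mul_left_comm]
  exact Ideal.sub_mem _ (Ideal.mul_mem_left _ _ (hN e he)) (Ideal.mul_mem_left _ _ hmem)

end Frobenius

theorem le_radical_of_isFiniteLength_quotient {R : Type*} [CommRing R] [IsLocalRing R]
    {I : Ideal R} (h : IsFiniteLength R (R ⧸ I)) : maximalIdeal R ≤ I.radical := by
  intro x hx
  have : IsArtinian R (R ⧸ I) := (isFiniteLength_iff_isNoetherian_isArtinian.1 h).2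
  obtain ⟨n, y, hy⟩ := IsArtinian.exists_pow_succ_smul_dvd x (1 : R ⧸ I)
  obtain ⟨y, rfl⟩ := Ideal.Quotient.mk_surjective y
  refine ⟨n, ?_⟩
  have hmem : x ^ n * (x * y - 1) ∈ I := by
    rw [← Ideal.Quotient.eq_zero_iff_mem, mul_sub, mul_one, ← mul_assoc, ← pow_succ, map_sub,
      sub_eq_zero]
    simpa [Algebra.smul_def] using! hy
  have hu : IsUnit (x * y - 1) := by
    rw [← neg_sub, IsUnit.neg_iff]
    exact isUnit_one_sub_self_of_mem_nonunits _ (Ideal.mul_mem_right y _ hx)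
  exact (Ideal.mul_unit_mem_iff_mem I hu).1 hmem

section LocalHom

variable {R S : Type*} [CommRing R] [CommRing S] [IsLocalRing R] [IsLocalRing S] [Algebra R S]

theorem maximalIdeal_map_le [IsLocalHom (algebraMap R S)] : (maximalIdeal R).map (algebraMap R S) ≤ maximalIdeal S :=
  ((local_hom_TFAE (algebraMap R S)).out 0 2).1 ‹_›

/-- Extension to `S ⧸ Z` is faithful on ideals primary to the maximal ideal. -/
theorem IsFlatModulo.mem_of_algebraMap_mem [IsLocalHom (algebraMap R S)] {Z : Ideal S} (hZ : IsFlatModulo R Z)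
    (hZn : Z ≤ maximalIdeal S) {I : Ideal R} (hI : maximalIdeal R ≤ I.radical) {x : R}
    (hx : algebraMap R S x ∈ I.map (algebraMap R S) ⊔ Z) : x ∈ I := by
  by_contra hxI
  have h1 := hZ.colon I hI x 1 (by simpa using hx)
  exact one_notMem_nonunits (sup_le ((Ideal.map_mono (colon_singleton_le_maximalIdeal hxI)).trans
    maximalIdeal_map_le) hZn h1)

theorem IsFlatModulo.exists_mul_sub_mem [IsNoetherianRing R] [IsNoetherianRing S] {Z : Ideal S}
    (hZ : IsFlatModulo R Z) {I : Ideal R} (hI : maximalIdeal R ≤ I.radical)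
    {u : R} (hu : GeneratesSocle I u) {w : S}
    (hw : GeneratesSocle ((maximalIdeal R).map (algebraMap R S) ⊔ Z) w)
    (hr : maximalIdeal S ≤ ((maximalIdeal R).map (algebraMap R S) ⊔ Z).radical) {x : S}
    (hx : x ∉ I.map (algebraMap R S) ⊔ Z) :
    ∃ s : S, s * x - algebraMap R S u * w ∈ I.map (algebraMap R S) ⊔ Z := by
  set K := I.map (algebraMap R S) ⊔ Z with hK
  obtain ⟨a, ha, hma⟩ := exists_notMem_forall_mul_mem
    (P := (Submodule.colon K {x}).comap (algebraMap R S)) (J := maximalIdeal R)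
    (fun h => hx <| by simpa using (Ideal.eq_top_iff_one _).1 h) (IsNoetherian.noetherian _)
    (hI.trans (Ideal.radical_mono fun b hb => by
      simpa using K.mul_mem_right x (Ideal.mem_sup_left (Ideal.mem_map_of_mem _ hb))))
  simp only [Ideal.mem_comap, Submodule.mem_colon_singleton, smul_eq_mul, map_mul,
    mul_assoc] at ha hma
  obtain ⟨hu₁, -, hu₃⟩ := generatesSocle_iff.1 hu
  have hmu : ∀ g ∈ (maximalIdeal R).map (algebraMap R S) ⊔ Z, algebraMap R S u * g ∈ K := by
    intro g hg
    have hle : (maximalIdeal R).map (algebraMap R S) ⊔ Z ≤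
        Submodule.colon K {algebraMap R S u} := by
      refine sup_le (Ideal.map_le_iff_le_comap.2 fun r hr => ?_) fun k hk => ?_
      · have := Ideal.mem_map_of_mem (algebraMap R S) (hu₁ r hr)
        rw [map_mul] at this
        simpa using Ideal.mem_sup_left this
      · simpa using K.mul_mem_right _ (Ideal.mem_sup_right hk)
    simpa [mul_comm] using hle hg
  have hmem : algebraMap R S a * x ∈ Ideal.span {algebraMap R S u} ⊔ K := by
    have hle : Submodule.colon I (maximalIdeal R : Set R) ≤ Ideal.span {u} ⊔ I := fun v hv =>
      hu₃ v fun b hb => by simpa [mul_comm] using Submodule.mem_colon.1 hv b hb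
    have := sup_le_sup_right (Ideal.map_mono (f := algebraMap R S) hle) Z
      (hZ.mem_map_colon_maximalIdeal hI hma)
    rwa [Ideal.map_sup, Ideal.map_span, Set.image_singleton, sup_assoc] at this
  obtain ⟨y, k, hk, e⟩ := Ideal.mem_span_singleton_sup.1 hmem
  have hy : y ∉ (maximalIdeal R).map (algebraMap R S) ⊔ Z := fun hy =>
    ha (by rw [← e, mul_comm y]; exact K.add_mem (hmu y hy) hk)
  obtain ⟨s, hs⟩ := hw.exists_mul_sub_mem hr hy
  refine ⟨s * algebraMap R S a, ?_⟩
  rw [show s * algebraMap R S a * x - algebraMap R S u * w =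
    algebraMap R S u * (s * y - w) + s * k by linear_combination -s * e]
  exact K.add_mem (hmu _ hs) (K.mul_mem_left _ hk)

end LocalHom

theorem Ideal.mem_sup_span_range_iff {S : Type*} [CommRing S] {M : Ideal S} {ι : Type*} {z : ι → S}
    {y : S} :
    y ∈ M ⊔ Ideal.span (Set.range z) ↔
      Ideal.Quotient.mk M y ∈ Ideal.span (Set.range fun i => Ideal.Quotient.mk M (z i)) := by
  rw [show (Set.range fun i => Ideal.Quotient.mk M (z i)) = Ideal.Quotient.mk M '' Set.range z from
    Set.range_comp _ _, ← Ideal.map_span, Ideal.mem_quotient_iff_mem_sup, sup_comm]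

theorem IsSystemOfParameters.mem_of_pow_mem {S : Type*} [CommRing S] {M : Ideal S}
    [IsLocalRing (S ⧸ M)] {d p : ℕ} {z : Fin d → S}
    (hz : IsSystemOfParameters (S ⧸ M) fun i => Ideal.Quotient.mk M (z i))
    (hFinj : IsFInjective (S ⧸ M) p) {w : S} {e : ℕ}
    (hw : w ^ p ^ e ∈ M ⊔ Ideal.span (Set.range fun i => z i ^ p ^ e)) :
    w ∈ M ⊔ Ideal.span (Set.range z) := by
  rw [Ideal.mem_sup_span_range_iff] at hw ⊢
  refine hFinj _ ⟨d, d, le_rfl, _, hz, rfl⟩ _ ⟨e, ?_⟩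
  rw [← map_pow]
  refine Ideal.span_le.2 ?_ hw
  rintro _ ⟨i, rfl⟩
  exact Ideal.subset_span ⟨_, Ideal.subset_span ⟨i, rfl⟩, by simp⟩

section ClosedFiber

variable {S : Type*} [CommRing S] [IsLocalRing S] {M : Ideal S} [IsLocalRing (S ⧸ M)]
  {d : ℕ} {z : Fin d → S}

theorem IsSystemOfParameters.isGorensteinSequence_of_quotient [IsNoetherianRing S]
    (hz : IsSystemOfParameters (S ⧸ M) fun i => Ideal.Quotient.mk M (z i))
    (hGor : IsGorensteinLocalRing (S ⧸ M)) : IsGorensteinSequence M (List.ofFn z) := by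
  have h := hGor.isGorensteinSequence hz
  rw [show (fun i => Ideal.Quotient.mk M (z i)) = Ideal.Quotient.mk M ∘ z from rfl,
    ← List.map_ofFn] at h
  simpa [← RingHom.ker_eq_comap_bot] using h.comap Ideal.Quotient.mk_surjective

theorem IsSystemOfParameters.mem_maximalIdeal_of_quotient
    (hz : IsSystemOfParameters (S ⧸ M) fun i => Ideal.Quotient.mk M (z i)) (i : Fin d) :
    z i ∈ maximalIdeal S :=
  have := IsLocalHom.of_surjective (Ideal.Quotient.mk M) Ideal.Quotient.mk_surjective
  (map_mem_nonunits_iff (Ideal.Quotient.mk M) _).1 (hz.2.1 i)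

theorem IsSystemOfParameters.le_radical_of_quotient
    (hz : IsSystemOfParameters (S ⧸ M) fun i => Ideal.Quotient.mk M (z i)) :
    maximalIdeal S ≤ (M ⊔ Ideal.span (Set.range z)).radical := by
  have := IsLocalHom.of_surjective (Ideal.Quotient.mk M) Ideal.Quotient.mk_surjective
  intro y hy
  obtain ⟨n, hn⟩ := hz.2.2 ((map_mem_nonunits_iff (Ideal.Quotient.mk M) y).2 hy)
  exact ⟨n, Ideal.mem_sup_span_range_iff.2 (by simpa using hn)⟩

end ClosedFiber

/-- **Proposition 3.2(1)** (Aberbach). Let `φ : (R,m,K) → (S,n,L)` be a flat local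
homomorphism of Noetherian local rings of prime characteristic `p` with `S/mS` Gorenstein,
let `z₁,…,z_d ∈ S` induce a system of parameters of `S/mS`, and let `I ⊆ R` with
`ℓ(R/I) < ∞` and one-dimensional socle. If `R` and `S` have a common test element
`c ∈ R°` and `S/mS` is F-injective, then: `I` is tightly closed in `R` iff
`IS + (z)^[t]` is tightly closed in `S` for every `t > 0` iff `IS + (z)^[t]` is
tightly closed in `S` for some `t > 0`. -/
theorem tightlyClosed_extension_iff_of_common_test_element
    (p : ℕ) [Fact p.Prime]
    (R S : Type*) [CommRing R] [CommRing S]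
    [IsNoetherianRing R] [IsNoetherianRing S]
    [IsLocalRing R] [IsLocalRing S] [CharP R p] [CharP S p]
    [Algebra R S] [Module.Flat R S] [IsLocalHom (algebraMap R S)]
    [IsLocalRing (S ⧸ Ideal.map (algebraMap R S) (IsLocalRing.maximalIdeal R))]
    (hGor : IsGorensteinLocalRing (S ⧸ Ideal.map (algebraMap R S) (IsLocalRing.maximalIdeal R)))
    (d : ℕ) (z : Fin d → S)
    (hz : IsSystemOfParameters (S ⧸ Ideal.map (algebraMap R S) (IsLocalRing.maximalIdeal R))
      (fun i => Ideal.Quotient.mk (Ideal.map (algebraMap R S) (IsLocalRing.maximalIdeal R)) (z i)))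
    (I : Ideal R) (hlen : IsFiniteLength R (R ⧸ I)) (hsoc : SocleDimOne I)
    (c : R) (hcR : IsTestElement p c) (hcS : IsTestElement p (algebraMap R S c))
    (hFinj : IsFInjective (S ⧸ Ideal.map (algebraMap R S) (IsLocalRing.maximalIdeal R)) p) :
    (I.IsTightlyClosed p ↔ ∀ t : ℕ, 0 < t →
      (Ideal.map (algebraMap R S) I ⊔
        Ideal.span (Set.range fun i => z i ^ t)).IsTightlyClosed p) ∧
    (I.IsTightlyClosed p ↔ ∃ t : ℕ, 0 < t ∧
      (Ideal.map (algebraMap R S) I ⊔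
        Ideal.span (Set.range fun i => z i ^ t)).IsTightlyClosed p) := by
  set M := Ideal.map (algebraMap R S) (maximalIdeal R)
  have hI : maximalIdeal R ≤ I.radical := le_radical_of_isFiniteLength_quotient hlen
  have hzt : ∀ t : ℕ, 0 < t → IsSystemOfParameters (S ⧸ M)
      fun i => Ideal.Quotient.mk M (z i ^ t) := fun t ht => by
    simpa only [map_pow] using hz.pow ht
  have hflat : ∀ t : ℕ, 0 < t → IsFlatModulo R (Ideal.span (Set.range fun i => z i ^ t)) := by
    intro t ht
    have h := (isFlatModulo_bot (R := R) (S := S)).ofList_sup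
      (by rw [sup_bot_eq]; exact (hzt t ht).isGorensteinSequence_of_quotient hGor)
    rwa [sup_bot_eq, Ideal.ofList_ofFn] at h
  have key : I.IsTightlyClosed p → ∀ t : ℕ, 0 < t →
      (I.map (algebraMap R S) ⊔ Ideal.span (Set.range fun i => z i ^ t)).IsTightlyClosed p := by
    intro hclosed t ht x hx
    by_contra hxK
    obtain ⟨u, hu⟩ := hsoc
    obtain ⟨w, hw⟩ := ((hzt t ht).isGorensteinSequence_of_quotient hGor).socleDimOne
    rw [Ideal.ofList_ofFn, sup_comm] at hw
    obtain ⟨s, hs⟩ := (hflat t ht).exists_mul_sub_mem hI hu hw (hzt t ht).le_radical_of_quotient hxK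
    obtain ⟨e, he⟩ : ∃ e, c * u ^ p ^ e ∉ I.frobPow (p ^ e) := by
      by_contra! h
      exact hu.2.1 (hclosed u ⟨c, hcR.1, 0, fun e _ => h e⟩)
    have hmem := hcS.2 _ _ (hx.of_mul_sub_mem p hs) e
    rw [Ideal.frobPow_sup_span_range, Ideal.frobPow_map, mul_pow, ← mul_assoc, ← map_pow,
      ← map_mul] at hmem
    have hpow : ∀ i, (z i ^ t) ^ p ^ e = z i ^ (t * p ^ e) := fun i => (pow_mul _ _ _).symm
    have hwq := (hflat (t * p ^ e) (Nat.mul_pos ht (pow_pos (Fact.out : p.Prime).pos e))).colon _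
      (hI.trans (I.radical_le_radical_frobPow _)) _ _ (by simpa only [hpow] using hmem)
    refine (generatesSocle_iff.1 hw).2.1 ((hzt t ht).mem_of_pow_mem hFinj (e := e) ?_)
    have hle := Ideal.map_mono (f := algebraMap R S) (colon_singleton_le_maximalIdeal he)
    simpa only [hpow] using sup_le_sup_right hle _ hwq
  have descent : ∀ t : ℕ, 0 < t →
      (I.map (algebraMap R S) ⊔ Ideal.span (Set.range fun i => z i ^ t)).IsTightlyClosed p →
      I.IsTightlyClosed p := by
    intro t ht hclosed x hx
    refine (hflat t ht).mem_of_algebraMap_mem (Ideal.span_le.2 ?_) hI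
      (hclosed _ (hx.map p hcR hcS.1 le_sup_left))
    rintro _ ⟨i, rfl⟩
    exact (hzt t ht).mem_maximalIdeal_of_quotient i
  exact ⟨⟨key, fun h => descent 1 one_pos (h 1 one_pos)⟩,
    ⟨fun h => ⟨1, one_pos, key h 1 one_pos⟩, fun ⟨t, ht, h⟩ => descent t ht h⟩⟩
end
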